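/- Let q be an odd prime power. For every real number u with |u| < 1/q, the series ∑_{n=0}^∞ NS_n u^n / |Sp(2n,q)| converges, the families of factors (1 + u^i) for i ≥ 1 and (1 - u^i q^{-(2l+1)})^{-1} for pairs (i,l) with i ≥ 1, l ≥ 0 are multipliable in ℝ, and ∑_{n=0}^∞ NS_n u^n / |Sp(2n,q)| = ∏_{i ≥ 1} (1 + u^i) · ∏_{i ≥ 1} ∏_{l ≥ 0} (1 - u^i q^{-(2l+1)})^{-1}. -/

import Mathlib

open Matrix

/-- The `2n × 2n` matrix `J = [[0, I],[-I, 0]]` defining the symplectic group. -/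
noncomputable def sympJ (F : Type) [Field F] (n : ℕ) :
    Matrix (Fin n ⊕ Fin n) (Fin n ⊕ Fin n) F :=
  Matrix.fromBlocks 0 1 (-1) 0

/-- `|Sp(2n,q)| = q^{n²} ∏_{i=1}^n (q^{2i} - 1)`, as a real number. -/
noncomputable def spOrder (q n : ℕ) : ℝ :=
  (q : ℝ) ^ (n ^ 2) * ∏ i ∈ Finset.range n, ((q : ℝ) ^ (2 * (i + 1)) - 1)

/-- `NS_n`: the number of ordered pairs of commuting nilpotent elements of the Lie algebra
`sp(2n,q) = {A : A·J = (A·J)ᵀ}`. -/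
noncomputable def spNilCommPairs (F : Type) [Field F] [Fintype F] (n : ℕ) : ℕ :=
  Nat.card {P : Matrix (Fin n ⊕ Fin n) (Fin n ⊕ Fin n) F ×
      Matrix (Fin n ⊕ Fin n) (Fin n ⊕ Fin n) F //
    P.1 * sympJ F n = (P.1 * sympJ F n)ᵀ ∧ P.2 * sympJ F n = (P.2 * sympJ F n)ᵀ ∧
    IsNilpotent P.1 ∧ IsNilpotent P.2 ∧ P.1 * P.2 = P.2 * P.1}


namespace FF

section basics
variable {F : Type} [Field F]
variable {ι κ γ : Type} [Fintype ι] [Fintype κ] [Fintype γ] [DecidableEq ι] [DecidableEq κ]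
  [DecidableEq γ]

lemma block_pow (A : Matrix κ κ F) (B : Matrix κ γ F) (D : Matrix γ γ F) (n : ℕ) :
    ∃ X, (fromBlocks A B 0 D) ^ n = fromBlocks (A ^ n) X 0 (D ^ n) := by
  induction n with
  | zero => exact ⟨0, by simp⟩
  | succ n ih =>
    obtain ⟨X, hX⟩ := ih
    refine ⟨A ^ n * B + X * D, ?_⟩
    rw [pow_succ, hX, fromBlocks_multiply]
    simp [pow_succ]

lemma nilp_block (A : Matrix κ κ F) (B : Matrix κ γ F) (D : Matrix γ γ F) :
    IsNilpotent (fromBlocks A B 0 D) ↔ IsNilpotent A ∧ IsNilpotent D := by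
  constructor
  · rintro ⟨n, hn⟩
    obtain ⟨X, hX⟩ := block_pow A B D n
    rw [hX, ← fromBlocks_zero, fromBlocks_inj] at hn
    exact ⟨⟨n, hn.1⟩, ⟨n, hn.2.2.2⟩⟩
  · rintro ⟨⟨n, hn⟩, ⟨m, hm⟩⟩
    obtain ⟨X, hX⟩ := block_pow A B D (n + m)
    refine ⟨(n + m) + (n + m), ?_⟩
    rw [pow_add _ (n + m), hX, pow_add A, hn, pow_add D, hm]
    simp [fromBlocks_multiply]

lemma exists_frame {S S' : Submodule F (ι → F)} (h : IsCompl S S')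
    (hS : Module.finrank F S = Fintype.card κ) (hS' : Module.finrank F S' = Fintype.card γ) :
    ∃ (P : Matrix ι (κ ⊕ γ) F) (P' : Matrix (κ ⊕ γ) ι F), P * P' = 1 ∧ P' * P = 1 ∧
      (∀ x, P *ᵥ (Sum.elim x 0) ∈ S) ∧ (∀ y, P *ᵥ (Sum.elim 0 y) ∈ S') := by
  have e1 : (κ → F) ≃ₗ[F] S := LinearEquiv.ofFinrankEq _ _ (by simp [hS])
  have e2 : (γ → F) ≃ₗ[F] S' := LinearEquiv.ofFinrankEq _ _ (by simp [hS'])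
  let e : (κ ⊕ γ → F) ≃ₗ[F] (ι → F) :=
    (LinearEquiv.sumArrowLequivProdArrow κ γ F F).trans
      ((LinearEquiv.prodCongr e1 e2).trans (Submodule.prodEquivOfIsCompl S S' h))
  refine ⟨LinearMap.toMatrix' e.toLinearMap, LinearMap.toMatrix' e.symm.toLinearMap, ?_, ?_, ?_, ?_⟩
  · rw [← LinearMap.toMatrix'_comp]; simp
  · rw [← LinearMap.toMatrix'_comp]; simp
  · intro x
    rw [LinearMap.toMatrix'_mulVec]
    have : e (Sum.elim x 0) = e1 x := by
      simp [e, LinearEquiv.sumArrowLequivProdArrow, Equiv.sumArrowEquivProdArrow]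
    simp [this]
  · intro x
    rw [LinearMap.toMatrix'_mulVec]
    have : e (Sum.elim 0 x) = e2 x := by
      simp [e, LinearEquiv.sumArrowLequivProdArrow, Equiv.sumArrowEquivProdArrow]
    simp [this]

lemma exists_perm (h : Fintype.card ι = Fintype.card κ) :
    ∃ (P : Matrix ι κ F) (P' : Matrix κ ι F), P * P' = 1 ∧ P' * P = 1 := by
  have e : (κ → F) ≃ₗ[F] (ι → F) := LinearEquiv.ofFinrankEq _ _ (by simp [h])
  refine ⟨LinearMap.toMatrix' e.toLinearMap, LinearMap.toMatrix' e.symm.toLinearMap, ?_, ?_⟩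
  · rw [← LinearMap.toMatrix'_comp]; simp
  · rw [← LinearMap.toMatrix'_comp]; simp

end basics

section count

lemma group_count {G α : Type} [Group G] [Finite G] [Finite α] (act : G → α → α)
    (h1 : ∀ x, act 1 x = x) (hm : ∀ g h x, act (g * h) x = act g (act h x))
    (X Y : Set α) (hX : ∀ g, ∀ x ∈ X, act g x ∈ X) (hYX : Y ⊆ X) (H : Set G)
    (hex : ∀ x ∈ X, ∃ g, act g x ∈ Y) (hH : ∀ y ∈ Y, ∀ g, act g y ∈ Y ↔ g ∈ H) :
    Nat.card X * Nat.card H = Nat.card G * Nat.card Y := by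
  choose g hg using hex
  rw [← Nat.card_prod, ← Nat.card_prod]
  have hinv : ∀ g x, act g⁻¹ (act g x) = x := fun g x => by rw [← hm]; simp [h1]
  have hinv' : ∀ g x, act g (act g⁻¹ x) = x := fun g x => by rw [← hm]; simp [h1]
  -- both sides are in bijection with {(x,g) | act g x ∈ Y}
  refine Nat.card_congr (Equiv.mk
    (fun p => (p.2.1 * g p.1.1 p.1.2,
      ⟨act (p.2.1 * g p.1.1 p.1.2) p.1.1, by
        rw [hm]; exact (hH _ (hg _ _) _).2 p.2.2⟩))
    (fun p => (⟨act p.1⁻¹ p.2.1, hX _ _ (hYX p.2.2)⟩,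
      ⟨p.1 * (g (act p.1⁻¹ p.2.1) (hX _ _ (hYX p.2.2)))⁻¹, by
        rw [← hH _ (hg (act p.1⁻¹ p.2.1) (hX _ _ (hYX p.2.2)))]
        rw [← hm]
        simp [hinv', p.2.2]⟩)) ?_ ?_)
  · rintro ⟨⟨x, hx⟩, ⟨h, hh⟩⟩
    simp [hinv]
    have : act ((h * g x hx)⁻¹) (act (h * g x hx) x) = x := hinv _ _
    simp at this
    simp [this]
  · rintro ⟨k, ⟨y, hy⟩⟩
    simp [hinv']

end count

section glcard
variable {F : Type} [Field F] [Fintype F]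

/-- order of GL_v as a real number -/
noncomputable def gl (F : Type) [Fintype F] (v : ℕ) : ℝ :=
  ∏ i ∈ Finset.range v, ((Fintype.card F : ℝ) ^ v - (Fintype.card F : ℝ) ^ i)

lemma one_lt_card : 1 < (Fintype.card F : ℝ) := by
  exact_mod_cast Fintype.one_lt_card

lemma gl_pos (v : ℕ) : 0 < gl F v := by
  apply Finset.prod_pos
  intro i hi
  rw [sub_pos]
  exact pow_lt_pow_right₀ one_lt_card (Finset.mem_range.1 hi)

lemma card_indep_aux {V : Type} [AddCommGroup V] [Module F V] [Finite V] {k : ℕ}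
    (hk : k ≤ Module.finrank F V) :
    (Nat.card { s : Fin k → V // LinearIndependent F s } : ℝ) =
      ∏ i ∈ Finset.range k, ((Fintype.card F : ℝ) ^ (Module.finrank F V) - (Fintype.card F : ℝ) ^ i) := by
  rw [card_linearIndependent hk, Finset.prod_range (n := k), Nat.cast_prod]
  refine Finset.prod_congr rfl fun i _ => ?_
  rw [Nat.cast_sub]
  · simp
  · exact Nat.pow_le_pow_right Fintype.card_pos (by omega)

lemma card_GL (ι : Type) [Fintype ι] [DecidableEq ι] :
    (Nat.card (GL ι F) : ℝ) = gl F (Fintype.card ι) := by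
  have e : GL ι F ≃* GL (Fin (Fintype.card ι)) F :=
    Units.mapEquiv (Matrix.reindexAlgEquiv F F (Fintype.equivFin ι)).toMulEquiv
  rw [Nat.card_congr e.toEquiv, Matrix.card_GL_field, gl, Finset.prod_range, Nat.cast_prod]
  refine Finset.prod_congr rfl fun i _ => ?_
  rw [Nat.cast_sub]
  · simp
  · exact Nat.pow_le_pow_right Fintype.card_pos (by omega)

lemma card_mat (ι κ : Type) [Fintype ι] [Fintype κ] :
    (Nat.card (Matrix ι κ F) : ℝ) = (Fintype.card F : ℝ) ^ (Fintype.card ι * Fintype.card κ) := by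
  classical
  rw [Nat.card_eq_fintype_card]
  have : Fintype.card (Matrix ι κ F) = Fintype.card (ι → κ → F) := Fintype.card_congr (Equiv.refl _)
  rw [this, Fintype.card_fun, Fintype.card_fun]
  push_cast
  rw [← pow_mul, mul_comm]

end glcard
end FF

namespace FF
section transport
variable {F : Type} [Field F]
variable {ι κ γ : Type} [Fintype ι] [Fintype κ] [Fintype γ] [DecidableEq ι] [DecidableEq κ]
  [DecidableEq γ]

/-- commuting nilpotent skew pair for the nondegenerate `ε`-symmetric form `ω`. -/
structure IsX (ε : F) (ω A B : Matrix ι ι F) : Prop where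
  sym : ωᵀ = ε • ω
  unit : IsUnit ω
  skA : Aᵀ * ω = -(ω * A)
  skB : Bᵀ * ω = -(ω * B)
  nA : IsNilpotent A
  nB : IsNilpotent B
  com : A * B = B * A

def XS (ε : F) (ι : Type) [Fintype ι] [DecidableEq ι] (w : ℕ) :
    Set (Matrix ι ι F × Matrix ι ι F × Matrix ι ι F) :=
  {t | IsX ε t.1 t.2.1 t.2.2 ∧ t.2.1.rank = w}

def NilS (ε : F) (ι : Type) [Fintype ι] [DecidableEq ι] : Set (Matrix ι ι F × Matrix ι ι F) :=
  {t | t.1ᵀ = ε • t.1 ∧ IsUnit t.1 ∧ t.2ᵀ * t.1 = -(t.1 * t.2) ∧ IsNilpotent t.2}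

def SS (ε : F) (ι : Type) [Fintype ι] [DecidableEq ι] : Set (Matrix ι ι F) :=
  {t | tᵀ = ε • t ∧ IsUnit t}

def FrmS (ε : F) (ι : Type) : Set (Matrix ι ι F) := {t | tᵀ = ε • t}

lemma tr_sym {ε : F} {ω : Matrix ι ι F} (P : Matrix ι κ F) (h : ωᵀ = ε • ω) :
    (Pᵀ * ω * P)ᵀ = ε • (Pᵀ * ω * P) := by
  simp [transpose_mul, h, Matrix.mul_assoc]

lemma tr_unit {ω : Matrix ι ι F} {P : Matrix ι κ F} {P' : Matrix κ ι F}
    (h1 : P * P' = 1) (h2 : P' * P = 1) (h : IsUnit ω) : IsUnit (Pᵀ * ω * P) := by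
  obtain ⟨u, hu⟩ := h.exists_left_inv
  apply IsUnit.of_mul_eq_one_right (P' * u * P'ᵀ)
  calc P' * u * P'ᵀ * (Pᵀ * ω * P) = P' * u * ((P * P')ᵀ * (ω * P)) := by
        simp [transpose_mul, Matrix.mul_assoc]
    _ = P' * (u * ω) * P := by rw [h1]; simp [Matrix.mul_assoc]
    _ = 1 := by rw [hu]; simp [h2]

lemma tr_skew {ω A : Matrix ι ι F} {P : Matrix ι κ F} {P' : Matrix κ ι F}
    (h1 : P * P' = 1) (h : Aᵀ * ω = -(ω * A)) :
    (P' * A * P)ᵀ * (Pᵀ * ω * P) = -((Pᵀ * ω * P) * (P' * A * P)) := by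
  calc (P' * A * P)ᵀ * (Pᵀ * ω * P) = Pᵀ * Aᵀ * ((P * P')ᵀ * (ω * P)) := by
        simp [transpose_mul, Matrix.mul_assoc]
    _ = Pᵀ * (Aᵀ * ω) * P := by rw [h1]; simp [Matrix.mul_assoc]
    _ = -((Pᵀ * ω) * ((1 : Matrix ι ι F) * (A * P))) := by rw [h]; simp [Matrix.mul_assoc]
    _ = _ := by rw [← h1]; simp [Matrix.mul_assoc]

lemma cj_mul {A B : Matrix ι ι F} {P : Matrix ι κ F} {P' : Matrix κ ι F}
    (h1 : P * P' = 1) : (P' * A * P) * (P' * B * P) = P' * (A * B) * P := by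
  calc (P' * A * P) * (P' * B * P) = P' * A * (P * P') * B * P := by simp [Matrix.mul_assoc]
    _ = _ := by rw [h1]; simp [Matrix.mul_assoc]

lemma cj_pow {A : Matrix ι ι F} {P : Matrix ι κ F} {P' : Matrix κ ι F}
    (h1 : P * P' = 1) (h2 : P' * P = 1) (n : ℕ) : (P' * A * P) ^ n = P' * A ^ n * P := by
  induction n with
  | zero => simp [h2]
  | succ n ih => rw [pow_succ, ih, cj_mul h1, pow_succ]

lemma cj_nilp {A : Matrix ι ι F} {P : Matrix ι κ F} {P' : Matrix κ ι F}
    (h1 : P * P' = 1) (h2 : P' * P = 1) (h : IsNilpotent A) : IsNilpotent (P' * A * P) := by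
  obtain ⟨n, hn⟩ := h
  exact ⟨n, by rw [cj_pow h1 h2, hn]; simp⟩

lemma cj_inv {A : Matrix ι ι F} {P : Matrix ι κ F} {P' : Matrix κ ι F}
    (h1 : P * P' = 1) : P * (P' * A * P) * P' = A := by
  calc P * (P' * A * P) * P' = (P * P') * A * (P * P') := by simp [Matrix.mul_assoc]
    _ = A := by simp [h1]

lemma tr_inv {A : Matrix ι ι F} {P : Matrix ι κ F} {P' : Matrix κ ι F}
    (h1 : P * P' = 1) : P'ᵀ * (Pᵀ * A * P) * P' = A := by
  calc P'ᵀ * (Pᵀ * A * P) * P' = (P * P')ᵀ * A * (P * P') := by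
        simp [Matrix.mul_assoc, transpose_mul]
    _ = A := by simp [h1]

lemma cj_rank {A : Matrix ι ι F} {P : Matrix ι κ F} {P' : Matrix κ ι F}
    (h1 : P * P' = 1) : (P' * A * P).rank = A.rank := by
  apply le_antisymm
  · exact (rank_mul_le_left _ _).trans (rank_mul_le_right _ _)
  · conv_lhs => rw [← cj_inv (A := A) h1]
    exact (rank_mul_le_left _ _).trans (rank_mul_le_right _ _)

lemma tr_rank {A : Matrix ι ι F} {P : Matrix ι κ F} {P' : Matrix κ ι F}
    (h1 : P * P' = 1) : (Pᵀ * A * P).rank = A.rank := by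
  apply le_antisymm
  · exact (rank_mul_le_left _ _).trans (rank_mul_le_right _ _)
  · conv_lhs => rw [← tr_inv (A := A) h1]
    exact (rank_mul_le_left _ _).trans (rank_mul_le_right _ _)

lemma IsX.tr {ε : F} {ω A B : Matrix ι ι F} (h : IsX ε ω A B) {P : Matrix ι κ F}
    {P' : Matrix κ ι F} (h1 : P * P' = 1) (h2 : P' * P = 1) :
    IsX ε (Pᵀ * ω * P) (P' * A * P) (P' * B * P) :=
  ⟨tr_sym P h.sym, tr_unit h1 h2 h.unit, tr_skew h1 h.skA, tr_skew h1 h.skB, cj_nilp h1 h2 h.nA,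
    cj_nilp h1 h2 h.nB, by rw [cj_mul h1, cj_mul h1, h.com]⟩

lemma card_XS (ε : F) (w : ℕ) (h : Fintype.card ι = Fintype.card κ) :
    Nat.card (XS ε ι w) = Nat.card (XS ε κ w) := by
  obtain ⟨P, P', h1, h2⟩ := exists_perm (F := F) h
  refine Nat.card_congr (Equiv.mk
    (fun t => ⟨(Pᵀ * t.1.1 * P, P' * t.1.2.1 * P, P' * t.1.2.2 * P),
      t.2.1.tr h1 h2, by rw [cj_rank h1]; exact t.2.2⟩)
    (fun t => ⟨(P'ᵀ * t.1.1 * P', P * t.1.2.1 * P', P * t.1.2.2 * P'),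
      t.2.1.tr h2 h1, by rw [cj_rank h2]; exact t.2.2⟩) ?_ ?_)
  · rintro ⟨⟨ω, A, B⟩, ht⟩
    simp [cj_inv h1, tr_inv h1]
  · rintro ⟨⟨ω, A, B⟩, ht⟩
    simp [cj_inv h2, tr_inv h2]

lemma card_NilS (ε : F) (h : Fintype.card ι = Fintype.card κ) :
    Nat.card (NilS ε ι) = Nat.card (NilS ε κ) := by
  obtain ⟨P, P', h1, h2⟩ := exists_perm (F := F) h
  refine Nat.card_congr (Equiv.mk
    (fun t => ⟨(Pᵀ * t.1.1 * P, P' * t.1.2 * P), tr_sym _ t.2.1, tr_unit h1 h2 t.2.2.1,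
      tr_skew h1 t.2.2.2.1, cj_nilp h1 h2 t.2.2.2.2⟩)
    (fun t => ⟨(P'ᵀ * t.1.1 * P', P * t.1.2 * P'), tr_sym _ t.2.1, tr_unit h2 h1 t.2.2.1,
      tr_skew h2 t.2.2.2.1, cj_nilp h2 h1 t.2.2.2.2⟩) ?_ ?_)
  · rintro ⟨⟨ω, A⟩, ht⟩
    simp [cj_inv h1, tr_inv h1]
  · rintro ⟨⟨ω, A⟩, ht⟩
    simp [cj_inv h2, tr_inv h2]

lemma card_SS (ε : F) (h : Fintype.card ι = Fintype.card κ) :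
    Nat.card (SS ε ι) = Nat.card (SS ε κ) := by
  obtain ⟨P, P', h1, h2⟩ := exists_perm (F := F) h
  refine Nat.card_congr (Equiv.mk
    (fun t => ⟨Pᵀ * t.1 * P, tr_sym _ t.2.1, tr_unit h1 h2 t.2.2⟩)
    (fun t => ⟨P'ᵀ * t.1 * P', tr_sym _ t.2.1, tr_unit h2 h1 t.2.2⟩) ?_ ?_)
  · rintro ⟨ω, ht⟩
    simp [tr_inv h1]
  · rintro ⟨ω, ht⟩
    simp [tr_inv h2]

/-- skewness in terms of the form `D = ω B`. -/
lemma skew_iff {ε : F} (hε : ε * ε = 1) {ω B : Matrix ι ι F} (hs : ωᵀ = ε • ω) :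
    Bᵀ * ω = -(ω * B) ↔ (ω * B)ᵀ = (-ε) • (ω * B) := by
  rw [transpose_mul, hs]
  constructor
  · intro h
    rw [Matrix.mul_smul, h]; simp
  · intro h
    have := congrArg (fun M => ε • M) h
    simpa [smul_smul, hε] using this

end transport
section frm
variable {F : Type} [Field F] [Fintype F]
variable {ι κ γ : Type} [Fintype ι] [Fintype κ] [Fintype γ] [DecidableEq ι] [DecidableEq κ]
  [DecidableEq γ]

lemma frm_mul (h2 : (2 : F) ≠ 0) {ε : F} (hε : ε * ε = 1) :
    (Nat.card (FrmS ε ι) : ℝ) * Nat.card (FrmS (-ε) ι) =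
      (Fintype.card F : ℝ) ^ (Fintype.card ι * Fintype.card ι) := by
  rw [← card_mat ι ι, ← Nat.cast_mul, ← Nat.card_prod]
  congr 1
  refine Nat.card_congr (Equiv.mk (fun p => p.1.1 + p.2.1)
    (fun M => (⟨(2⁻¹ : F) • (M + ε • Mᵀ), ?_⟩, ⟨(2⁻¹ : F) • (M - ε • Mᵀ), ?_⟩)) ?_ ?_)
  · simp only [FrmS, Set.mem_ofPred_eq, transpose_smul, transpose_add, transpose_transpose,
      smul_add, smul_smul]
    rw [mul_comm ε 2⁻¹, show ε * (2⁻¹ * ε) = (2⁻¹ : F) by linear_combination (2⁻¹ : F) * hε, add_comm]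
  · simp only [FrmS, Set.mem_ofPred_eq, transpose_smul, transpose_sub, transpose_transpose,
      smul_sub, smul_smul]
    rw [show -ε * (2⁻¹ * ε) = -(2⁻¹ : F) by linear_combination (-2⁻¹ : F) * hε]
    rw [show -ε * 2⁻¹ = -(2⁻¹ * ε) by ring]
    simp [neg_smul]; abel
  · rintro ⟨⟨a, ha⟩, ⟨b, hb⟩⟩
    simp only [FrmS, Set.mem_ofPred_eq] at ha hb
    have : (2⁻¹ : F) + 2⁻¹ = 1 := by field_simp; norm_num
    have e1 : ε • (a + b)ᵀ = a - b := by
      rw [transpose_add, ha, hb, smul_add, smul_smul, smul_smul, hε, mul_neg, hε]; simp [sub_eq_add_neg]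
    refine Prod.ext (Subtype.ext ?_) (Subtype.ext ?_)
    · show (2⁻¹ : F) • (a + b + ε • (a + b)ᵀ) = a
      rw [e1, show a + b + (a - b) = (2 : F) • a by rw [two_smul]; abel, smul_smul]; simp [h2]
    · show (2⁻¹ : F) • (a + b - ε • (a + b)ᵀ) = b
      rw [e1, show a + b - (a - b) = (2 : F) • b by rw [two_smul]; abel, smul_smul]; simp [h2]
  · intro M
    simp only [← smul_add]
    rw [show M + ε • Mᵀ + (M - ε • Mᵀ) = (2 : F) • M by rw [two_smul]; abel, smul_smul]; simp [h2]

lemma mem_frm_block {ε : F} (hε : ε * ε = 1) (M : Matrix (κ ⊕ γ) (κ ⊕ γ) F) :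
    Mᵀ = ε • M ↔ ∃ a b c, M = fromBlocks a b (ε • bᵀ) c ∧ aᵀ = ε • a ∧ cᵀ = ε • c := by
  constructor
  · intro h
    refine ⟨M.toBlocks₁₁, M.toBlocks₁₂, M.toBlocks₂₂, ?_, ?_, ?_⟩
    · conv_lhs => rw [← fromBlocks_toBlocks M]
      rw [fromBlocks_inj]
      refine ⟨rfl, rfl, ?_, rfl⟩
      ext i j
      have := congrFun (congrFun h (Sum.inr i)) (Sum.inl j)
      simp only [transpose_apply, Matrix.smul_apply, smul_eq_mul] at this
      simp only [toBlocks₂₁, toBlocks₁₂, transpose_apply, of_apply, Matrix.smul_apply, smul_eq_mul, this]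
      rw [← mul_assoc, hε, one_mul]
    · ext i j
      exact congrFun (congrFun h (Sum.inl i)) (Sum.inl j)
    · ext i j
      exact congrFun (congrFun h (Sum.inr i)) (Sum.inr j)
  · rintro ⟨a, b, c, rfl, ha, hc⟩
    rw [fromBlocks_transpose, fromBlocks_smul, fromBlocks_inj]
    refine ⟨ha, ?_, ?_, hc⟩
    · simp
    · rw [smul_smul, hε, one_smul]

end frm
end FF

namespace FF
section KS
variable {F : Type} [Field F]
variable {κ κ' γ γ' ρ μ m : Type} [Fintype κ] [Fintype γ] [DecidableEq κ]
  [DecidableEq γ] [Fintype κ'] [Fintype γ'] [DecidableEq κ'] [DecidableEq γ']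
  [Fintype ρ] [Fintype μ] [DecidableEq ρ] [DecidableEq μ] [Fintype m] [DecidableEq m]

/-- extensions of the data `(ω0, B')` on `κ` to `κ ⊕ γ`. -/
def KS (ε : F) (ω0 B' : Matrix κ κ F) (E : Set (Matrix κ γ F)) :
    Set (Matrix (κ ⊕ γ) (κ ⊕ γ) F × Matrix (κ ⊕ γ) (κ ⊕ γ) F) :=
  {t | (t.1ᵀ = ε • t.1 ∧ IsUnit t.1 ∧ t.2ᵀ * t.1 = -(t.1 * t.2) ∧ IsNilpotent t.2) ∧
    t.1.toBlocks₁₁ = ω0 ∧ t.2.toBlocks₁₁ = B' ∧ t.2.toBlocks₂₁ = 0 ∧ t.1.toBlocks₁₂ ∈ E}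

lemma KS_le [Finite F] {ε : F} {ω0 B' : Matrix κ κ F} {E : Set (Matrix κ γ F)}
    {P : Matrix κ κ' F} {P' : Matrix κ' κ F} {Q : Matrix γ γ' F} {Q' : Matrix γ' γ F}
    (hP : P * P' = 1) (hP' : P' * P = 1) (hQ : Q * Q' = 1) (hQ' : Q' * Q = 1)
    (S : Matrix κ γ' F) (E' : Set (Matrix κ' γ' F))
    (hE : ∀ η ∈ E, Pᵀ * ω0 * S + Pᵀ * η * Q ∈ E') :
    Nat.card (KS ε ω0 B' E) ≤ Nat.card (KS ε (Pᵀ * ω0 * P) (P' * B' * P) E') := by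
  set G : Matrix (κ ⊕ γ) (κ' ⊕ γ') F := fromBlocks P S 0 Q with hG
  set G' : Matrix (κ' ⊕ γ') (κ ⊕ γ) F := fromBlocks P' (-(P' * S * Q')) 0 Q' with hG'
  have h1 : G * G' = 1 := by
    rw [hG, hG', fromBlocks_multiply, hQ]
    have : P * -(P' * S * Q') = -((P * P') * S * Q') := by simp [Matrix.mul_assoc]
    rw [this]
    simp [hP]
  have h2 : G' * G = 1 := by
    rw [hG, hG', fromBlocks_multiply, hQ']
    have : P' * S * Q' * Q = P' * S * (Q' * Q) := by simp [Matrix.mul_assoc]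
    simp [hP', this, hQ']
  refine Nat.card_le_card_of_injective
    (fun t => ⟨(Gᵀ * t.1.1 * G, G' * t.1.2 * G), ⟨tr_sym _ t.2.1.1, tr_unit h1 h2 t.2.1.2.1,
      tr_skew h1 t.2.1.2.2.1, cj_nilp h1 h2 t.2.1.2.2.2⟩, ?_⟩) ?_
  · obtain ⟨⟨ω, B⟩, ⟨-, e1, e2, e3, e4⟩⟩ := t
    simp only at e1 e2 e3 e4
    dsimp only
    rw [← fromBlocks_toBlocks ω, ← fromBlocks_toBlocks B, hG, hG', fromBlocks_transpose]
    simp only [fromBlocks_multiply, toBlocks_fromBlocks₁₁, toBlocks_fromBlocks₁₂,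
      toBlocks_fromBlocks₂₁, e1, e2, e3]
    refine ⟨?_, ?_, ?_, ?_⟩
    · simp
    · simp
    · simp
    · simpa using hE _ e4
  · rintro ⟨⟨ω, B⟩, h⟩ ⟨⟨ω', B'⟩, h'⟩ he
    have he' := Prod.ext_iff.1 (Subtype.ext_iff.1 he)
    dsimp only at he'
    refine Subtype.ext (Prod.ext ?_ ?_)
    · show ω = ω'
      rw [← tr_inv (A := ω) h1, he'.1, tr_inv h1]
    · show B = B'
      rw [← cj_inv (A := B) h1, he'.2, cj_inv h1]

lemma KS_eq [Finite F] {ε : F} {ω0 B' : Matrix κ κ F} (E : Set (Matrix κ γ F))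
    {P : Matrix κ κ' F} {P' : Matrix κ' κ F} {Q : Matrix γ γ' F} {Q' : Matrix γ' γ F}
    (hP : P * P' = 1) (hP' : P' * P = 1) (hQ : Q * Q' = 1) (hQ' : Q' * Q = 1)
    (S : Matrix κ γ' F) (E' : Set (Matrix κ' γ' F))
    (hE : ∀ η, η ∈ E ↔ Pᵀ * ω0 * S + Pᵀ * η * Q ∈ E') :
    Nat.card (KS ε ω0 B' E) = Nat.card (KS ε (Pᵀ * ω0 * P) (P' * B' * P) E') := by
  apply le_antisymm (KS_le hP hP' hQ hQ' S E' fun η h => (hE η).1 h)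
  have := KS_le (ε := ε) (ω0 := Pᵀ * ω0 * P) (B' := P' * B' * P) (E := E') hP' hP hQ' hQ
    (-(P' * S * Q')) E ?_
  · rwa [tr_inv hP, cj_inv hP] at this
  · intro η h
    rw [hE]
    convert h using 1
    have a1 : P'ᵀ * (Pᵀ * ω0 * P) = ω0 * P := by
      have : P'ᵀ * (Pᵀ * ω0 * P) = (P * P')ᵀ * ω0 * P := by simp [Matrix.mul_assoc, transpose_mul]
      rw [this, hP]; simp
    have a2 : Pᵀ * P'ᵀ = 1 := by rw [← transpose_mul, hP']; simp
    have a3 : Pᵀ * (ω0 * P * (P' * S * Q')) * Q = Pᵀ * ω0 * (P * P') * S * (Q' * Q) := by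
      simp [Matrix.mul_assoc]
    have a4 : Pᵀ * (P'ᵀ * η * Q') * Q = (Pᵀ * P'ᵀ) * η * (Q' * Q) := by
      simp [Matrix.mul_assoc]
    rw [a1, Matrix.mul_neg, Matrix.mul_add, Matrix.mul_neg, Matrix.add_mul, Matrix.neg_mul, a3, a4,
      a2, hP, hQ']
    simp

/-! normal form -/

def etaS (F : Type) [Field F] (ρ μ m : Type) [DecidableEq ρ] : Matrix (ρ ⊕ μ) (m ⊕ ρ) F :=
  fromBlocks 0 1 0 0

def omS (ε : F) (M : Matrix μ μ F) (σ : Matrix m m F) (e : Matrix m ρ F) (c : Matrix ρ ρ F) :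
    Matrix ((ρ ⊕ μ) ⊕ (m ⊕ ρ)) ((ρ ⊕ μ) ⊕ (m ⊕ ρ)) F :=
  fromBlocks (fromBlocks 0 0 0 M) (etaS F ρ μ m) (ε • (etaS F ρ μ m)ᵀ)
    (fromBlocks σ e (ε • eᵀ) c)

lemma omS_mulVec (ε : F) (M : Matrix μ μ F) (σ : Matrix m m F) (e : Matrix m ρ F)
    (c : Matrix ρ ρ F) (x1 : ρ → F) (x2 : μ → F) (x3 : m → F) (x4 : ρ → F) :
    omS ε M σ e c *ᵥ (Sum.elim (Sum.elim x1 x2) (Sum.elim x3 x4)) =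
      Sum.elim (Sum.elim x4 (M *ᵥ x2))
        (Sum.elim (σ *ᵥ x3 + e *ᵥ x4) (ε • x1 + (ε • eᵀ) *ᵥ x3 + c *ᵥ x4)) := by
  simp only [omS, etaS, fromBlocks_mulVec, fromBlocks_transpose, fromBlocks_smul]
  ext ((i | i) | (i | i)) <;> simp [smul_mulVec, add_assoc, Sum.elim_comp_inl, fromBlocks_mulVec]

lemma isUnit_iff_inj {ι : Type} [Fintype ι] [DecidableEq ι] (M : Matrix ι ι F) :
    IsUnit M ↔ ∀ x, M *ᵥ x = 0 → x = 0 := by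
  rw [← Matrix.mulVec_injective_iff_isUnit]
  constructor
  · intro h x hx
    exact h (by simpa using hx)
  · intro h x y hxy
    have : M *ᵥ (x - y) = 0 := by rw [mulVec_sub]; simpa [sub_eq_zero] using hxy
    exact sub_eq_zero.1 (h _ this)

lemma omS_unit {ε : F} (hε : ε * ε = 1) (M : Matrix μ μ F) (hM : IsUnit M) (σ : Matrix m m F)
    (e : Matrix m ρ F) (c : Matrix ρ ρ F) : IsUnit (omS ε M σ e c) ↔ IsUnit σ := by
  have hε0 : ε ≠ 0 := by rintro rfl; simp at hε
  rw [isUnit_iff_inj] at hM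
  rw [isUnit_iff_inj, isUnit_iff_inj]
  constructor
  · intro h x hx
    have := h (Sum.elim (Sum.elim (-(eᵀ *ᵥ x)) 0) (Sum.elim x 0)) (by
      rw [omS_mulVec]
      ext ((i | i) | (i | i)) <;> simp [hx, smul_mulVec])
    ext i
    exact congrFun this (Sum.inr (Sum.inl i))
  · intro h x hx
    obtain ⟨x1, x2, x3, x4, rfl⟩ : ∃ x1 x2 x3 x4,
        x = Sum.elim (Sum.elim x1 x2) (Sum.elim x3 x4) :=
      ⟨fun i => x (.inl (.inl i)), fun i => x (.inl (.inr i)), fun i => x (.inr (.inl i)),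
        fun i => x (.inr (.inr i)), by ext ((i | i) | (i | i)) <;> rfl⟩
    rw [omS_mulVec] at hx
    have h4 : x4 = 0 := by ext i; exact congrFun hx (.inl (.inl i))
    have h2 : M *ᵥ x2 = 0 := by ext i; exact congrFun hx (.inl (.inr i))
    have h3 : σ *ᵥ x3 + e *ᵥ x4 = 0 := by ext i; exact congrFun hx (.inr (.inl i))
    have h1 : ε • x1 + (ε • eᵀ) *ᵥ x3 + c *ᵥ x4 = 0 := by ext i; exact congrFun hx (.inr (.inr i))
    subst h4
    have h2' := hM _ h2
    have h3' := h _ (by simpa using h3)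
    subst h2' h3'
    have h1' : x1 = 0 := by simpa [hε0] using h1
    subst h1'
    ext ((i | i) | (i | i)) <;> rfl

lemma omS_key {ε : F} (hε : ε * ε = 1) (M : Matrix μ μ F) (σ : Matrix m m F)
    (e : Matrix m ρ F) (c : Matrix ρ ρ F) (b11 : Matrix ρ ρ F) (b12 : Matrix ρ μ F)
    (b22 : Matrix μ μ F) (Bx : Matrix (ρ ⊕ μ) (m ⊕ ρ) F) (By : Matrix (m ⊕ ρ) (m ⊕ ρ) F)
    (B : Matrix ((ρ ⊕ μ) ⊕ (m ⊕ ρ)) ((ρ ⊕ μ) ⊕ (m ⊕ ρ)) F)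
    (hB : B = fromBlocks (fromBlocks b11 b12 0 b22) Bx 0 By)
    (hsk : (omS ε M σ e c * B)ᵀ = (-ε) • (omS ε M σ e c * B)) :
    By = fromBlocks By.toBlocks₁₁ By.toBlocks₁₂ 0 (-b11ᵀ) ∧
      σ * By.toBlocks₁₁ = (omS ε M σ e c * B).toBlocks₂₂.toBlocks₁₁ := by
  obtain ⟨x1, x2, x3, x4, rfl⟩ : ∃ x1 x2 x3 x4, Bx = fromBlocks x1 x2 x3 x4 :=
    ⟨_, _, _, _, (fromBlocks_toBlocks _).symm⟩
  obtain ⟨y1, y2, y3, y4, rfl⟩ : ∃ y1 y2 y3 y4, By = fromBlocks y1 y2 y3 y4 :=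
    ⟨_, _, _, _, (fromBlocks_toBlocks _).symm⟩
  have hcomp : omS ε M σ e c * B =
      fromBlocks (fromBlocks 0 0 0 (M * b22)) (fromBlocks y3 y4 (M * x3) (M * x4))
        (fromBlocks 0 0 (ε • b11) (ε • b12))
        (fromBlocks (σ * y1 + e * y3) (σ * y2 + e * y4)
          (ε • x1 + (ε • eᵀ * y1 + c * y3)) (ε • x2 + (ε • eᵀ * y2 + c * y4))) := by
    rw [hB, omS, etaS]
    simp [fromBlocks_multiply, fromBlocks_transpose, fromBlocks_smul, fromBlocks_add]
  rw [hcomp] at hsk ⊢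
  simp only [fromBlocks_transpose, fromBlocks_smul, fromBlocks_inj, transpose_smul] at hsk
  obtain ⟨-, ⟨h3, h4, -, -⟩, -, -⟩ := hsk
  have hε0 : -ε ≠ 0 := by rintro h; rw [neg_eq_zero] at h; subst h; simp at hε
  have hy3 : y3 = 0 := by
    have : (-ε) • y3 = 0 := by rw [← h3]; simp
    exact (smul_eq_zero_iff_right hε0).1 this
  have hy4 : y4 = -b11ᵀ := by
    have : (-ε) • ((-ε) • y4) = (-ε) • (ε • b11ᵀ) := by rw [← h4]
    rw [smul_smul, smul_smul] at this
    simpa [hε] using this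
  subst hy3 hy4
  simp

end KS
end FF

namespace FF
section KN
variable {F : Type} [Field F] [Fintype F]
variable {κ κ' γ γ' ρ μ m : Type} [Fintype κ] [Fintype γ] [DecidableEq κ]
  [DecidableEq γ] [Fintype κ'] [Fintype γ'] [DecidableEq κ'] [DecidableEq γ']
  [Fintype ρ] [Fintype μ] [DecidableEq ρ] [DecidableEq μ] [Fintype m] [DecidableEq m]

lemma K_norm {ε : F} (hε : ε * ε = 1) (M : Matrix μ μ F) (hM : IsUnit M) (hMs : Mᵀ = ε • M)
    (b11 : Matrix ρ ρ F) (b12 : Matrix ρ μ F) (b22 : Matrix μ μ F)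
    (hb : IsNilpotent (fromBlocks b11 b12 0 b22)) (hbs : b22ᵀ * M = -(M * b22)) :
    Nat.card (KS ε (fromBlocks 0 0 0 M) (fromBlocks b11 b12 0 b22) {etaS F ρ μ m}) =
      Nat.card (NilS ε m × Matrix m ρ F × FrmS ε ρ × Matrix m ρ F × FrmS (-ε) ρ) := by
  have hb11 : IsNilpotent (-b11ᵀ) := by
    have := ((nilp_block _ _ _).1 hb).1
    rw [isNilpotent_neg_iff]
    obtain ⟨n, hn⟩ := this
    exact ⟨n, by rw [← transpose_pow, hn]; simp⟩
  set B' : Matrix (ρ ⊕ μ) (ρ ⊕ μ) F := fromBlocks b11 b12 0 b22 with hB'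
  -- the form `D`
  let Dd : Matrix m m F → Matrix m ρ F → Matrix ρ ρ F →
      Matrix ((ρ ⊕ μ) ⊕ (m ⊕ ρ)) ((ρ ⊕ μ) ⊕ (m ⊕ ρ)) F := fun x d34 d44 =>
    fromBlocks (fromBlocks 0 0 0 (M * b22)) (fromBlocks 0 (-b11ᵀ) 0 (-b12ᵀ))
      (fromBlocks 0 0 (ε • b11) (ε • b12)) (fromBlocks x d34 ((-ε) • d34ᵀ) d44)
  have hDs : ∀ x d34 d44, xᵀ = (-ε) • x → d44ᵀ = (-ε) • d44 →
      (Dd x d34 d44)ᵀ = (-ε) • Dd x d34 d44 := by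
    intro x d34 d44 hx hd
    have h22 := (skew_iff hε hMs).1 hbs
    simp only [Dd, fromBlocks_transpose, fromBlocks_smul, hx, hd, h22]
    simp [smul_smul, hε]
  have hcol : ∀ σ e c x d34 d44, ∃ X Y, Dd x d34 d44 =
      omS ε M σ e c * fromBlocks B' 0 0 0 + fromBlocks 0 X 0 Y := by
    intro σ e c x d34 d44
    refine ⟨fromBlocks 0 (-b11ᵀ) 0 (-b12ᵀ), fromBlocks x d34 ((-ε) • d34ᵀ) d44, ?_⟩
    · simp only [Dd, omS, etaS, hB', fromBlocks_multiply, fromBlocks_transpose, fromBlocks_smul,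
        fromBlocks_add]
      simp
  symm
  refine Nat.card_eq_of_bijective (fun p => ⟨(omS ε M p.1.1.1 p.2.1 p.2.2.1.1,
    (omS ε M p.1.1.1 p.2.1 p.2.2.1.1)⁻¹ * Dd (p.1.1.1 * p.1.1.2) p.2.2.2.1 p.2.2.2.2.1), ?_⟩)
    ⟨?_, ?_⟩
  · obtain ⟨⟨⟨σ, N⟩, ⟨hσ, hσu, hN, hNn⟩⟩, e, ⟨c, hc⟩, d34, ⟨d44, hd⟩⟩ := p
    simp only [FrmS, Set.mem_ofPred_eq] at hc hd hσ hσu hN hNn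
    dsimp only
    set ω := omS ε M σ e c with hω
    have hωu : IsUnit ω := (omS_unit hε M hM σ e c).2 hσu
    have hωd : IsUnit ω.det := (isUnit_iff_isUnit_det ω).1 hωu
    have hωs : ωᵀ = ε • ω := by
      rw [mem_frm_block hε]
      refine ⟨_, _, _, rfl, ?_, ?_⟩
      · simp [fromBlocks_transpose, fromBlocks_smul, hMs]
      · rw [mem_frm_block hε]; exact ⟨_, _, _, rfl, hσ, hc⟩
    set B := ω⁻¹ * Dd (σ * N) d34 d44 with hBdef
    have hωB : ω * B = Dd (σ * N) d34 d44 := by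
      rw [hBdef, ← Matrix.mul_assoc, mul_nonsing_inv _ hωd, Matrix.one_mul]
    have hsk : (ω * B)ᵀ = (-ε) • (ω * B) := by
      rw [hωB]; exact hDs _ _ _ ((skew_iff hε hσ).1 hN) hd
    obtain ⟨X, Y, hXY⟩ := hcol σ e c (σ * N) d34 d44
    obtain ⟨Bx, By, hBb⟩ : ∃ Bx By, B = fromBlocks B' Bx 0 By := by
      have : B = fromBlocks B' 0 0 0 + ω⁻¹ * fromBlocks 0 X 0 Y := by
        rw [hBdef, hXY, Matrix.mul_add, ← Matrix.mul_assoc, nonsing_inv_mul _ hωd, Matrix.one_mul]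
      rw [this, ← fromBlocks_toBlocks (ω⁻¹), fromBlocks_multiply, fromBlocks_add]
      refine ⟨(ω⁻¹).toBlocks₁₁ * X + (ω⁻¹).toBlocks₁₂ * Y,
        (ω⁻¹).toBlocks₂₁ * X + (ω⁻¹).toBlocks₂₂ * Y, ?_⟩
      simp
    obtain ⟨k1, k2⟩ := omS_key hε M σ e c b11 b12 b22 Bx By B hBb hsk
    rw [← hω, hωB] at k2
    have hx : By.toBlocks₁₁ = N := by
      simp only [Dd, toBlocks_fromBlocks₂₂, toBlocks_fromBlocks₁₁] at k2
      exact hσu.mul_left_cancel k2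
    refine ⟨⟨hωs, hωu, (skew_iff hε hωs).2 hsk, ?_⟩, rfl, ?_, ?_, ?_⟩
    · show IsNilpotent B
      rw [hBb, nilp_block B', k1, nilp_block _ _ (-b11ᵀ)]
      exact ⟨hb, by rw [hx]; exact hNn, hb11⟩
    · show B.toBlocks₁₁ = B'
      rw [hBb]; simp
    · show B.toBlocks₂₁ = 0
      rw [hBb]; simp
    · rfl
  · rintro ⟨⟨⟨σ, N⟩, ⟨hσ, hσu, hN, hNn⟩⟩, e, ⟨c, hc⟩, d34, ⟨d44, hd⟩⟩
    rintro ⟨⟨⟨σ', N'⟩, ⟨hσ', hσu', hN', hNn'⟩⟩, e', ⟨c', hc'⟩, d34', ⟨d44', hd'⟩⟩ heq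
    simp only [Subtype.mk.injEq, Prod.mk.injEq] at heq
    dsimp only at hσu hσu'
    obtain ⟨h1, h2⟩ := heq
    have hωu : IsUnit (omS ε M σ' e' c') := (omS_unit hε M hM σ' e' c').2 hσu'
    have hωd := (isUnit_iff_isUnit_det _).1 hωu
    rw [h1] at h2
    have h3 := congrArg (fun Z => omS ε M σ' e' c' * Z) h2
    simp only [← Matrix.mul_assoc, mul_nonsing_inv _ hωd, Matrix.one_mul] at h3
    simp only [omS, fromBlocks_inj] at h1
    simp only [Dd, fromBlocks_inj] at h3
    obtain ⟨-, -, -, rfl, rfl, -, rfl⟩ := h1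
    obtain ⟨-, -, -, h4, rfl, -, rfl⟩ := h3
    have := hσu.mul_left_cancel h4
    subst this
    rfl
  · rintro ⟨⟨ω, B⟩, ⟨hωs, hωu, hBs, hBn⟩, h11, hB11, hB21, hη⟩
    simp only at hωs hωu hBs hBn h11 hB11 hB21 hη
    have hη2 := Set.mem_singleton_iff.1 hη
    obtain ⟨a, b, cc, rfl, ha, hcc⟩ := (mem_frm_block hε _).1 hωs
    simp only [toBlocks_fromBlocks₁₁, toBlocks_fromBlocks₁₂] at h11 hη2
    subst h11 hη2
    obtain ⟨σ, e, c, rfl, hσ, hc⟩ := (mem_frm_block hε _).1 hcc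
    change IsUnit (omS ε M σ e c) at hωu
    have hBb : B = fromBlocks B' B.toBlocks₁₂ 0 B.toBlocks₂₂ := by
      conv_lhs => rw [← fromBlocks_toBlocks B, hB11, hB21]
    have hsk := (skew_iff hε hωs).1 hBs
    change (omS ε M σ e c * B)ᵀ = (-ε) • (omS ε M σ e c * B) at hsk
    have hσu := (omS_unit hε M hM σ e c).1 hωu
    have hωd := (isUnit_iff_isUnit_det _).1 hωu
    obtain ⟨k1, k2⟩ := omS_key hε M σ e c b11 b12 b22 _ _ B hBb hsk
    have hε' : (-ε) * (-ε) = 1 := by simpa using hε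
    obtain ⟨D1, D2, D4, hD, hD1, hD4⟩ := (mem_frm_block hε' _).1 hsk
    obtain ⟨d1, d2, d4, rfl, hd1, hd4⟩ := (mem_frm_block hε' _).1 hD4
    have hN : B.toBlocks₂₂.toBlocks₁₁ᵀ * σ = -(σ * B.toBlocks₂₂.toBlocks₁₁) := by
      rw [skew_iff hε hσ, k2, hD]; simpa using hd1
    have hNn : IsNilpotent B.toBlocks₂₂.toBlocks₁₁ := by
      rw [hBb, nilp_block B', k1, nilp_block _ _ (-b11ᵀ)] at hBn
      exact hBn.2.1
    refine ⟨⟨⟨(σ, B.toBlocks₂₂.toBlocks₁₁), hσ, hσu, hN, hNn⟩, e, ⟨c, hc⟩, d2, ⟨d4, hd4⟩⟩, ?_⟩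
    refine Subtype.ext (Prod.ext rfl ?_)
    show (omS ε M σ e c)⁻¹ * Dd (σ * B.toBlocks₂₂.toBlocks₁₁) d2 d4 = B
    have : Dd (σ * B.toBlocks₂₂.toBlocks₁₁) d2 d4 = omS ε M σ e c * B := by
      have hD21 : (omS ε M σ e c * B).toBlocks₂₁ = fromBlocks 0 0 (ε • b11) (ε • b12) := by
        rw [hBb, omS, etaS]
        simp [fromBlocks_multiply, fromBlocks_transpose, fromBlocks_smul, hB']
      have hD11 : (omS ε M σ e c * B).toBlocks₁₁ = fromBlocks 0 0 0 (M * b22) := by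
        rw [hBb, omS, etaS]
        simp [fromBlocks_multiply, hB']
      rw [k2, hD] 
      rw [hD] at hD21 hD11
      simp only [toBlocks_fromBlocks₁₁, toBlocks_fromBlocks₂₁, toBlocks_fromBlocks₂₂] at hD21 hD11 ⊢
      have hD2 : D2 = fromBlocks 0 (-b11ᵀ) 0 (-b12ᵀ) := by
        have := congrArg (fun Z => (-ε) • Zᵀ) hD21
        simp only [transpose_smul, transpose_transpose, smul_smul, hε', one_smul,
          fromBlocks_transpose, fromBlocks_smul] at this
        rw [this]
        simp [hε]
      rw [hD21, hD11, hD2]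
    rw [this, ← Matrix.mul_assoc, nonsing_inv_mul _ hωd, Matrix.one_mul]

end KN
end FF

namespace FF
section L2
variable {F : Type} [Field F] [Fintype F]
variable {κ γ ρ μ : Type} [Fintype κ] [Fintype γ] [DecidableEq κ] [DecidableEq γ]
  [Fintype ρ] [Fintype μ] [DecidableEq ρ] [DecidableEq μ]

lemma gl_split (r m : ℕ) : gl F (r + m) = (∏ i ∈ Finset.range r,
    ((Fintype.card F : ℝ) ^ (r + m) - (Fintype.card F : ℝ) ^ i)) * (Fintype.card F : ℝ) ^ (r * m) *
      gl F m := by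
  rw [gl, Finset.prod_range_add, mul_assoc, gl]
  congr 1
  have : (Fintype.card F : ℝ) ^ (r * m) = ∏ _i ∈ Finset.range m, (Fintype.card F : ℝ) ^ r := by
    simp [pow_mul]
  rw [this, ← Finset.prod_mul_distrib]
  refine Finset.prod_congr rfl fun i _ => ?_
  rw [pow_add, pow_add]; ring

lemma mul_eq_zero_cols {α : Type} [Fintype α] (M : Matrix α (ρ ⊕ μ) F)
    (h : ∀ x, M *ᵥ Sum.elim x 0 = 0) : ∃ T, M = fromCols 0 T := by
  refine ⟨M.toCols₂, ?_⟩
  conv_lhs => rw [← fromCols_toCols M]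
  congr 1
  ext i j
  have := congrFun (h (Pi.single j 1)) i
  rw [show (Sum.elim (Pi.single j 1) 0 : ρ ⊕ μ → F) = Pi.single (Sum.inl j) 1 from ?_] at this
  · simpa using this
  · ext (k | k)
    · simp [Pi.single_apply]
    · simp [Pi.single_apply]

lemma ker_normal {ε : F} (hε : ε * ε = 1) (ω0 B' : Matrix κ κ F) (hs : ω0ᵀ = ε • ω0)
    (hsk : B'ᵀ * ω0 = -(ω0 * B')) (r w' : ℕ) (hw : ω0.rank = w') (hr : r + w' = Fintype.card κ) :
    ∃ (P : Matrix κ (Fin r ⊕ Fin w') F) (P' : Matrix (Fin r ⊕ Fin w') κ F)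
      (M : Matrix (Fin w') (Fin w') F) (b11 : Matrix (Fin r) (Fin r) F)
      (b12 : Matrix (Fin r) (Fin w') F) (b22 : Matrix (Fin w') (Fin w') F),
      P * P' = 1 ∧ P' * P = 1 ∧ Pᵀ * ω0 * P = fromBlocks 0 0 0 M ∧ IsUnit M ∧ Mᵀ = ε • M ∧
      P' * B' * P = fromBlocks b11 b12 0 b22 ∧ b22ᵀ * M = -(M * b22) := by
  obtain ⟨S', hS'⟩ := Submodule.exists_isCompl (LinearMap.ker ω0.mulVecLin)
  have hk : Module.finrank F (LinearMap.ker ω0.mulVecLin) = Fintype.card (Fin r) := by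
    have := LinearMap.finrank_range_add_finrank_ker ω0.mulVecLin
    rw [← Matrix.rank, hw, Module.finrank_fintype_fun_eq_card] at this
    simp; omega
  have hk' : Module.finrank F S' = Fintype.card (Fin w') := by
    have := Submodule.finrank_add_eq_of_isCompl hS'
    rw [Module.finrank_fintype_fun_eq_card, hk] at this
    simp at this ⊢; omega
  obtain ⟨P, P', h1, h2, hP, hP'⟩ := exists_frame hS' hk hk'
  have hsym := tr_sym P hs
  obtain ⟨T, hT⟩ := mul_eq_zero_cols (Pᵀ * ω0 * P) (by
    intro x
    have := hP x
    rw [LinearMap.mem_ker, mulVecLin_apply] at this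
    rw [← mulVec_mulVec, ← mulVec_mulVec, this]; simp)
  obtain ⟨a, b, M, hM, ha, hMs⟩ := (mem_frm_block hε _).1 hsym
  have hb0 : a = 0 ∧ b = 0 := by
    rw [hM] at hT
    have e1 : a = 0 := by
      ext i j; exact congrFun (congrFun hT (.inl i)) (.inl j)
    have e2 : ε • bᵀ = 0 := by
      ext i j; exact congrFun (congrFun hT (.inr i)) (.inl j)
    refine ⟨e1, ?_⟩
    have := congrArg (fun Z => (ε • Z)ᵀ) e2
    simpa [smul_smul, hε] using this
  obtain ⟨rfl, rfl⟩ := hb0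
  have hM' : Pᵀ * ω0 * P = fromBlocks 0 0 0 M := by simpa using hM
  have hMu : IsUnit M := by
    rw [isUnit_iff_inj]
    intro y hy
    have e1 : (Pᵀ * ω0 * P) *ᵥ (Sum.elim 0 y) = 0 := by
      rw [hM', fromBlocks_mulVec]; ext (i | i) <;> simp [Sum.elim_comp_inr, hy]
    have e2 : ω0 *ᵥ (P *ᵥ (Sum.elim 0 y)) = 0 := by
      have := congrArg (fun z => P'ᵀ *ᵥ z) e1
      simp only [mulVec_mulVec, mulVec_zero, ← Matrix.mul_assoc] at this
      rw [← transpose_mul, h1] at this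
      simpa [mulVec_mulVec] using this
    have e3 : P *ᵥ (Sum.elim 0 y) = 0 :=
      (Submodule.disjoint_def.1 hS'.disjoint) _ (by simpa using e2) (hP' y)
    have e4 := congrArg (fun z => P' *ᵥ z) e3
    simp only [mulVec_mulVec, h2, one_mulVec, mulVec_zero] at e4
    ext i
    exact congrFun e4 (.inr i)
  have hsk' := tr_skew h1 hsk
  obtain ⟨b11, b12, b21, b22, hb⟩ : ∃ b11 b12 b21 b22, P' * B' * P = fromBlocks b11 b12 b21 b22 :=
    ⟨_, _, _, _, (fromBlocks_toBlocks _).symm⟩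
  rw [hb, hM', fromBlocks_transpose, fromBlocks_multiply, fromBlocks_multiply, fromBlocks_neg,
    fromBlocks_inj] at hsk'
  obtain ⟨-, -, h21, h22⟩ := hsk'
  simp at h21 h22
  have hb21 : b21 = 0 := by
    obtain ⟨u, hu⟩ := hMu.exists_left_inv
    rw [← Matrix.one_mul b21, ← hu, Matrix.mul_assoc, h21, Matrix.mul_zero]
  subst hb21
  exact ⟨P, P', M, b11, b12, b22, h1, h2, hM', hMu, hMs, hb, h22⟩

lemma right_normal {r m : ℕ} (η : Matrix (Fin r) γ F) (hη : LinearIndependent F η.row)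
    (hc : r + m = Fintype.card γ) :
    ∃ (Q : Matrix γ (Fin m ⊕ Fin r) F) (Q' : Matrix (Fin m ⊕ Fin r) γ F),
      Q * Q' = 1 ∧ Q' * Q = 1 ∧ η * Q = fromCols 0 1 := by
  have hrk : η.rank = r := by simpa using hη.rank_matrix
  obtain ⟨S', hS'⟩ := Submodule.exists_isCompl (LinearMap.ker η.mulVecLin)
  have hk : Module.finrank F (LinearMap.ker η.mulVecLin) = Fintype.card (Fin m) := by
    have := LinearMap.finrank_range_add_finrank_ker η.mulVecLin
    rw [← Matrix.rank, hrk, Module.finrank_fintype_fun_eq_card] at this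
    simp; omega
  have hk' : Module.finrank F S' = Fintype.card (Fin r) := by
    have := Submodule.finrank_add_eq_of_isCompl hS'
    rw [Module.finrank_fintype_fun_eq_card, hk] at this
    simp at this ⊢; omega
  obtain ⟨P, P', h1, h2, hP, hP'⟩ := exists_frame hS' hk hk'
  obtain ⟨T, hT⟩ := mul_eq_zero_cols (η * P) (by
    intro x
    have := hP x
    rw [LinearMap.mem_ker, mulVecLin_apply] at this
    rw [← mulVec_mulVec, this])
  have hTu : IsUnit T := by
    rw [isUnit_iff_inj]
    intro y hy
    have e2 : η *ᵥ (P *ᵥ (Sum.elim 0 y)) = 0 := by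
      rw [mulVec_mulVec, hT, fromCols_mulVec]; simp [Sum.elim_comp_inr, hy]
    have e3 : P *ᵥ (Sum.elim 0 y) = 0 :=
      (Submodule.disjoint_def.1 hS'.disjoint) _ (by simpa using e2) (hP' y)
    have e4 := congrArg (fun z => P' *ᵥ z) e3
    simp only [mulVec_mulVec, h2, one_mulVec, mulVec_zero] at e4
    ext i
    exact congrFun e4 (.inr i)
  have hTd := (isUnit_iff_isUnit_det T).1 hTu
  obtain ⟨D, hD⟩ : ∃ D : Matrix (Fin m ⊕ Fin r) (Fin m ⊕ Fin r) F, D = fromBlocks 1 0 0 T⁻¹ :=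
    ⟨_, rfl⟩
  obtain ⟨D', hD'⟩ : ∃ D : Matrix (Fin m ⊕ Fin r) (Fin m ⊕ Fin r) F, D = fromBlocks 1 0 0 T :=
    ⟨_, rfl⟩
  refine ⟨P * D, D' * P', ?_, ?_, ?_⟩
  · rw [Matrix.mul_assoc, ← Matrix.mul_assoc D, hD, hD', fromBlocks_multiply]
    simp [nonsing_inv_mul _ hTd, h1]
  · rw [Matrix.mul_assoc, ← Matrix.mul_assoc P', h2, Matrix.one_mul, hD, hD', fromBlocks_multiply]
    simp [mul_nonsing_inv _ hTd]
  · rw [← Matrix.mul_assoc, hT, hD, fromCols_mul_fromBlocks]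
    simp [mul_nonsing_inv _ hTd]

lemma KS_indep {ε : F} {r w' : ℕ} (M : Matrix (Fin w') (Fin w') F)
    (B' : Matrix (Fin r ⊕ Fin w') (Fin r ⊕ Fin w') F) (η : Matrix (Fin r ⊕ Fin w') γ F)
    (t) (ht : t ∈ KS ε (fromBlocks 0 0 0 M) B' {η}) : LinearIndependent F η.toRows₁.row := by
  obtain ⟨⟨-, hu, -, -⟩, h11, -, -, h12⟩ := ht
  rw [Set.mem_singleton_iff] at h12
  rw [← Matrix.vecMul_injective_iff]
  have hinj := Matrix.vecMul_injective_of_isUnit hu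
  intro x y hxy
  have key : ∀ z : Fin r → F, (Sum.elim (Sum.elim z (0 : Fin w' → F)) (0 : γ → F)) ᵥ* t.1 =
      Sum.elim (0 : Fin r ⊕ Fin w' → F) (z ᵥ* η.toRows₁) := by
    intro z
    rw [← fromBlocks_toBlocks t.1, h11, h12, vecMul_fromBlocks]
    simp only [Sum.elim_comp_inl, Sum.elim_comp_inr]
    ext (i | i)
    · rw [vecMul_fromBlocks]
      rcases i with i | i <;> simp [Sum.elim_comp_inl, Sum.elim_comp_inr]
    · have : (Sum.elim z (0 : Fin w' → F)) ᵥ* η = z ᵥ* η.toRows₁ := by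
        conv_lhs => rw [← fromRows_toRows η]
        rw [vecMul_fromRows]
        simp [Sum.elim_comp_inl, Sum.elim_comp_inr]
      simp [this]
  have := hinj ((key x).trans ((congrArg (Sum.elim (0 : Fin r ⊕ Fin w' → F)) hxy).trans (key y).symm))
  ext i
  exact congrFun this (.inl (.inl i))

lemma KS_eta {ε : F} {r w' m : ℕ} (M : Matrix (Fin w') (Fin w') F) (hM : IsUnit M)
    (B' : Matrix (Fin r ⊕ Fin w') (Fin r ⊕ Fin w') F) (η : Matrix (Fin r ⊕ Fin w') γ F)
    (hη : LinearIndependent F η.toRows₁.row) (hc : r + m = Fintype.card γ) :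
    Nat.card (KS ε (fromBlocks 0 0 0 M) B' {η}) =
      Nat.card (KS ε (fromBlocks 0 0 0 M) B' {etaS F (Fin r) (Fin w') (Fin m)}) := by
  obtain ⟨Q, Q', h1, h2, hQ⟩ := right_normal _ hη hc
  have hMd := (isUnit_iff_isUnit_det M).1 hM
  have := KS_eq (ε := ε) (ω0 := fromBlocks (0 : Matrix (Fin r) (Fin r) F) 0 0 M) (B' := B') {η}
    (P := 1) (P' := 1) (Q := Q) (Q' := Q') (by simp) (by simp) h1 h2
    (fromRows 0 (-(M⁻¹ * (η.toRows₂ * Q)))) {etaS F (Fin r) (Fin w') (Fin m)} ?_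
  · simpa using this
  · have base : (fromBlocks 0 0 0 M : Matrix (Fin r ⊕ Fin w') (Fin r ⊕ Fin w') F) * fromRows (0 : Matrix (Fin r) (Fin m ⊕ Fin r) F)
        (-(M⁻¹ * (η.toRows₂ * Q))) + η * Q = etaS F (Fin r) (Fin w') (Fin m) := by
      conv_lhs => enter [2]; rw [← fromRows_toRows η]
      rw [fromRows_mul, hQ, fromBlocks_mul_fromRows]
      simp only [Matrix.mul_neg, ← Matrix.mul_assoc, mul_nonsing_inv _ hMd, etaS]
      ext (i | i) (j | j) <;> simp
    intro η'
    simp only [Set.mem_singleton_iff, transpose_one, Matrix.one_mul]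
    rw [← base]
    constructor
    · rintro rfl; rfl
    · intro h
      have h' := add_left_cancel h
      rw [← Matrix.mul_one η', ← h1, ← Matrix.mul_assoc, h', Matrix.mul_assoc, h1, Matrix.mul_one]

lemma card_good (r w' : ℕ) (hr : r ≤ Fintype.card γ) :
    (Nat.card {η : Matrix (Fin r ⊕ Fin w') γ F // LinearIndependent F η.toRows₁.row} : ℝ) =
      (∏ i ∈ Finset.range r, ((Fintype.card F : ℝ) ^ (Fintype.card γ) - (Fintype.card F : ℝ) ^ i)) *
        (Fintype.card F : ℝ) ^ (w' * Fintype.card γ) := by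
  have e : {η : Matrix (Fin r ⊕ Fin w') γ F // LinearIndependent F η.toRows₁.row} ≃
      {s : Fin r → (γ → F) // LinearIndependent F s} × Matrix (Fin w') γ F :=
    Equiv.mk (fun η => (⟨η.1.toRows₁, η.2⟩, η.1.toRows₂))
      (fun p => ⟨fromRows (Matrix.of p.1.1) p.2, p.1.2⟩)
      (fun η => Subtype.ext (fromRows_toRows _)) (fun p => rfl)
  have := card_indep_aux (F := F) (V := γ → F) (k := r) (by simpa using hr)
  rw [Nat.card_congr e, Nat.card_prod, Nat.cast_mul, this, card_mat]
  simp

lemma KS_fib {ε : F} (ω0 B' : Matrix κ κ F) :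
    Nat.card (KS ε ω0 B' (Set.univ : Set (Matrix κ γ F))) =
      ∑ η : Matrix κ γ F, Nat.card (KS ε ω0 B' {η}) := by
  rw [← Nat.card_sigma]
  refine Nat.card_congr (Equiv.mk (fun t => ⟨t.1.1.toBlocks₁₂, ⟨t.1, t.2.1, t.2.2.1, t.2.2.2.1,
    t.2.2.2.2.1, rfl⟩⟩) (fun t => ⟨t.2.1, t.2.2.1, t.2.2.2.1, t.2.2.2.2.1, t.2.2.2.2.2.1,
      trivial⟩) ?_ ?_)
  · intro t; rfl
  · rintro ⟨η, ⟨t, h1, h2, h3, h4, h5⟩⟩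
    rw [Set.mem_singleton_iff] at h5
    subst h5
    rfl

/-- Lemma II -/
lemma KS_count (h2 : (2 : F) ≠ 0) {ε : F} (hε : ε * ε = 1) (ω0 B' : Matrix κ κ F)
    (hs : ω0ᵀ = ε • ω0) (hsk : B'ᵀ * ω0 = -(ω0 * B')) (hn : IsNilpotent B') (r w' m : ℕ)
    (hw : ω0.rank = w') (hr : r + w' = Fintype.card κ) (hc : r + m = Fintype.card γ) :
    (Nat.card (KS ε ω0 B' (Set.univ : Set (Matrix κ γ F))) : ℝ) * gl F m =
      gl F (Fintype.card γ) * (Fintype.card F : ℝ) ^ (Fintype.card κ * Fintype.card γ) *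
        Nat.card (NilS ε (Fin m)) := by
  obtain ⟨P, P', M, b11, b12, b22, h1, h1', hM, hMu, hMs, hB, hbs⟩ :=
    ker_normal hε ω0 B' hs hsk r w' hw hr
  have hBn := cj_nilp h1 h1' hn
  rw [KS_eq (ε := ε) (E := (Set.univ : Set (Matrix κ γ F))) h1 h1' (Matrix.one_mul 1) (Matrix.one_mul 1) 0
    (Set.univ : Set (Matrix (Fin r ⊕ Fin w') γ F)) (by simp), hM, hB, KS_fib]
  rw [hB] at hBn
  classical
  have key : ∀ η : Matrix (Fin r ⊕ Fin w') γ F,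
      (Nat.card (KS ε (fromBlocks 0 0 0 M) (fromBlocks b11 b12 0 b22) {η}) : ℝ) =
      if LinearIndependent F η.toRows₁.row then
        (Nat.card (NilS ε (Fin m)) : ℝ) * (Fintype.card F : ℝ) ^ (2 * m * r + r * r) else 0 := by
    intro η
    split_ifs with h
    · rw [KS_eta M hMu _ η h hc, K_norm hε M hMu hMs _ _ _ hBn hbs]
      simp only [Nat.card_prod, Nat.cast_mul, card_mat, Fintype.card_fin]
      have := frm_mul (F := F) (ι := Fin r) h2 hε
      rw [Fintype.card_fin] at this
      rw [pow_add, ← this]; ring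
    · have : IsEmpty (KS ε (fromBlocks 0 0 0 M) (fromBlocks b11 b12 0 b22) {η}) :=
        ⟨fun t => h (KS_indep M _ η t.1 t.2)⟩
      simp
  rw [Nat.cast_sum, Finset.sum_congr rfl fun η _ => key η, ← Finset.sum_filter, Finset.sum_const,
    nsmul_eq_mul]
  have hg := card_good (F := F) (γ := γ) r w' (by omega)
  rw [Nat.card_eq_fintype_card, Fintype.card_subtype] at hg
  rw [hg, ← hc, gl_split, ← hr]
  ring

lemma KS_count_zero {ε : F} (hε : ε * ε = 1) (ω0 B' : Matrix κ κ F)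
    (hs : ω0ᵀ = ε • ω0) (hsk : B'ᵀ * ω0 = -(ω0 * B')) (r w' : ℕ)
    (hw : ω0.rank = w') (hr : r + w' = Fintype.card κ) (hc : Fintype.card γ < r) :
    Nat.card (KS ε ω0 B' (Set.univ : Set (Matrix κ γ F))) = 0 := by
  obtain ⟨P, P', M, b11, b12, b22, h1, h1', hM, hMu, hMs, hB, hbs⟩ :=
    ker_normal hε ω0 B' hs hsk r w' hw hr
  rw [KS_eq (ε := ε) (E := (Set.univ : Set (Matrix κ γ F))) h1 h1' (Matrix.one_mul 1) (Matrix.one_mul 1) 0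
    (Set.univ : Set (Matrix (Fin r ⊕ Fin w') γ F)) (by simp), hM, hB, KS_fib]
  refine Finset.sum_eq_zero fun η _ => ?_
  have : IsEmpty (KS ε (fromBlocks 0 0 0 M) (fromBlocks b11 b12 0 b22) {η}) := by
    refine ⟨fun t => ?_⟩
    have := (KS_indep M _ η t.1 t.2).fintype_card_le_finrank
    simp at this; omega
  simp

end L2
end FF

namespace FF
section Img
variable {F : Type} [Field F]
variable {κ γ : Type} [Fintype κ] [Fintype γ] [DecidableEq κ] [DecidableEq γ]

/-- the inclusion of the first block -/
def inc (F κ γ : Type) [Field F] [DecidableEq κ] : Matrix (κ ⊕ γ) κ F := fromRows 1 0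

lemma inc_tr_mul (M : Matrix (κ ⊕ γ) (κ ⊕ γ) F) : (inc F κ γ)ᵀ * M = M.toRows₁ := by
  rw [inc, transpose_fromRows]
  conv_lhs => rw [← fromRows_toRows M]
  rw [fromCols_mul_fromRows]
  simp

lemma inc_tr_inc : (inc F κ γ)ᵀ * inc F κ γ = 1 := by
  rw [inc, transpose_fromRows, fromCols_mul_fromRows]
  simp

lemma mul_inc {α : Type} (M : Matrix α (κ ⊕ γ) F) : M * inc F κ γ = M.toCols₁ := by
  rw [inc]
  conv_lhs => rw [← fromCols_toCols M]
  rw [fromCols_mul_fromRows]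
  simp

lemma inc_mul {α : Type} (M : Matrix κ α F) : inc F κ γ * M = fromRows M 0 := by
  rw [inc, fromRows_mul]; simp

lemma inc_blocks (A : Matrix (κ ⊕ γ) (κ ⊕ γ) F) (h1 : A.toBlocks₂₁ = 0) (h2 : A.toBlocks₂₂ = 0) :
    A = inc F κ γ * A.toRows₁ := by
  rw [inc_mul]
  ext (i | i) j
  · simp
  · rcases j with j | j
    · exact congrFun (congrFun h1 i) j
    · exact congrFun (congrFun h2 i) j

lemma right_inv {α : Matrix κ (κ ⊕ γ) F} (h : α.rank = Fintype.card κ) : ∃ R : Matrix (κ ⊕ γ) κ F, α * R = 1 := by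
  have hs : Function.Surjective α.mulVecLin := by
    rw [← LinearMap.range_eq_top]
    apply Submodule.eq_top_of_finrank_eq
    rw [← Matrix.rank, h]; simp
  obtain ⟨g, hg⟩ := LinearMap.exists_rightInverse_of_surjective _ (LinearMap.range_eq_top.2 hs)
  refine ⟨LinearMap.toMatrix' g, ?_⟩
  have := congrArg LinearMap.toMatrix' hg
  rw [LinearMap.toMatrix'_comp] at this
  simpa [← Matrix.toLin'_apply'] using this

def YS (ε : F) (κ γ : Type) [Fintype κ] [Fintype γ] [DecidableEq κ] [DecidableEq γ] :
    Set (Matrix (κ ⊕ γ) (κ ⊕ γ) F × Matrix (κ ⊕ γ) (κ ⊕ γ) F × Matrix (κ ⊕ γ) (κ ⊕ γ) F) :=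
  {t | (IsX ε t.1 t.2.1 t.2.2 ∧ t.2.1.rank = Fintype.card κ) ∧
    t.2.1.toBlocks₂₁ = 0 ∧ t.2.1.toBlocks₂₂ = 0}

lemma YS_right {ε : F} {t} (ht : t ∈ YS ε κ γ) : ∃ R : Matrix (κ ⊕ γ) κ F, t.2.1.toRows₁ * R = 1 := by
  apply right_inv
  apply le_antisymm
  · exact rank_le_card_height _
  · rw [← ht.1.2]
    conv_lhs => rw [inc_blocks _ ht.2.1 ht.2.2]
    exact rank_mul_le_right _ _

lemma img_fwd {ε : F} (hε : ε * ε = 1) {β A' B' : Matrix κ κ F} (hx : IsX (-ε) β A' B')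
    {ω B : Matrix (κ ⊕ γ) (κ ⊕ γ) F} (hk : (ω, B) ∈ KS ε (β * A') B' Set.univ) :
    (ω, inc F κ γ * (β⁻¹ * ((inc F κ γ)ᵀ * ω)), B) ∈ YS ε κ γ ∧
      (inc F κ γ * (β⁻¹ * ((inc F κ γ)ᵀ * ω))).toBlocks₁₁ = A' ∧
      β * (inc F κ γ * (β⁻¹ * ((inc F κ γ)ᵀ * ω))).toRows₁ = (inc F κ γ)ᵀ * ω := by
  obtain ⟨⟨hs, hu, hsk, hn⟩, h11, hB11, hB21, -⟩ := hk
  dsimp only at hs hu hsk hn h11 hB11 hB21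
  have hβd := (isUnit_iff_isUnit_det β).1 hx.unit
  have hωd := (isUnit_iff_isUnit_det ω).1 hu
  set E := inc F κ γ with hE
  set α := β⁻¹ * (Eᵀ * ω) with hα
  clear_value α E
  have hβα : β * α = Eᵀ * ω := by rw [hα, ← Matrix.mul_assoc, mul_nonsing_inv _ hβd, Matrix.one_mul]
  have hEα1 : (E * α).toRows₁ = α := by rw [hE, inc_mul]; simp
  have hαE : α * E = A' := by
    have : Eᵀ * ω * E = β * A' := by
      rw [← h11, hE, inc_tr_mul, mul_inc]; rfl
    rw [hα, Matrix.mul_assoc, this, ← Matrix.mul_assoc, nonsing_inv_mul _ hβd, Matrix.one_mul]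
  have hBE : B * E = E * B' := by
    rw [hE, mul_inc, inc_mul, ← hB11]
    ext (i | i) j
    · rfl
    · exact congrFun (congrFun hB21 i) j
  have hEα : E * α = fromBlocks A' α.toCols₂ 0 0 := by
    rw [hE, inc_mul, ← hαE, hE, mul_inc]
    ext (i | i) (j | j) <;> simp
  have hαB : α * B = B' * α := by
    have e1 : Eᵀ * ω * B = -(B'ᵀ * (Eᵀ * ω)) := by
      have : ω * B = -(Bᵀ * ω) := by rw [hsk, neg_neg]
      rw [Matrix.mul_assoc, this, Matrix.mul_neg, ← Matrix.mul_assoc, ← transpose_mul, hBE,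
        transpose_mul, Matrix.mul_assoc]
    have e2 : β * (α * B) = β * (B' * α) := by
      rw [← Matrix.mul_assoc, hβα, e1, ← hβα, ← Matrix.mul_assoc, hx.skB, Matrix.neg_mul, neg_neg,
        Matrix.mul_assoc]
    have := congrArg (fun Z => β⁻¹ * Z) e2
    simpa [← Matrix.mul_assoc, nonsing_inv_mul _ hβd] using this
  refine ⟨⟨⟨⟨hs, hu, ?_, hsk, ?_, hn, ?_⟩, ?_⟩, ?_, ?_⟩, ?_, ?_⟩
  · show (E * α)ᵀ * ω = -(ω * (E * α))
    have hωE : ω * E = ε • (β * α)ᵀ := by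
      rw [hβα, transpose_mul, transpose_transpose, hs, Matrix.smul_mul, smul_smul, hε, one_smul]
    rw [transpose_mul, Matrix.mul_assoc, ← hβα, ← Matrix.mul_assoc, ← Matrix.mul_assoc, hωE,
      transpose_mul, hx.sym]
    simp [smul_smul, hε]
  · show IsNilpotent (E * α)
    rw [hEα, nilp_block]; exact ⟨hx.nA, IsNilpotent.zero⟩
  · show E * α * B = B * (E * α)
    rw [Matrix.mul_assoc, hαB, ← Matrix.mul_assoc, ← Matrix.mul_assoc, hBE]
  · show (E * α).rank = _
    apply le_antisymm
    · exact (rank_mul_le_right _ _).trans (rank_le_card_height _)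
    · have : β * (Eᵀ * (E * α)) * (ω⁻¹ * E) = 1 := by
        rw [← Matrix.mul_assoc Eᵀ, hE, inc_tr_inc, ← hE, Matrix.one_mul, hβα]
        rw [Matrix.mul_assoc, ← Matrix.mul_assoc ω, mul_nonsing_inv _ hωd, Matrix.one_mul, hE,
          inc_tr_inc]
      calc Fintype.card κ = (β * (Eᵀ * (E * α)) * (ω⁻¹ * E)).rank := by rw [this, rank_one]
        _ ≤ _ := (rank_mul_le_left _ _).trans ((rank_mul_le_right _ _).trans (rank_mul_le_right _ _))
  · show (E * α).toBlocks₂₁ = 0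
    rw [hEα]; simp
  · show (E * α).toBlocks₂₂ = 0
    rw [hEα]; simp
  · rw [hEα]; simp
  · rw [hEα1, hβα]

lemma img_bwd {ε : F} (hε : ε * ε = 1) {ω A B : Matrix (κ ⊕ γ) (κ ⊕ γ) F}
    (hy : (ω, A, B) ∈ YS ε κ γ) :
    ∃ β, IsX (-ε) β A.toBlocks₁₁ B.toBlocks₁₁ ∧
      (ω, B) ∈ KS ε (β * A.toBlocks₁₁) B.toBlocks₁₁ Set.univ ∧
      A = inc F κ γ * (β⁻¹ * ((inc F κ γ)ᵀ * ω)) := by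
  obtain ⟨R, hR⟩ := YS_right hy
  obtain ⟨⟨hx, hrk⟩, h21, h22⟩ := hy
  dsimp only at hx hrk h21 h22 hR
  have hωd := (isUnit_iff_isUnit_det ω).1 hx.unit
  set E := inc F κ γ with hE
  have hA := inc_blocks A h21 h22
  rw [← hE] at hA
  set α := A.toRows₁ with hα
  set N := Eᵀ * ω with hN
  clear_value α N E
  have hωE : ω * E = ε • Nᵀ := by
    rw [hN, transpose_mul, transpose_transpose, hx.sym, Matrix.smul_mul, smul_smul, hε, one_smul]
  have hskA : αᵀ * N = -(ε • (Nᵀ * α)) := by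
    have := hx.skA
    rw [hA, transpose_mul, Matrix.mul_assoc, ← hN, ← Matrix.mul_assoc, hωE] at this
    rw [this, Matrix.smul_mul]
  have hN1 : N = (-ε) • ((N * R)ᵀ * α) := by
    have := congrArg (fun Z => Rᵀ * Z) hskA
    simp only [← Matrix.mul_assoc, ← transpose_mul, hR] at this
    rw [transpose_one, Matrix.one_mul] at this
    conv_lhs => rw [this]
    simp [transpose_mul, Matrix.mul_assoc]
  set β := N * R with hβ
  clear_value β
  have hβs : βᵀ = (-ε) • β := by
    have : β = (-ε) • βᵀ := by
      conv_lhs => rw [hβ, hN1]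
      rw [Matrix.smul_mul, Matrix.mul_assoc, hR, Matrix.mul_one]
    conv_rhs => rw [this]
    simp [smul_smul, hε]
  have hβα : β * α = N := by
    conv_rhs => rw [hN1, hβs]
    simp [smul_smul, hε]
  have hβu : IsUnit β := by
    apply IsUnit.of_mul_eq_one (α * (ω⁻¹ * E))
    rw [← Matrix.mul_assoc, hβα, hN, Matrix.mul_assoc, ← Matrix.mul_assoc ω, mul_nonsing_inv _ hωd,
      Matrix.one_mul, hE, inc_tr_inc]
  have hβd := (isUnit_iff_isUnit_det β).1 hβu
  have hA11 : A.toBlocks₁₁ = α * E := by rw [hE, mul_inc, hα]; rfl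
  have hBE0 : B * E = E * (α * B * R) := by
    have h := hx.com
    rw [hA] at h
    have := congrArg (fun Z => Z * R) h
    simp only [Matrix.mul_assoc, hR, Matrix.mul_one] at this
    rw [← this]; simp only [Matrix.mul_assoc]
  have hB21 : B.toBlocks₂₁ = 0 := by
    rw [hE, mul_inc, inc_mul] at hBE0
    ext i j
    exact congrFun (congrFun hBE0 (.inr i)) j
  have hBE : B * E = E * B.toBlocks₁₁ := by
    rw [hE, mul_inc, inc_mul]
    ext (i | i) j
    · rfl
    · exact congrFun (congrFun hB21 i) j
  have hαB : α * B = B.toBlocks₁₁ * α := by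
    have h := hx.com
    rw [hA, ← Matrix.mul_assoc B, hBE] at h
    have := congrArg (fun Z => Eᵀ * Z) h
    simp only [← Matrix.mul_assoc] at this
    rw [hE, inc_tr_inc] at this
    simpa using this
  have hω11 : β * (α * E) = ω.toBlocks₁₁ := by
    rw [← Matrix.mul_assoc, hβα, hE, mul_inc, hN, hE, inc_tr_mul]; rfl
  have hε' : -ε * -ε = 1 := by simpa using hε
  refine ⟨β, ⟨hβs, hβu, ?_, ?_, ?_, ?_, ?_⟩, ⟨⟨hx.sym, hx.unit, hx.skB, hx.nB⟩, ?_, rfl, hB21,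
    trivial⟩, ?_⟩
  · rw [skew_iff hε' hβs, hA11, hω11, neg_neg]
    ext i j
    exact congrFun (congrFun hx.sym (.inl i)) (.inl j)
  · have e1 : B.toBlocks₁₁ᵀ * β * α = -(β * B.toBlocks₁₁) * α := by
      rw [Matrix.mul_assoc, hβα, Matrix.neg_mul, Matrix.mul_assoc β, ← hαB, ← Matrix.mul_assoc, hβα, hN,
        Matrix.mul_assoc Eᵀ, ← neg_eq_iff_eq_neg.2 hx.skB, Matrix.mul_neg, neg_neg, ← Matrix.mul_assoc,
        ← Matrix.mul_assoc, ← transpose_mul, ← transpose_mul, hBE]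
    have := congrArg (fun Z => Z * R) e1
    simpa only [Matrix.mul_assoc, hR, Matrix.mul_one] using this
  · have := hx.nA
    rw [← fromBlocks_toBlocks A, h21, nilp_block] at this
    exact this.1
  · have := hx.nB
    rw [← fromBlocks_toBlocks B, hB21, nilp_block] at this
    exact this.1
  · rw [hA11, Matrix.mul_assoc, ← hBE, ← Matrix.mul_assoc, hαB, Matrix.mul_assoc]
  · show ω.toBlocks₁₁ = _
    rw [hA11, hω11]
  · show A = E * (β⁻¹ * N)
    rw [← hβα, ← Matrix.mul_assoc β⁻¹, nonsing_inv_mul _ hβd, Matrix.one_mul]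
    exact hA

end Img
end FF

namespace FF
section Img2
variable {F : Type} [Field F] [Fintype F]
variable {κ γ : Type} [Fintype κ] [Fintype γ] [DecidableEq κ] [DecidableEq γ]

open Classical in
lemma card_YS {ε : F} (hε : ε * ε = 1) : Nat.card (YS ε κ γ) =
    ∑ p : {p : Matrix κ κ F × Matrix κ κ F × Matrix κ κ F // IsX (-ε) p.1 p.2.1 p.2.2},
      Nat.card (KS ε (p.1.1 * p.1.2.1) p.1.2.2 (Set.univ : Set (Matrix κ γ F))) := by
  rw [← Nat.card_sigma]
  symm
  refine Nat.card_eq_of_bijective (fun s => ⟨(s.2.1.1,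
    inc F κ γ * (s.1.1.1⁻¹ * ((inc F κ γ)ᵀ * s.2.1.1)), s.2.1.2), (img_fwd hε s.1.2 s.2.2).1⟩)
    ⟨?_, ?_⟩
  · rintro ⟨⟨⟨β, A', B'⟩, hx⟩, ⟨⟨ω, B⟩, hk⟩⟩ ⟨⟨⟨β2, A2, B2⟩, hx2⟩, ⟨⟨ω2, C⟩, hk2⟩⟩ he
    have he' := Subtype.ext_iff.1 he
    simp only [Prod.mk.injEq] at he'
    obtain ⟨h1, h2, h3⟩ := he'
    subst h1 h3
    obtain ⟨hy, h11, hb⟩ := img_fwd hε hx hk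
    obtain ⟨hy2, h112, hb2⟩ := img_fwd hε hx2 hk2
    dsimp only at h2 h11 hb h112 hb2
    have hA : A' = A2 := by rw [← h11, ← h112, h2]
    have hB : B' = B2 := hk.2.2.1.symm.trans hk2.2.2.1
    obtain ⟨R, hR⟩ := YS_right hy2
    dsimp only at hR
    have hβ : β = β2 := by
      rw [h2] at hb
      have := congrArg (fun Z => Z * R) (hb.trans hb2.symm)
      simpa only [Matrix.mul_assoc, hR, Matrix.mul_one] using this
    subst hA hB hβ
    rfl
  · rintro ⟨⟨ω, A, B⟩, hy⟩
    obtain ⟨β, hx, hk, hA⟩ := img_bwd hε hy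
    refine ⟨⟨⟨(β, _, _), hx⟩, ⟨(ω, B), hk⟩⟩, ?_⟩
    refine Subtype.ext ?_
    show (ω, inc F κ γ * (β⁻¹ * ((inc F κ γ)ᵀ * ω)), B) = (ω, A, B)
    rw [← hA]

lemma YS_count (h2 : (2 : F) ≠ 0) {ε : F} (hε : ε * ε = 1) (w c : ℕ)
    (hw : Fintype.card κ = w) (hc : Fintype.card γ = c) : (Nat.card (YS ε κ γ) : ℝ) =
    ∑ w' ∈ Finset.range (w + 1), if w ≤ c + w' then
      (Nat.card (XS (-ε) κ w') : ℝ) * (gl F (c) *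
        (Fintype.card F : ℝ) ^ (w * c) *
        Nat.card (NilS ε (Fin (c + w' - w))) /
          gl F (c + w' - w)) else 0 := by
  subst hw hc
  classical
  rw [card_YS hε, Nat.cast_sum]
  have hmaps : ∀ p ∈ (Finset.univ : Finset {p : Matrix κ κ F × Matrix κ κ F × Matrix κ κ F //
      IsX (-ε) p.1 p.2.1 p.2.2}), p.1.2.1.rank ∈ Finset.range (Fintype.card κ + 1) := by
    intro p _
    rw [Finset.mem_range]
    exact Nat.lt_succ_of_le (rank_le_card_height _)
  rw [← Finset.sum_fiberwise_of_maps_to hmaps]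
  refine Finset.sum_congr rfl fun w' hw' => ?_
  rw [Finset.mem_range] at hw'
  have hcard : (Finset.univ.filter fun p : {p : Matrix κ κ F × Matrix κ κ F × Matrix κ κ F //
      IsX (-ε) p.1 p.2.1 p.2.2} => p.1.2.1.rank = w').card = Nat.card (XS (-ε) κ w') := by
    rw [← Fintype.card_subtype, ← Nat.card_eq_fintype_card]
    exact Nat.card_congr (Equiv.subtypeSubtypeEquivSubtypeInter
      (fun p : Matrix κ κ F × Matrix κ κ F × Matrix κ κ F => IsX (-ε) p.1 p.2.1 p.2.2)
      (fun p => p.2.1.rank = w'))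
  have hε' : -ε * -ε = 1 := by simpa using hε
  have hrk : ∀ p : {p : Matrix κ κ F × Matrix κ κ F × Matrix κ κ F //
      IsX (-ε) p.1 p.2.1 p.2.2}, p.1.2.1.rank = w' → (p.1.1 * p.1.2.1).rank = w' := by
    intro p hp
    rw [rank_mul_eq_right_of_isUnit_det _ _ ((isUnit_iff_isUnit_det _).1 p.2.unit), hp]
  have hsym : ∀ p : {p : Matrix κ κ F × Matrix κ κ F × Matrix κ κ F //
      IsX (-ε) p.1 p.2.1 p.2.2}, (p.1.1 * p.1.2.1)ᵀ = ε • (p.1.1 * p.1.2.1) := by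
    intro p
    have := (skew_iff hε' p.2.sym).1 p.2.skA
    simpa using this
  have hskw : ∀ p : {p : Matrix κ κ F × Matrix κ κ F × Matrix κ κ F //
      IsX (-ε) p.1 p.2.1 p.2.2}, p.1.2.2ᵀ * (p.1.1 * p.1.2.1) = -(p.1.1 * p.1.2.1 * p.1.2.2) := by
    intro p
    rw [← Matrix.mul_assoc, p.2.skB, Matrix.neg_mul, Matrix.mul_assoc, ← p.2.com, Matrix.mul_assoc]
  split_ifs with hle
  · rw [← hcard, ← nsmul_eq_mul, ← Finset.sum_const]
    refine Finset.sum_congr rfl fun p hp => ?_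
    have hp' := (Finset.mem_filter.1 hp).2
    rw [eq_div_iff (gl_pos _).ne']
    exact KS_count h2 hε _ _ (hsym p) (hskw p) p.2.nB (Fintype.card κ - w') w' _ (hrk p hp')
      (by omega) (by omega)
  · refine Finset.sum_eq_zero fun p hp => ?_
    have hp' := (Finset.mem_filter.1 hp).2
    rw [KS_count_zero hε _ _ (hsym p) (hskw p) (Fintype.card κ - w') w' (hrk p hp')
      (by omega) (by omega)]
    simp

lemma card_H : (Nat.card {g : GL (κ ⊕ γ) F | g.1.toBlocks₂₁ = 0} : ℝ) =
    gl F (Fintype.card κ) * gl F (Fintype.card γ) *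
      (Fintype.card F : ℝ) ^ (Fintype.card κ * Fintype.card γ) := by
  rw [← card_GL, ← card_GL, ← card_mat, ← Nat.cast_mul, ← Nat.cast_mul, ← Nat.card_prod,
    ← Nat.card_prod]
  congr 1
  symm
  have hu : ∀ p : (GL κ F × GL γ F) × Matrix κ γ F, IsUnit (fromBlocks p.1.1.1 p.2 0 p.1.2.1) :=
    fun p => isUnit_fromBlocks_zero₂₁.2 ⟨p.1.1.isUnit, p.1.2.isUnit⟩
  refine Nat.card_eq_of_bijective (fun p => ⟨(hu p).unit, ?_⟩) ⟨?_, ?_⟩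
  · simp
  · rintro ⟨⟨a, d⟩, b⟩ ⟨⟨a', d'⟩, b'⟩ h
    have := congrArg (fun g => (g.1 : GL (κ ⊕ γ) F).1) h
    simp only [IsUnit.unit_spec, fromBlocks_inj] at this
    obtain ⟨h1, h2, -, h3⟩ := this
    subst h2
    rw [Units.ext h1, Units.ext h3]
  · rintro ⟨g, hg⟩
    have hg' : g.1.toBlocks₂₁ = 0 := hg
    have h1 := fromBlocks_toBlocks g.1
    have h2 := g.isUnit
    rw [← h1, hg', isUnit_fromBlocks_zero₂₁] at h2
    refine ⟨((h2.1.unit, h2.2.unit), g.1.toBlocks₁₂), Subtype.ext (Units.ext ?_)⟩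
    simp only [IsUnit.unit_spec]
    conv_rhs => rw [← h1, hg']

/-- base change action -/
def actX {ι : Type} [Fintype ι] [DecidableEq ι] (g : GL ι F)
    (t : Matrix ι ι F × Matrix ι ι F × Matrix ι ι F) :
    Matrix ι ι F × Matrix ι ι F × Matrix ι ι F :=
  ((g⁻¹).1ᵀ * t.1 * (g⁻¹).1, g.1 * t.2.1 * (g⁻¹).1, g.1 * t.2.2 * (g⁻¹).1)

lemma img_group (ε : F) : (Nat.card (XS ε (κ ⊕ γ) (Fintype.card κ)) : ℝ) *
    (gl F (Fintype.card κ) * gl F (Fintype.card γ) *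
      (Fintype.card F : ℝ) ^ (Fintype.card κ * Fintype.card γ)) =
    gl F (Fintype.card κ + Fintype.card γ) * Nat.card (YS ε κ γ) := by
  rw [← card_H, ← Fintype.card_sum, ← card_GL, ← Nat.cast_mul, ← Nat.cast_mul]
  congr 1
  apply group_count actX
  · intro t; simp [actX]
  · intro g h t; simp [actX, Matrix.mul_assoc, transpose_mul]
  · rintro g t ⟨h1, h2⟩
    have e1 : (g⁻¹).1 * g.1 = 1 := by rw [← Units.val_mul]; simp
    have e2 : g.1 * (g⁻¹).1 = 1 := by rw [← Units.val_mul]; simp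
    exact ⟨h1.tr e1 e2, by rw [actX, cj_rank e1]; exact h2⟩
  · rintro t ht
    exact ht.1
  · rintro ⟨ω, A, B⟩ ⟨h1, h2⟩
    dsimp only at h1 h2
    obtain ⟨S', hS'⟩ := Submodule.exists_isCompl (LinearMap.range A.mulVecLin)
    have hk' : Module.finrank F S' = Fintype.card γ := by
      have := Submodule.finrank_add_eq_of_isCompl hS'
      rw [Module.finrank_fintype_fun_eq_card, ← Matrix.rank, h2, Fintype.card_sum] at this
      omega
    obtain ⟨P, P', e1, e2, hP, hP'⟩ := exists_frame hS' h2 hk'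
    have hPS : ∀ v ∈ LinearMap.range A.mulVecLin, ∀ i, (P' *ᵥ v) (Sum.inr i) = 0 := by
      intro v hv
      obtain ⟨a, b, hab⟩ : ∃ a b, P' *ᵥ v = Sum.elim a b :=
        ⟨_, _, (Sum.elim_comp_inl_inr _).symm⟩
      have hv' : v = P *ᵥ Sum.elim a 0 + P *ᵥ Sum.elim 0 b := by
        rw [← mulVec_add]
        have : (Sum.elim a (0 : γ → F) + Sum.elim (0 : κ → F) b : κ ⊕ γ → F) = Sum.elim a b := by
          ext (i | i) <;> simp
        rw [this, ← hab, mulVec_mulVec, e1, one_mulVec]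
      have hb : P *ᵥ Sum.elim 0 b = 0 := by
        refine (Submodule.disjoint_def.1 hS'.disjoint) _ ?_ (hP' b)
        have : P *ᵥ Sum.elim 0 b = v - P *ᵥ Sum.elim a 0 := by rw [hv']; simp
        rw [this]
        exact Submodule.sub_mem _ hv (hP a)
      have e4 := congrArg (fun z => P' *ᵥ z) hb
      simp only [mulVec_mulVec, e2, one_mulVec, mulVec_zero] at e4
      intro i
      rw [hab]
      exact congrFun e4 (.inr i)
    have hlow : ∀ i j, (P' * A * P) (.inr i) j = 0 := by
      intro i j
      have := hPS ((A * P) *ᵥ Pi.single j 1) (by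
        rw [← mulVec_mulVec]; exact ⟨_, rfl⟩) i
      rw [mulVec_mulVec, ← Matrix.mul_assoc] at this
      simpa using this
    refine ⟨⟨P', P, e2, e1⟩, ⟨h1.tr e1 e2, ?_⟩, ?_, ?_⟩
    · show (P' * A * P).rank = _
      rw [cj_rank e1]; exact h2
    · ext i j; exact hlow i (.inl j)
    · ext i j; exact hlow i (.inr j)
  · intro y hy g
    have e1 : (g⁻¹).1 * g.1 = 1 := by rw [← Units.val_mul]; simp
    have e2 : g.1 * (g⁻¹).1 = 1 := by rw [← Units.val_mul]; simp
    obtain ⟨R, hR⟩ := YS_right hy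
    have hA := inc_blocks _ hy.2.1 hy.2.2
    have hgA : (g.1 * y.2.1).toRows₂ = g.1.toBlocks₂₁ * y.2.1.toRows₁ := by
      conv_lhs => rw [hA]
      rw [← Matrix.mul_assoc, mul_inc]
      rfl
    constructor
    · intro h
      have hA2 := inc_blocks _ h.2.1 h.2.2
      have : (g.1 * y.2.1).toRows₂ = 0 := by
        have e : g.1 * y.2.1 = (actX g y).2.1 * g.1 := by
          simp only [actX]; rw [Matrix.mul_assoc, e1, Matrix.mul_one]
        rw [e, hA2, inc_mul, fromRows_mul]
        simp
      rw [hgA] at this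
      show g.1.toBlocks₂₁ = 0
      have := congrArg (fun Z => Z * R) this
      simpa only [Matrix.mul_assoc, hR, Matrix.mul_one, Matrix.zero_mul] using this
    · intro h
      have h' : g.1.toBlocks₂₁ = 0 := h
      rw [h', Matrix.zero_mul] at hgA
      have hlow : ∀ i j, (actX g y).2.1 (.inr i) j = 0 := by
        intro i j
        have : (g.1 * y.2.1 * (g⁻¹).1).toRows₂ = (g.1 * y.2.1).toRows₂ * (g⁻¹).1 := rfl
        rw [hgA, Matrix.zero_mul] at this
        exact congrFun (congrFun this i) j
      refine ⟨⟨hy.1.1.tr e1 e2, ?_⟩, ?_, ?_⟩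
      · rw [actX, cj_rank e1]; exact hy.1.2
      · ext i j; exact hlow i (.inl j)
      · ext i j; exact hlow i (.inr j)

end Img2

section Tdef
variable {F : Type} [Field F] [Fintype F]

noncomputable def fN (ε : F) (m : ℕ) : ℝ := Nat.card (NilS ε (Fin m)) / gl F m

noncomputable def TX (ε : F) (v w : ℕ) : ℝ := Nat.card (XS ε (Fin v) w) / gl F v

/-- the image recursion -/
lemma TX_rec (h2 : (2 : F) ≠ 0) {ε : F} (hε : ε * ε = 1) (w c : ℕ) :
    TX ε (w + c) w = ∑ w' ∈ Finset.range (w + 1), if w ≤ c + w' then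
      fN ε (c + w' - w) * TX (-ε) w w' else 0 := by
  have h := img_group (F := F) (κ := Fin w) (γ := Fin c) ε
  rw [YS_count h2 hε w c (by simp) (by simp)] at h
  simp only [Fintype.card_fin] at h
  have hq : (0 : ℝ) < (Fintype.card F : ℝ) ^ (w * c) := pow_pos (by linarith [one_lt_card (F := F)]) _
  have hw := gl_pos (F := F) w
  have hc := gl_pos (F := F) c
  have hv := gl_pos (F := F) (w + c)
  rw [TX, card_XS (κ := Fin w ⊕ Fin c) ε w (by simp)]
  have : (Nat.card (XS ε (Fin w ⊕ Fin c) w) : ℝ) / gl F (w + c) =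
      (gl F w * gl F c * (Fintype.card F : ℝ) ^ (w * c))⁻¹ * (gl F (w + c) *
        (∑ w' ∈ Finset.range (w + 1), if w ≤ c + w' then
      (Nat.card (XS (-ε) (Fin w) w') : ℝ) * (gl F c *
        (Fintype.card F : ℝ) ^ (w * c) *
        Nat.card (NilS ε (Fin (c + w' - w))) /
          gl F (c + w' - w)) else 0)) / gl F (w + c) := by
    rw [← h]; field_simp
  rw [this, mul_div_assoc, mul_div_cancel_left₀ _ hv.ne', Finset.mul_sum]
  refine Finset.sum_congr rfl fun w' _ => ?_
  split_ifs
  · rw [fN, TX]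
    have := gl_pos (F := F) (c + w' - w)
    field_simp
  · simp

end Tdef
end FF

namespace FF
section Fit
variable {F : Type} [Field F] [Fintype F]
variable {ι κ γ : Type} [Fintype κ] [Fintype γ] [DecidableEq κ] [DecidableEq γ]
  [Fintype ι] [DecidableEq ι]

def AllS (ε : F) (ι : Type) [Fintype ι] [DecidableEq ι] : Set (Matrix ι ι F × Matrix ι ι F) :=
  {t | t.1ᵀ = ε • t.1 ∧ IsUnit t.1 ∧ t.2ᵀ * t.1 = -(t.1 * t.2)}

def UnS (ε : F) (ι : Type) [Fintype ι] [DecidableEq ι] : Set (Matrix ι ι F × Matrix ι ι F) :=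
  {t | t.1ᵀ = ε • t.1 ∧ IsUnit t.1 ∧ t.2ᵀ * t.1 = -(t.1 * t.2) ∧ IsUnit t.2}

def AllR (ε : F) (ι : Type) [Fintype ι] [DecidableEq ι] (l : ℕ) :
    Set (Matrix ι ι F × Matrix ι ι F) :=
  {t | t ∈ AllS ε ι ∧ (t.2 ^ (Fintype.card ι)).rank = l}

lemma card_AllS {ε : F} (hε : ε * ε = 1) :
    Nat.card (AllS ε ι) = Nat.card (SS ε ι) * Nat.card (FrmS (-ε) ι) := by
  rw [← Nat.card_prod]
  refine Nat.card_eq_of_bijective (fun t => (⟨t.1.1, t.2.1, t.2.2.1⟩,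
    ⟨t.1.1 * t.1.2, (skew_iff hε t.2.1).1 t.2.2.2⟩)) ⟨?_, ?_⟩
  · rintro ⟨⟨ω, B⟩, h1, h2, h3⟩ ⟨⟨ω', B'⟩, h1', h2', h3'⟩ h
    obtain ⟨ha, hb⟩ := Prod.ext_iff.1 h
    have ha' : ω = ω' := Subtype.ext_iff.1 ha
    have hb' : ω * B = ω' * B' := Subtype.ext_iff.1 hb
    subst ha'
    have hc : B = B' := h2.mul_left_cancel hb'
    subst hc
    rfl
  · rintro ⟨⟨ω, h1, h2⟩, ⟨D, hD⟩⟩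
    have hd := (isUnit_iff_isUnit_det ω).1 h2
    have e : ω * (ω⁻¹ * D) = D := by rw [← Matrix.mul_assoc, mul_nonsing_inv _ hd, Matrix.one_mul]
    refine ⟨⟨(ω, ω⁻¹ * D), h1, h2, ?_⟩, ?_⟩
    · show (ω⁻¹ * D)ᵀ * ω = -(ω * (ω⁻¹ * D))
      rw [skew_iff hε h1, e]; exact hD
    · refine Prod.ext rfl (Subtype.ext e)

lemma card_UnS {ε : F} (hε : ε * ε = 1) :
    Nat.card (UnS ε ι) = Nat.card (SS ε ι) * Nat.card (SS (-ε) ι) := by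
  rw [← Nat.card_prod]
  refine Nat.card_eq_of_bijective (fun t => (⟨t.1.1, t.2.1, t.2.2.1⟩,
    ⟨t.1.1 * t.1.2, (skew_iff hε t.2.1).1 t.2.2.2.1, t.2.2.1.mul t.2.2.2.2⟩)) ⟨?_, ?_⟩
  · rintro ⟨⟨ω, B⟩, h1, h2, h3⟩ ⟨⟨ω', B'⟩, h1', h2', h3'⟩ h
    obtain ⟨ha, hb⟩ := Prod.ext_iff.1 h
    have ha' : ω = ω' := Subtype.ext_iff.1 ha
    have hb' : ω * B = ω' * B' := Subtype.ext_iff.1 hb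
    subst ha'
    have hc : B = B' := h2.mul_left_cancel hb'
    subst hc
    rfl
  · rintro ⟨⟨ω, h1, h2⟩, ⟨D, hD, hDu⟩⟩
    have hd := (isUnit_iff_isUnit_det ω).1 h2
    have e : ω * (ω⁻¹ * D) = D := by rw [← Matrix.mul_assoc, mul_nonsing_inv _ hd, Matrix.one_mul]
    have hi : IsUnit ω⁻¹ := by
      rw [isUnit_iff_isUnit_det]; exact isUnit_nonsing_inv_det _ hd
    refine ⟨⟨(ω, ω⁻¹ * D), h1, h2, ?_, ?_⟩, ?_⟩
    · show (ω⁻¹ * D)ᵀ * ω = -(ω * (ω⁻¹ * D))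
      rw [skew_iff hε h1, e]; exact hD
    · exact hi.mul hDu
    · refine Prod.ext rfl (Subtype.ext e)

lemma AllS.tr {ε : F} {t} (h : t ∈ AllS ε ι) {P : Matrix ι κ F}
    {P' : Matrix κ ι F} (h1 : P * P' = 1) (h2 : P' * P = 1) :
    (Pᵀ * t.1 * P, P' * t.2 * P) ∈ AllS ε κ :=
  ⟨tr_sym P h.1, tr_unit h1 h2 h.2.1, tr_skew h1 h.2.2⟩

lemma card_AllR (ε : F) (l : ℕ) (h : Fintype.card ι = Fintype.card κ) :
    Nat.card (AllR ε ι l) = Nat.card (AllR ε κ l) := by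
  obtain ⟨P, P', h1, h2⟩ := exists_perm (F := F) h
  refine Nat.card_congr (Equiv.mk
    (fun t => ⟨(Pᵀ * t.1.1 * P, P' * t.1.2 * P), AllS.tr t.2.1 h1 h2, by
      dsimp only; rw [cj_pow h1 h2, cj_rank h1, ← h]; exact t.2.2⟩)
    (fun t => ⟨(P'ᵀ * t.1.1 * P', P * t.1.2 * P'), AllS.tr t.2.1 h2 h1, by
      dsimp only; rw [cj_pow h2 h1, cj_rank h2, h]; exact t.2.2⟩) ?_ ?_)
  · rintro ⟨⟨ω, A⟩, ht⟩
    simp [cj_inv h1, tr_inv h1]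
  · rintro ⟨⟨ω, A⟩, ht⟩
    simp [cj_inv h2, tr_inv h2]

lemma intertw {N : Matrix κ κ F} {T : Matrix γ γ F} (hN : IsNilpotent N) (hT : IsUnit T)
    (X : Matrix κ γ F) (h : X * T = N * X) : X = 0 := by
  obtain ⟨k, hk⟩ := hN
  have : ∀ j, X * T ^ j = N ^ j * X := by
    intro j
    induction j with
    | zero => simp
    | succ j ih => rw [pow_succ, ← Matrix.mul_assoc, ih, Matrix.mul_assoc, h, ← Matrix.mul_assoc, pow_succ]
  have h1 := this k
  rw [hk, Matrix.zero_mul] at h1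
  obtain ⟨u, hu⟩ := (hT.pow k).exists_right_inv
  rw [← Matrix.mul_one X, ← hu, ← Matrix.mul_assoc, h1, Matrix.zero_mul]

lemma nilp_tr {N : Matrix κ κ F} (hN : IsNilpotent N) : IsNilpotent Nᵀ := by
  obtain ⟨k, hk⟩ := hN
  exact ⟨k, by rw [← transpose_pow, hk, transpose_zero]⟩

lemma unit_tr {N : Matrix κ κ F} (hN : IsUnit N) : IsUnit Nᵀ := by
  rw [isUnit_iff_isUnit_det] at *; rwa [det_transpose]

lemma intertw' {N : Matrix κ κ F} {T : Matrix γ γ F} (hN : IsNilpotent N) (hT : IsUnit T)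
    (X : Matrix γ κ F) (h : T * X = X * N) : X = 0 := by
  have := intertw (nilp_tr hN) (unit_tr hT) Xᵀ (by rw [← transpose_mul, ← transpose_mul, h])
  simpa using this

lemma rank_stab (B : Matrix ι ι F) (M : ℕ) (h : Fintype.card ι ≤ M) :
    (B ^ M).rank = (B ^ (Fintype.card ι)).rank := by
  have h1 := LinearMap.finrank_range_add_finrank_ker (B ^ M).mulVecLin
  have h2 := LinearMap.finrank_range_add_finrank_ker (B ^ (Fintype.card ι)).mulVecLin
  have h3 : LinearMap.ker (B ^ M).mulVecLin = LinearMap.ker (B ^ (Fintype.card ι)).mulVecLin := by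
    have := Module.End.ker_pow_eq_ker_pow_finrank_of_le (f := Matrix.toLin' B) (m := M) (by simpa using h)
    rw [← Matrix.toLin'_apply', ← Matrix.toLin'_apply', Matrix.toLin'_pow, Matrix.toLin'_pow]
    simpa using this
  rw [h3] at h1
  simp only [Matrix.rank]
  omega

lemma rank_diag (U : Matrix γ γ F) (hU : IsUnit U) :
    (fromBlocks (0 : Matrix κ κ F) 0 0 U).rank = Fintype.card γ := by
  have h1 : fromBlocks (0 : Matrix κ κ F) 0 0 U = (fromRows 0 1 : Matrix (κ ⊕ γ) γ F) * (U * (fromCols 0 1 : Matrix γ (κ ⊕ γ) F)) := by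
    ext (i | i) (j | j) <;> simp [fromRows_mul, mul_fromCols]
  have h2 : U = ((fromCols 0 1 : Matrix γ (κ ⊕ γ) F) * fromBlocks (0 : Matrix κ κ F) 0 0 U) * (fromRows 0 1 : Matrix (κ ⊕ γ) γ F) := by
    rw [h1]
    simp [Matrix.mul_assoc, fromCols_mul_fromRows, fromCols_mul_fromBlocks, fromRows_mul]
  apply le_antisymm
  · rw [h1]
    exact (rank_mul_le_right _ _).trans ((rank_mul_le_left _ _).trans (rank_le_card_height _))
  · calc Fintype.card γ = U.rank := (rank_of_isUnit _ hU).symm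
      _ ≤ _ := by
        conv_lhs => rw [h2]
        exact (rank_mul_le_left _ _).trans (rank_mul_le_right _ _)

lemma frame_low {S S' : Submodule F (ι → F)} (hS' : IsCompl S S') {P : Matrix ι (κ ⊕ γ) F}
    {P' : Matrix (κ ⊕ γ) ι F} (e1 : P * P' = 1) (e2 : P' * P = 1)
    (hP : ∀ x, P *ᵥ (Sum.elim x 0) ∈ S) (hP' : ∀ y, P *ᵥ (Sum.elim 0 y) ∈ S') :
    (∀ v ∈ S, ∀ i, (P' *ᵥ v) (Sum.inr i) = 0) ∧ (∀ v ∈ S', ∀ i, (P' *ᵥ v) (Sum.inl i) = 0) := by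
  have hv : ∀ v, v = P *ᵥ Sum.elim (fun i => (P' *ᵥ v) (.inl i)) 0 +
      P *ᵥ Sum.elim 0 (fun i => (P' *ᵥ v) (.inr i)) := by
    intro v
    rw [← mulVec_add]
    have : (Sum.elim (fun i => (P' *ᵥ v) (.inl i)) (0 : γ → F) +
        Sum.elim (0 : κ → F) (fun i => (P' *ᵥ v) (.inr i)) : κ ⊕ γ → F) = P' *ᵥ v := by
      ext (i | i) <;> simp
    rw [this, mulVec_mulVec, e1, one_mulVec]
  constructor
  · intro v hvS i
    have hb : P *ᵥ Sum.elim 0 (fun i => (P' *ᵥ v) (.inr i)) = 0 := by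
      refine (Submodule.disjoint_def.1 hS'.disjoint) _ ?_ (hP' _)
      rw [← sub_eq_of_eq_add' (hv v)]
      exact Submodule.sub_mem _ hvS (hP _)
    have e4 := congrArg (fun z => P' *ᵥ z) hb
    simp only [mulVec_mulVec, e2, one_mulVec, mulVec_zero] at e4
    exact congrFun e4 (.inr i)
  · intro v hvS i
    have hb : P *ᵥ Sum.elim (fun i => (P' *ᵥ v) (.inl i)) 0 = 0 := by
      refine (Submodule.disjoint_def.1 hS'.disjoint) _ (hP _) ?_
      rw [← sub_eq_of_eq_add (hv v)]
      exact Submodule.sub_mem _ hvS (hP' _)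
    have e4 := congrArg (fun z => P' *ᵥ z) hb
    simp only [mulVec_mulVec, e2, one_mulVec, mulVec_zero] at e4
    exact congrFun e4 (.inl i)

end Fit
end FF

namespace FF
section Fit2
variable {F : Type} [Field F] [Fintype F]
variable {ι κ γ : Type} [Fintype κ] [Fintype γ] [DecidableEq κ] [DecidableEq γ]
  [Fintype ι] [DecidableEq ι]

lemma card_HD : (Nat.card {g : GL (κ ⊕ γ) F | g.1.toBlocks₁₂ = 0 ∧ g.1.toBlocks₂₁ = 0} : ℝ) =
    gl F (Fintype.card κ) * gl F (Fintype.card γ) := by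
  rw [← card_GL, ← card_GL, ← Nat.cast_mul, ← Nat.card_prod]
  congr 1
  symm
  have hu : ∀ p : GL κ F × GL γ F, IsUnit (fromBlocks p.1.1 0 0 p.2.1) :=
    fun p => isUnit_fromBlocks_zero₂₁.2 ⟨p.1.isUnit, p.2.isUnit⟩
  refine Nat.card_eq_of_bijective (fun p => ⟨(hu p).unit, ?_⟩) ⟨?_, ?_⟩
  · simp
  · rintro ⟨a, d⟩ ⟨a', d'⟩ h
    have := congrArg (fun g => (g.1 : GL (κ ⊕ γ) F).1) h
    simp only [IsUnit.unit_spec, fromBlocks_inj] at this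
    obtain ⟨h1, -, -, h3⟩ := this
    rw [Units.ext h1, Units.ext h3]
  · rintro ⟨g, hg, hg'⟩
    have h1 := fromBlocks_toBlocks g.1
    have h2 := g.isUnit
    rw [← h1, hg', isUnit_fromBlocks_zero₂₁] at h2
    refine ⟨(h2.1.unit, h2.2.unit), Subtype.ext (Units.ext ?_)⟩
    simp only [IsUnit.unit_spec]
    conv_rhs => rw [← h1, hg', hg]

/-- base change action -/
def actP {ι : Type} [Fintype ι] [DecidableEq ι] (g : GL ι F)
    (t : Matrix ι ι F × Matrix ι ι F) : Matrix ι ι F × Matrix ι ι F :=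
  ((g⁻¹).1ᵀ * t.1 * (g⁻¹).1, g.1 * t.2 * (g⁻¹).1)

def DiS (ε : F) (κ γ : Type) [Fintype κ] [Fintype γ] [DecidableEq κ] [DecidableEq γ] :
    Set (Matrix (κ ⊕ γ) (κ ⊕ γ) F × Matrix (κ ⊕ γ) (κ ⊕ γ) F) :=
  {t | ∃ p ∈ NilS ε κ, ∃ r ∈ UnS ε γ,
    t = (fromBlocks p.1 0 0 r.1, fromBlocks p.2 0 0 r.2)}

lemma card_DiS (ε : F) : Nat.card (DiS ε κ γ) = Nat.card (NilS ε κ) * Nat.card (UnS ε γ) := by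
  rw [← Nat.card_prod]
  symm
  refine Nat.card_eq_of_bijective (fun p => ⟨(fromBlocks p.1.1.1 0 0 p.2.1.1,
    fromBlocks p.1.1.2 0 0 p.2.1.2), p.1.1, p.1.2, p.2.1, p.2.2, rfl⟩) ⟨?_, ?_⟩
  · rintro ⟨⟨⟨a, b⟩, h1⟩, ⟨⟨c, d⟩, h2⟩⟩ ⟨⟨⟨a', b'⟩, h1'⟩, ⟨⟨c', d'⟩, h2'⟩⟩ h
    have h := Subtype.ext_iff.1 h
    obtain ⟨ha, hb⟩ := Prod.ext_iff.1 h
    dsimp only at ha hb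
    rw [fromBlocks_inj] at ha hb
    obtain ⟨rfl, -, -, rfl⟩ := ha
    obtain ⟨rfl, -, -, rfl⟩ := hb
    rfl
  · rintro ⟨t, p, hp, r, hr, rfl⟩
    exact ⟨(⟨p, hp⟩, ⟨r, hr⟩), rfl⟩

lemma DiS_sub {ε : F} {t} (h : t ∈ DiS ε κ γ) : t ∈ AllR ε (κ ⊕ γ) (Fintype.card γ) := by
  obtain ⟨⟨a, b⟩, ⟨p1, p2, p3, k, p4⟩, ⟨c, d⟩, ⟨r1, r2, r3, r4⟩, rfl⟩ := h
  dsimp only at *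
  refine ⟨⟨?_, ?_, ?_⟩, ?_⟩
  · dsimp only
    rw [fromBlocks_transpose, p1, r1, fromBlocks_smul]; simp
  · exact isUnit_fromBlocks_zero₂₁.2 ⟨p2, r2⟩
  · dsimp only
    rw [fromBlocks_transpose, fromBlocks_multiply, fromBlocks_multiply, fromBlocks_neg]
    simp [p3, r3]
  · dsimp only
    rw [← rank_stab _ (Fintype.card (κ ⊕ γ) + k) (by omega), fromBlocks_diagonal_pow,
      pow_add b, p4, Matrix.mul_zero, rank_diag _ (r4.pow _)]

lemma AllR_normal {ε : F} {t} (h : t ∈ AllR ε (κ ⊕ γ) (Fintype.card γ)) :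
    ∃ g : GL (κ ⊕ γ) F, actP g t ∈ DiS ε κ γ := by
  obtain ⟨ω, B⟩ := t
  obtain ⟨hA, hr⟩ := h
  dsimp only at hr
  obtain ⟨M, hM, hc⟩ : ∃ M, Fintype.card (κ ⊕ γ) ≤ M ∧
      IsCompl (LinearMap.ker (B ^ M).mulVecLin) (LinearMap.range (B ^ M).mulVecLin) := by
    have := (LinearMap.eventually_isCompl_ker_pow_range_pow (Matrix.toLin' B)).and
      (Filter.eventually_ge_atTop (Fintype.card (κ ⊕ γ)))
    obtain ⟨M, h1, h2⟩ := this.exists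
    refine ⟨M, h2, ?_⟩
    rw [← Matrix.toLin'_apply', Matrix.toLin'_pow]
    exact h1
  have hrk : Module.finrank F (LinearMap.range (B ^ M).mulVecLin) = Fintype.card γ := by
    rw [← hr, ← rank_stab _ M hM]; rfl
  have hk : Module.finrank F (LinearMap.ker (B ^ M).mulVecLin) = Fintype.card κ := by
    have := Submodule.finrank_add_eq_of_isCompl hc
    rw [Module.finrank_fintype_fun_eq_card, hrk, Fintype.card_sum] at this
    omega
  obtain ⟨P, P', e1, e2, hP, hP'⟩ := exists_frame hc hk hrk
  obtain ⟨l1, l2⟩ := frame_low hc e1 e2 hP hP'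
  have hBM : B * B ^ M = B ^ M * B := (Commute.refl B).pow_right M
  have b21 : (P' * B * P).toBlocks₂₁ = 0 := by
    ext i j
    have := l1 (B *ᵥ P *ᵥ Sum.elim (Pi.single j 1) 0) (by
      have h0 := hP (Pi.single j 1)
      rw [LinearMap.mem_ker, mulVecLin_apply] at h0 ⊢
      rw [mulVec_mulVec, ← hBM, ← mulVec_mulVec, h0, mulVec_zero]) i
    rw [mulVec_mulVec, mulVec_mulVec, Sum.elim_single_zero] at this
    simpa [Matrix.mul_assoc, toBlocks₁₂, toBlocks₂₁] using this
  have b12 : (P' * B * P).toBlocks₁₂ = 0 := by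
    ext i j
    have := l2 (B *ᵥ P *ᵥ Sum.elim 0 (Pi.single j 1)) (by
      obtain ⟨y, hy⟩ := hP' (Pi.single j 1)
      rw [mulVecLin_apply] at hy
      rw [← hy]
      refine ⟨B *ᵥ y, ?_⟩
      rw [mulVecLin_apply, mulVec_mulVec, mulVec_mulVec, hBM]) i
    rw [mulVec_mulVec, mulVec_mulVec, Sum.elim_zero_single] at this
    simpa [Matrix.mul_assoc, toBlocks₁₂, toBlocks₂₁] using this
  have hAll := AllS.tr hA e1 e2
  set B₁ := P' * B * P with hB₁
  have hBp := cj_pow (A := B) e1 e2 M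
  rw [← hB₁] at hBp
  set ω₁ := Pᵀ * ω * P with hω₁
  obtain ⟨hs, hu, hsk⟩ := hAll
  dsimp only at hs hu hsk
  have hBd : B₁ = fromBlocks B₁.toBlocks₁₁ 0 0 B₁.toBlocks₂₂ := by
    conv_lhs => rw [← fromBlocks_toBlocks B₁, b12, b21]
  rw [hBd, fromBlocks_diagonal_pow] at hBp
  set N := B₁.toBlocks₁₁ with hN
  set T := B₁.toBlocks₂₂ with hT
  have hNn : N ^ M = 0 := by
    ext i j
    have h0 := hP (Pi.single j 1)
    rw [LinearMap.mem_ker, mulVecLin_apply] at h0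
    have h1 := congrArg (fun z => (P' *ᵥ z) (.inl i)) h0
    simp only [mulVec_mulVec, Sum.elim_single_zero] at h1
    rw [← Matrix.mul_assoc, ← hBp] at h1
    simpa using h1
  have hTu : IsUnit T := by
    rcases Nat.eq_zero_or_pos M with h0 | h0
    · have : IsEmpty γ := by
        rw [← Fintype.card_eq_zero_iff]
        have := hM; rw [Fintype.card_sum] at this; omega
      exact isUnit_of_subsingleton _
    refine (isUnit_pow_iff h0.ne').1 ?_
    rw [isUnit_iff_inj]
    intro y hy
    have h1 : B ^ M *ᵥ P *ᵥ Sum.elim 0 y = 0 := by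
      have : P *ᵥ (fromBlocks (N ^ M) 0 0 (T ^ M)) *ᵥ Sum.elim 0 y = 0 := by
        rw [fromBlocks_mulVec]
        simp [hy]
      rw [hBp, mulVec_mulVec, ← Matrix.mul_assoc, ← Matrix.mul_assoc, e1, Matrix.one_mul,
        ← mulVec_mulVec] at this
      exact this
    have h2 := (Submodule.disjoint_def.1 hc.disjoint) _ (by
      rw [LinearMap.mem_ker, mulVecLin_apply]; exact h1) (hP' y)
    have h3 := congrArg (fun z => P' *ᵥ z) h2
    simp only [mulVec_mulVec, e2, one_mulVec, mulVec_zero] at h3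
    ext i
    exact congrFun h3 (.inr i)
  have w12 : ω₁.toBlocks₁₂ = 0 ∧ ω₁.toBlocks₂₁ = 0 ∧ Nᵀ * ω₁.toBlocks₁₁ = -(ω₁.toBlocks₁₁ * N)
      ∧ Tᵀ * ω₁.toBlocks₂₂ = -(ω₁.toBlocks₂₂ * T) := by
    rw [hBd, ← fromBlocks_toBlocks ω₁, fromBlocks_transpose, fromBlocks_multiply,
      fromBlocks_multiply, fromBlocks_neg, fromBlocks_inj] at hsk
    simp only [transpose_zero, Matrix.zero_mul, Matrix.mul_zero, zero_add, add_zero] at hsk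
    obtain ⟨s1, s2, s3, s4⟩ := hsk
    refine ⟨?_, ?_, s1, s4⟩
    · refine intertw (nilp_tr ⟨M, hNn⟩) hTu.neg _ ?_
      rw [s2, Matrix.mul_neg]
    · refine intertw' (N := -N) (T := Tᵀ) ?_ (unit_tr hTu) _ ?_
      · exact IsNilpotent.neg ⟨M, hNn⟩
      · rw [s3, Matrix.mul_neg]
  obtain ⟨w12, w21, s1, s2⟩ := w12
  have hωd : ω₁ = fromBlocks ω₁.toBlocks₁₁ 0 0 ω₁.toBlocks₂₂ := by
    conv_lhs => rw [← fromBlocks_toBlocks ω₁, w12, w21]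
  have hu' := hu
  rw [hωd, isUnit_fromBlocks_zero₂₁] at hu'
  refine ⟨⟨P', P, e2, e1⟩, (ω₁.toBlocks₁₁, N), ⟨?_, hu'.1, s1, ⟨M, hNn⟩⟩, (ω₁.toBlocks₂₂, T),
    ⟨?_, hu'.2, s2, hTu⟩, Prod.ext hωd hBd⟩
  · ext i j; exact congrFun (congrFun hs (.inl i)) (.inl j)
  · ext i j; exact congrFun (congrFun hs (.inr i)) (.inr j)

lemma fit_group (ε : F) : (Nat.card (AllR ε (κ ⊕ γ) (Fintype.card γ)) : ℝ) *
    (gl F (Fintype.card κ) * gl F (Fintype.card γ)) =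
    gl F (Fintype.card κ + Fintype.card γ) * (Nat.card (NilS ε κ) * Nat.card (UnS ε γ)) := by
  rw [← card_HD, ← Fintype.card_sum, ← card_GL, ← Nat.cast_mul, ← Nat.cast_mul (α := ℝ) (m := Nat.card (NilS ε κ)),
    ← Nat.cast_mul, ← card_DiS]
  congr 1
  apply group_count actP
  · intro t; simp [actP]
  · intro g h t; simp [actP, Matrix.mul_assoc, transpose_mul]
  · rintro g t ⟨h1, h2⟩
    have e1 : (g⁻¹).1 * g.1 = 1 := by rw [← Units.val_mul]; simp
    have e2 : g.1 * (g⁻¹).1 = 1 := by rw [← Units.val_mul]; simp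
    exact ⟨AllS.tr h1 e1 e2, by rw [actP, cj_pow e1 e2, cj_rank e1]; exact h2⟩
  · intro t ht; exact DiS_sub ht
  · intro t ht; exact AllR_normal ht
  · intro y hy g
    have e1 : (g⁻¹).1 * g.1 = 1 := by rw [← Units.val_mul]; simp
    have e2 : g.1 * (g⁻¹).1 = 1 := by rw [← Units.val_mul]; simp
    obtain ⟨⟨a, b⟩, hp, ⟨c, d⟩, hr, rfl⟩ := hy
    constructor
    · rintro ⟨⟨a', b'⟩, hp', ⟨c', d'⟩, hr', h⟩
      have h := (Prod.ext_iff.1 h).2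
      dsimp only [actP] at h
      have h3 : g.1 * fromBlocks b 0 0 d = fromBlocks b' 0 0 d' * g.1 := by
        rw [← h, Matrix.mul_assoc, e1, Matrix.mul_one]
      rw [← fromBlocks_toBlocks g.1, fromBlocks_multiply, fromBlocks_multiply, fromBlocks_inj] at h3
      simp only [Matrix.zero_mul, Matrix.mul_zero, zero_add, add_zero] at h3
      obtain ⟨-, h4, h5, -⟩ := h3
      exact ⟨intertw hp'.2.2.2 hr.2.2.2 _ h4, intertw' hp.2.2.2 hr'.2.2.2 _ h5.symm⟩
    · rintro ⟨h1, h2⟩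
      have h3 := fromBlocks_toBlocks g.1
      rw [h1, h2] at h3
      have hu := g.isUnit
      rw [← h3, isUnit_fromBlocks_zero₂₁] at hu
      obtain ⟨x, hx⟩ := hu.1
      obtain ⟨z, hz⟩ := hu.2
      rw [← hx, ← hz] at h3
      have ex1 : (x⁻¹).1 * x.1 = 1 := by rw [← Units.val_mul]; simp
      have ex2 : x.1 * (x⁻¹).1 = 1 := by rw [← Units.val_mul]; simp
      have ez1 : (z⁻¹).1 * z.1 = 1 := by rw [← Units.val_mul]; simp
      have ez2 : z.1 * (z⁻¹).1 = 1 := by rw [← Units.val_mul]; simp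
      have hgi : (g⁻¹).1 = fromBlocks (x⁻¹).1 0 0 (z⁻¹).1 := by
        have h4 : g.1 * (fromBlocks (x⁻¹).1 0 0 (z⁻¹).1 : Matrix (κ ⊕ γ) (κ ⊕ γ) F) = 1 := by
          rw [← h3, fromBlocks_multiply, ex2, ez2]; simp
        calc (g⁻¹).1 = (g⁻¹).1 * (g.1 * (fromBlocks (x⁻¹).1 0 0 (z⁻¹).1 : Matrix (κ ⊕ γ) (κ ⊕ γ) F)) := by
              rw [h4, Matrix.mul_one]
          _ = _ := by rw [← Matrix.mul_assoc, e1, Matrix.one_mul]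
      refine ⟨((x⁻¹).1ᵀ * a * (x⁻¹).1, x.1 * b * (x⁻¹).1), ⟨tr_sym _ hp.1, tr_unit ex1 ex2 hp.2.1,
        tr_skew ex1 hp.2.2.1, cj_nilp ex1 ex2 hp.2.2.2⟩,
        ((z⁻¹).1ᵀ * c * (z⁻¹).1, z.1 * d * (z⁻¹).1), ⟨tr_sym _ hr.1, tr_unit ez1 ez2 hr.2.1,
        tr_skew ez1 hr.2.2.1, (z.isUnit.mul hr.2.2.2).mul (z⁻¹).isUnit⟩, ?_⟩
      rw [actP, hgi, ← h3]
      simp [fromBlocks_multiply, fromBlocks_transpose]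

/-- Fitting recursion -/
lemma fit_rec {ε : F} (hε : ε * ε = 1) (m : ℕ) :
    (Nat.card (SS ε (Fin m)) : ℝ) * Nat.card (FrmS (-ε) (Fin m)) / gl F m =
    ∑ l ∈ Finset.range (m + 1), fN ε (m - l) *
      ((Nat.card (SS ε (Fin l)) : ℝ) * Nat.card (SS (-ε) (Fin l)) / gl F l) := by
  have h1 : (Nat.card (AllS ε (Fin m)) : ℝ) =
      ∑ l ∈ Finset.range (m + 1), (Nat.card (AllR ε (Fin m) l) : ℝ) := by
    rw [← Nat.cast_sum]
    congr 1
    classical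
    have := Finset.card_eq_sum_card_fiberwise (s := (AllS ε (Fin m)).toFinset)
      (t := Finset.range (m + 1)) (f := fun t => (t.2 ^ (Fintype.card (Fin m))).rank) (by
        intro t _
        have := rank_le_card_height (t.2 ^ (Fintype.card (Fin m)))
        simp at this ⊢; omega)
    rw [Nat.card_eq_fintype_card, ← Set.toFinset_card, this]
    refine Finset.sum_congr rfl fun l _ => ?_
    rw [Nat.card_eq_fintype_card, ← Set.toFinset_card]
    congr 1
    ext t
    rw [Set.mem_toFinset, Finset.mem_filter, Set.mem_toFinset]; rfl
  rw [← Nat.cast_mul, ← card_AllS hε, h1, Finset.sum_div]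
  refine Finset.sum_congr rfl fun l hl => ?_
  have hl : l ≤ m := by simpa [Nat.lt_succ_iff] using hl
  have h2 := fit_group (F := F) (κ := Fin (m - l)) (γ := Fin l) ε
  simp only [Fintype.card_fin] at h2
  rw [card_UnS hε, ← card_AllR (ι := Fin m) ε l (by simp; omega), Nat.sub_add_cancel hl] at h2
  have g1 := gl_pos (F := F) (m - l)
  have g2 := gl_pos (F := F) l
  have g3 := gl_pos (F := F) m
  rw [fN]
  push_cast at h2
  field_simp
  linarith

end Fit2
end FF

namespace FF
section Cnt
variable {F : Type} [Field F] [Fintype F]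
variable {ι κ γ : Type} [Fintype κ] [Fintype γ] [DecidableEq κ] [DecidableEq γ]
  [Fintype ι] [DecidableEq ι]

lemma card_FrmS_sum {ε : F} (hε : ε * ε = 1) : (Nat.card (FrmS ε (κ ⊕ γ)) : ℝ) =
    Nat.card (FrmS ε κ) * (Fintype.card F : ℝ) ^ (Fintype.card κ * Fintype.card γ) *
      Nat.card (FrmS ε γ) := by
  rw [← card_mat κ γ, ← Nat.cast_mul, ← Nat.cast_mul, ← Nat.card_prod, ← Nat.card_prod]
  congr 1
  symm
  refine Nat.card_eq_of_bijective (fun p => ⟨fromBlocks p.1.1.1 p.1.2 (ε • p.1.2ᵀ) p.2.1,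
    (mem_frm_block hε _).2 ⟨_, _, _, rfl, p.1.1.2, p.2.2⟩⟩) ⟨?_, ?_⟩
  · rintro ⟨⟨⟨a, ha⟩, b⟩, ⟨c, hc⟩⟩ ⟨⟨⟨a', ha'⟩, b'⟩, ⟨c', hc'⟩⟩ h
    have h := Subtype.ext_iff.1 h
    dsimp only at h
    rw [fromBlocks_inj] at h
    obtain ⟨rfl, rfl, -, rfl⟩ := h
    rfl
  · rintro ⟨M, hM⟩
    obtain ⟨a, b, c, rfl, ha, hc⟩ := (mem_frm_block hε M).1 hM
    exact ⟨((⟨a, ha⟩, b), ⟨c, hc⟩), rfl⟩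

lemma card_FrmS (ε : F) (h : Fintype.card ι = Fintype.card κ) :
    Nat.card (FrmS ε ι) = Nat.card (FrmS ε κ) := by
  obtain ⟨P, P', h1, h2⟩ := exists_perm (F := F) h
  refine Nat.card_congr (Equiv.mk
    (fun t => ⟨Pᵀ * t.1 * P, tr_sym _ t.2⟩)
    (fun t => ⟨P'ᵀ * t.1 * P', tr_sym _ t.2⟩) ?_ ?_)
  · rintro ⟨ω, ht⟩
    simp [tr_inv h1]
  · rintro ⟨ω, ht⟩
    simp [tr_inv h2]

lemma one_tr (a : Matrix (Fin 1) (Fin 1) F) : aᵀ = a := by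
  ext i j; rw [transpose_apply, Subsingleton.elim i j]

lemma card_FrmS_one_pos : (Nat.card (FrmS (1 : F) (Fin 1)) : ℝ) = Fintype.card F := by
  have : FrmS (1 : F) (Fin 1) = Set.univ := by
    ext a; simp [FrmS, one_tr]
  rw [this, Nat.card_univ, card_mat]; simp

lemma skew_one (h2 : (2 : F) ≠ 0) {a : Matrix (Fin 1) (Fin 1) F} (h : aᵀ = (-1 : F) • a) : a = 0 := by
  rw [one_tr] at h
  ext i j
  have := congrFun (congrFun h i) j
  simp only [Matrix.smul_apply, smul_eq_mul] at this
  have h3 : 2 * a i j = 0 := by linear_combination this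
  simpa [h2] using h3

lemma card_FrmS_one_neg (h2 : (2 : F) ≠ 0) : (Nat.card (FrmS (-1 : F) (Fin 1)) : ℝ) = 1 := by
  have : FrmS (-1 : F) (Fin 1) = {0} := by
    ext a
    constructor
    · intro h; exact skew_one h2 h
    · rintro rfl; simp [FrmS]
  rw [this]; simp

lemma card_SS_one_pos : (Nat.card (SS (1 : F) (Fin 1)) : ℝ) = Fintype.card F - 1 := by
  have e : SS (1 : F) (Fin 1) = {t | IsUnit t} := by
    ext a; simp [SS, one_tr]
  have : Nat.card {t : Matrix (Fin 1) (Fin 1) F | IsUnit t} = Nat.card (GL (Fin 1) F) :=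
    Nat.card_congr (Equiv.mk (fun t => t.2.unit) (fun g => ⟨g.1, g.isUnit⟩) (fun t => rfl)
      (fun g => Units.ext rfl))
  rw [e, this, card_GL]; simp [gl]

lemma card_SS_one_neg (h2 : (2 : F) ≠ 0) : (Nat.card (SS (-1 : F) (Fin 1)) : ℝ) = 0 := by
  have : SS (-1 : F) (Fin 1) = ∅ := by
    ext a
    simp only [Set.mem_empty_iff_false, iff_false]
    rintro ⟨h, hu⟩
    rw [skew_one h2 h] at hu
    exact not_isUnit_zero hu
  rw [this]; simp

lemma card_SS_zero (ε : F) : (Nat.card (SS ε (Fin 0)) : ℝ) = 1 := by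
  have : SS ε (Fin 0) = Set.univ := by
    ext a
    simp only [Set.mem_univ, iff_true]
    exact ⟨Subsingleton.elim _ _, isUnit_of_subsingleton _⟩
  rw [this, Nat.card_univ, card_mat]; simp

lemma card_FrmS_zero (ε : F) : (Nat.card (FrmS ε (Fin 0)) : ℝ) = 1 := by
  have : FrmS ε (Fin 0) = Set.univ := by
    ext a
    simp only [Set.mem_univ, iff_true]
    exact Subsingleton.elim (α := Matrix (Fin 0) (Fin 0) F) _ _
  rw [this, Nat.card_univ, card_mat]; simp

lemma schur_unit {ε : F} (a : Matrix κ κ F) (ha : IsUnit a) (b : Matrix κ γ F)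
    (c : Matrix γ γ F) : IsUnit (fromBlocks a b (ε • bᵀ) c) ↔ IsUnit (c - ε • (bᵀ * a⁻¹ * b)) := by
  letI := ha.invertible
  rw [isUnit_fromBlocks_iff_of_invertible₁₁, invOf_eq_nonsing_inv]
  simp

lemma schur_sym {ε : F} (hε : ε * ε = 1) (a : Matrix κ κ F) (ha : IsUnit a) (hs : aᵀ = ε • a)
    (b : Matrix κ γ F) : (ε • (bᵀ * a⁻¹ * b))ᵀ = ε • (ε • (bᵀ * a⁻¹ * b)) := by
  have : (a⁻¹)ᵀ = ε • a⁻¹ := by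
    rw [transpose_nonsing_inv, hs]
    have hd := (isUnit_iff_isUnit_det a).1 ha
    apply inv_eq_right_inv
    rw [Matrix.smul_mul, Matrix.mul_smul, smul_smul, hε, one_smul, mul_nonsing_inv _ hd]
  simp [transpose_mul, this, Matrix.mul_assoc]

lemma card_SA {ε : F} (hε : ε * ε = 1) :
    (Nat.card {t : Matrix (κ ⊕ γ) (κ ⊕ γ) F | t ∈ SS ε (κ ⊕ γ) ∧ IsUnit t.toBlocks₁₁} : ℝ) =
    Nat.card (SS ε κ) * (Fintype.card F : ℝ) ^ (Fintype.card κ * Fintype.card γ) *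
      Nat.card (SS ε γ) := by
  rw [← card_mat κ γ, ← Nat.cast_mul, ← Nat.cast_mul, ← Nat.card_prod, ← Nat.card_prod]
  congr 1
  symm
  refine Nat.card_eq_of_bijective (fun p => ⟨fromBlocks p.1.1.1 p.1.2 (ε • p.1.2ᵀ)
    (p.2.1 + ε • (p.1.2ᵀ * (p.1.1.1)⁻¹ * p.1.2)), ⟨?_, ?_⟩, ?_⟩) ⟨?_, ?_⟩
  · refine (mem_frm_block hε _).2 ⟨_, _, _, rfl, p.1.1.2.1, ?_⟩
    rw [transpose_add, schur_sym hε _ p.1.1.2.2 p.1.1.2.1, p.2.2.1, smul_add]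
  · rw [schur_unit _ p.1.1.2.2]
    simpa using p.2.2.2
  · simpa using p.1.1.2.2
  · rintro ⟨⟨⟨a, ha⟩, b⟩, ⟨c, hc⟩⟩ ⟨⟨⟨a', ha'⟩, b'⟩, ⟨c', hc'⟩⟩ h
    have h := Subtype.ext_iff.1 h
    dsimp only at h
    rw [fromBlocks_inj] at h
    obtain ⟨rfl, rfl, -, h⟩ := h
    have := add_right_cancel h
    subst this
    rfl
  · rintro ⟨M, ⟨hM, hu⟩, hMa⟩
    obtain ⟨a, b, c, rfl, ha, hc⟩ := (mem_frm_block hε M).1 hM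
    have hua : IsUnit a := by simpa using hMa
    rw [schur_unit _ hua] at hu
    refine ⟨((⟨a, ha, hua⟩, b), ⟨c - ε • (bᵀ * a⁻¹ * b), ?_, hu⟩), ?_⟩
    · rw [transpose_sub, schur_sym hε a hua ha, hc, smul_sub]
    · apply Subtype.ext
      dsimp only
      rw [sub_add_cancel]

/-- lower right blocks making the bordered form nondegenerate -/
def ZS (ε : F) (η : Matrix ι γ F) : Set (Matrix γ γ F) :=
  {c | cᵀ = ε • c ∧ IsUnit (fromBlocks 0 η (ε • ηᵀ) c)}

lemma ZS_tr {ε : F} (η : Matrix ι γ F) {Q : Matrix γ κ F} {Q' : Matrix κ γ F} (h1 : Q * Q' = 1)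
    (h2 : Q' * Q = 1) {c} (hc : c ∈ ZS ε η) : Qᵀ * c * Q ∈ ZS ε (η * Q) := by
  refine ⟨tr_sym _ hc.1, ?_⟩
  obtain ⟨G, hG⟩ : ∃ G : Matrix (ι ⊕ γ) (ι ⊕ κ) F, G = fromBlocks 1 0 0 Q := ⟨_, rfl⟩
  obtain ⟨G', hG'⟩ : ∃ G : Matrix (ι ⊕ κ) (ι ⊕ γ) F, G = fromBlocks 1 0 0 Q' := ⟨_, rfl⟩
  have e1 : G * G' = 1 := by rw [hG, hG', fromBlocks_multiply, h1]; simp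
  have e2 : G' * G = 1 := by rw [hG, hG', fromBlocks_multiply, h2]; simp
  have := tr_unit e1 e2 hc.2
  rw [hG, fromBlocks_transpose, fromBlocks_multiply, fromBlocks_multiply] at this
  simpa [transpose_mul] using this

lemma card_ZS_tr {ε : F} (η : Matrix ι γ F) {Q : Matrix γ κ F} {Q' : Matrix κ γ F} (h1 : Q * Q' = 1)
    (h2 : Q' * Q = 1) : Nat.card (ZS ε η) = Nat.card (ZS ε (η * Q)) := by
  refine Nat.card_congr (Equiv.mk (fun c => ⟨Qᵀ * c.1 * Q, ZS_tr η h1 h2 c.2⟩)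
    (fun c => ⟨Q'ᵀ * c.1 * Q', ?_⟩) ?_ ?_)
  · have := ZS_tr _ h2 h1 c.2
    rwa [Matrix.mul_assoc, h1, Matrix.mul_one] at this
  · rintro ⟨c, hc⟩; simp [tr_inv h1]
  · rintro ⟨c, hc⟩; simp [tr_inv h2]

lemma ZS_unit {ε : F} (hε : ε * ε = 1) (σ : Matrix γ γ F) (e : Matrix γ κ F) (c : Matrix κ κ F) :
    IsUnit (fromBlocks (0 : Matrix κ κ F) (fromCols 0 1 : Matrix κ (γ ⊕ κ) F)
      (ε • (fromCols 0 1 : Matrix κ (γ ⊕ κ) F)ᵀ) (fromBlocks σ e (ε • eᵀ) c)) ↔ IsUnit σ := by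
  have hε0 : ε ≠ 0 := by rintro rfl; simp at hε
  have key : ∀ (x1 : κ → F) (x3 : γ → F) (x4 : κ → F),
      (fromBlocks (0 : Matrix κ κ F) (fromCols 0 1 : Matrix κ (γ ⊕ κ) F)
      (ε • (fromCols 0 1 : Matrix κ (γ ⊕ κ) F)ᵀ) (fromBlocks σ e (ε • eᵀ) c)) *ᵥ
        (Sum.elim x1 (Sum.elim x3 x4)) =
      Sum.elim x4 (Sum.elim (σ *ᵥ x3 + e *ᵥ x4) (ε • x1 + (ε • eᵀ) *ᵥ x3 + c *ᵥ x4)) := by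
    intro x1 x3 x4
    rw [fromBlocks_mulVec, transpose_fromCols]
    ext (i | i | i) <;> simp [smul_mulVec, add_assoc, Sum.elim_comp_inl, Sum.elim_comp_inr,
      fromBlocks_mulVec, fromRows_mulVec, fromCols_mulVec]
  rw [isUnit_iff_inj, isUnit_iff_inj]
  constructor
  · intro h x hx
    have := h (Sum.elim (-(eᵀ *ᵥ x)) (Sum.elim x 0)) (by
      rw [key]
      ext (i | i | i) <;> simp [hx, smul_mulVec])
    ext i
    exact congrFun this (Sum.inr (Sum.inl i))
  · intro h x hx
    obtain ⟨x1, x3, x4, rfl⟩ : ∃ x1 x3 x4,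
        x = Sum.elim x1 (Sum.elim x3 x4) :=
      ⟨fun i => x (.inl i), fun i => x (.inr (.inl i)),
        fun i => x (.inr (.inr i)), by ext (i | i | i) <;> rfl⟩
    rw [key] at hx
    have h4 : x4 = 0 := by ext i; exact congrFun hx (.inl i)
    have h3 : σ *ᵥ x3 + e *ᵥ x4 = 0 := by ext i; exact congrFun hx (.inr (.inl i))
    have h1 : ε • x1 + (ε • eᵀ) *ᵥ x3 + c *ᵥ x4 = 0 := by ext i; exact congrFun hx (.inr (.inr i))
    subst h4
    have h3' := h _ (by simpa using h3)
    subst h3'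
    have h1' : x1 = 0 := by simpa [hε0] using h1
    subst h1'
    ext (i | i | i) <;> rfl

lemma card_ZS_std {ε : F} (hε : ε * ε = 1) :
    (Nat.card (ZS ε (fromCols 0 1 : Matrix κ (γ ⊕ κ) F)) : ℝ) =
    Nat.card (SS ε γ) * (Fintype.card F : ℝ) ^ (Fintype.card γ * Fintype.card κ) *
      Nat.card (FrmS ε κ) := by
  rw [← card_mat γ κ, ← Nat.cast_mul, ← Nat.cast_mul, ← Nat.card_prod, ← Nat.card_prod]
  congr 1
  symm
  refine Nat.card_eq_of_bijective (fun p => ⟨fromBlocks p.1.1.1 p.1.2 (ε • p.1.2ᵀ) p.2.1, ?_, ?_⟩) ⟨?_, ?_⟩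
  · exact (mem_frm_block hε _).2 ⟨_, _, _, rfl, p.1.1.2.1, p.2.2⟩
  · rw [ZS_unit hε]; exact p.1.1.2.2
  · rintro ⟨⟨⟨a, ha⟩, b⟩, ⟨c, hc⟩⟩ ⟨⟨⟨a', ha'⟩, b'⟩, ⟨c', hc'⟩⟩ h
    have h := Subtype.ext_iff.1 h
    dsimp only at h
    rw [fromBlocks_inj] at h
    obtain ⟨rfl, rfl, -, rfl⟩ := h
    rfl
  · rintro ⟨M, hM, hu⟩
    obtain ⟨a, b, c, rfl, ha, hc⟩ := (mem_frm_block hε M).1 hM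
    rw [ZS_unit hε] at hu
    exact ⟨((⟨a, ha, hu⟩, b), ⟨c, hc⟩), rfl⟩

lemma ZS_ne {ε : F} {η : Matrix (Fin 1) γ F} {c} (h : c ∈ ZS ε η) : η ≠ 0 := by
  rintro rfl
  have := h.2
  rw [isUnit_iff_inj] at this
  have h1 := this (Sum.elim (fun _ => 1) 0) (by rw [fromBlocks_mulVec]; ext (i | i) <;> simp)
  exact one_ne_zero (congrFun h1 (.inl 0))

lemma row_indep {η : Matrix (Fin 1) γ F} (h : η ≠ 0) : LinearIndependent F η.row := by
  rw [linearIndependent_unique_iff]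
  intro h0
  apply h
  ext i j
  rw [Subsingleton.elim i default]
  exact congrFun h0 j

lemma SB_count {ε : F} (hε : ε * ε = 1) (m : ℕ) (hc : Fintype.card γ = m + 1) :
    (Nat.card {t : Matrix (Fin 1 ⊕ γ) (Fin 1 ⊕ γ) F | t ∈ SS ε (Fin 1 ⊕ γ) ∧ t.toBlocks₁₁ = 0} : ℝ) =
    ((Fintype.card F : ℝ) ^ (m + 1) - 1) * (Nat.card (SS ε (Fin m)) * (Fintype.card F : ℝ) ^ m *
      Nat.card (FrmS ε (Fin 1))) := by
  have h1 : Nat.card {t : Matrix (Fin 1 ⊕ γ) (Fin 1 ⊕ γ) F | t ∈ SS ε (Fin 1 ⊕ γ) ∧ t.toBlocks₁₁ = 0}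
      = ∑ η : Matrix (Fin 1) γ F, Nat.card (ZS ε η) := by
    rw [← Nat.card_sigma]
    symm
    refine Nat.card_eq_of_bijective (fun p => ⟨fromBlocks 0 p.1 (ε • p.1ᵀ) p.2.1, ⟨?_, p.2.2.2⟩, ?_⟩)
      ⟨?_, ?_⟩
    · exact (mem_frm_block hε _).2 ⟨_, _, _, rfl, by simp, p.2.2.1⟩
    · simp
    · rintro ⟨b, ⟨c, hc⟩⟩ ⟨b', ⟨c', hc'⟩⟩ h
      have h := Subtype.ext_iff.1 h
      dsimp only at h
      rw [fromBlocks_inj] at h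
      obtain ⟨-, rfl, -, rfl⟩ := h
      rfl
    · rintro ⟨M, ⟨hM, hu⟩, hMa⟩
      obtain ⟨a, b, c, rfl, ha, hc⟩ := (mem_frm_block hε M).1 hM
      have : a = 0 := by simpa using hMa
      subst this
      exact ⟨⟨b, ⟨c, hc, hu⟩⟩, rfl⟩
  classical
  have h2 : ∀ η : Matrix (Fin 1) γ F, (Nat.card (ZS ε η) : ℝ) = if η = 0 then 0 else
      (Nat.card (SS ε (Fin m)) * (Fintype.card F : ℝ) ^ m * Nat.card (FrmS ε (Fin 1))) := by
    intro η
    split_ifs with h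
    · have : IsEmpty (ZS ε η) := ⟨fun c => ZS_ne c.2 h⟩
      simp
    · obtain ⟨Q, Q', e1, e2, e3⟩ := right_normal η (row_indep h) (m := m) (by omega)
      rw [card_ZS_tr η e1 e2, e3, card_ZS_std hε]
      simp
  rw [h1]
  push_cast
  simp_rw [h2]
  rw [Finset.sum_ite, Finset.sum_const_zero, zero_add, Finset.sum_const, nsmul_eq_mul]
  congr 1
  have := card_mat (F := F) (Fin 1) γ
  rw [Nat.card_eq_fintype_card, hc, ← Finset.card_univ] at this
  have h3 := Finset.card_erase_of_mem (Finset.mem_univ (0 : Matrix (Fin 1) γ F))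
  have h4 : (Finset.univ.filter fun x : Matrix (Fin 1) γ F => ¬ x = 0) = Finset.univ.erase 0 := by
    ext; simp
  rw [h4, h3, Nat.cast_sub (Finset.card_pos.2 ⟨0, Finset.mem_univ _⟩), this]
  simp

noncomputable def sC (ε : F) (m : ℕ) : ℝ := Nat.card (SS ε (Fin m))

lemma sC_rec {ε : F} (hε : ε * ε = 1) (m : ℕ) :
    sC ε (m + 2) = sC ε 1 * (Fintype.card F : ℝ) ^ (m + 1) * sC ε (m + 1) +
      ((Fintype.card F : ℝ) ^ (m + 1) - 1) * (sC ε m * (Fintype.card F : ℝ) ^ m *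
        Nat.card (FrmS ε (Fin 1))) := by
  have hA := card_SA (F := F) (κ := Fin 1) (γ := Fin (m + 1)) hε
  have hB := SB_count (F := F) (γ := Fin (m + 1)) hε m (by simp)
  simp only [Fintype.card_fin, one_mul] at hA
  rw [sC, sC, sC, sC, ← hA, ← hB, card_SS (κ := Fin 1 ⊕ Fin (m + 1)) ε (by simp; omega), ← Nat.cast_add]
  congr 1
  rw [← Nat.card_sum]
  refine (Nat.card_eq_of_bijective (Sum.elim (fun t => ⟨t.1, t.2.1⟩) (fun t => ⟨t.1, t.2.1⟩)) ⟨?_, ?_⟩).symm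
  · rintro (⟨a, ha, ha'⟩ | ⟨a, ha, ha'⟩) (⟨b, hb, hb'⟩ | ⟨b, hb, hb'⟩) h <;>
      have h := Subtype.ext_iff.1 h <;> simp only [Sum.elim_inl, Sum.elim_inr] at h <;> subst h
    · rfl
    · rw [hb'] at ha'; exact absurd ha' not_isUnit_zero
    · rw [ha'] at hb'; exact absurd hb' not_isUnit_zero
    · rfl
  · rintro ⟨t, ht⟩
    by_cases h : t.toBlocks₁₁ = 0
    · exact ⟨.inr ⟨t, ht, h⟩, rfl⟩
    · refine ⟨.inl ⟨t, ht, ?_⟩, rfl⟩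
      rw [isUnit_iff_isUnit_det, det_fin_one, isUnit_iff_ne_zero]
      intro h0
      apply h
      ext i j
      rw [Subsingleton.elim i 0, Subsingleton.elim j 0, h0]; rfl

lemma frm_pos (m : ℕ) : (Nat.card (FrmS (1 : F) (Fin (m + 1))) : ℝ) =
    (Fintype.card F : ℝ) ^ (m + 1) * Nat.card (FrmS (1 : F) (Fin m)) := by
  rw [card_FrmS (κ := Fin 1 ⊕ Fin m) 1 (by simp; omega), card_FrmS_sum (by norm_num), card_FrmS_one_pos]
  simp only [Fintype.card_fin]; ring

lemma frm_neg (h2 : (2 : F) ≠ 0) (m : ℕ) : (Nat.card (FrmS (-1 : F) (Fin (m + 1))) : ℝ) =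
    (Fintype.card F : ℝ) ^ m * Nat.card (FrmS (-1 : F) (Fin m)) := by
  rw [card_FrmS (κ := Fin 1 ⊕ Fin m) (-1) (by simp; omega), card_FrmS_sum (by norm_num),
    card_FrmS_one_neg h2]
  simp only [Fintype.card_fin]; ring

lemma sC_zero (ε : F) : sC ε 0 = 1 := card_SS_zero ε
lemma sC_one_pos : sC (1 : F) 1 = Fintype.card F - 1 := card_SS_one_pos
lemma sC_one_neg (h2 : (2 : F) ≠ 0) : sC (-1 : F) 1 = 0 := card_SS_one_neg h2

lemma sC_neg_rec (h2 : (2 : F) ≠ 0) (m : ℕ) : sC (-1 : F) (m + 2) =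
    ((Fintype.card F : ℝ) ^ (m + 1) - 1) * (Fintype.card F : ℝ) ^ m * sC (-1 : F) m := by
  rw [sC_rec (by norm_num), sC_one_neg h2, card_FrmS_one_neg h2]; ring

lemma sC_pos_rec (m : ℕ) : sC (1 : F) (m + 2) =
    (Fintype.card F - 1) * (Fintype.card F : ℝ) ^ (m + 1) * sC (1 : F) (m + 1) +
    ((Fintype.card F : ℝ) ^ (m + 1) - 1) * (Fintype.card F : ℝ) ^ (m + 1) * sC (1 : F) m := by
  rw [sC_rec (by norm_num), sC_one_pos, card_FrmS_one_pos]; ring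

lemma sC_neg_odd (h2 : (2 : F) ≠ 0) (k : ℕ) : sC (-1 : F) (2 * k + 1) = 0 := by
  induction k with
  | zero => exact sC_one_neg h2
  | succ k ih => rw [show 2 * (k + 1) + 1 = 2 * k + 1 + 2 by ring, sC_neg_rec h2, ih, mul_zero]

/-- closed recursion for the symmetric count -/
lemma sC_pos_pair (k : ℕ) : sC (1 : F) (2 * k + 1) =
      ((Fintype.card F : ℝ) ^ (2 * k + 1) - 1) * sC (1 : F) (2 * k) ∧
    sC (1 : F) (2 * k + 2) = (Fintype.card F : ℝ) ^ (2 * k + 2) * sC (1 : F) (2 * k + 1) := by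
  have step : ∀ k, sC (1 : F) (2 * k + 1) =
      ((Fintype.card F : ℝ) ^ (2 * k + 1) - 1) * sC (1 : F) (2 * k) →
      sC (1 : F) (2 * k + 2) = (Fintype.card F : ℝ) ^ (2 * k + 2) * sC (1 : F) (2 * k + 1) := by
    intro k h
    rw [sC_pos_rec, h]; ring
  induction k with
  | zero =>
    have : sC (1 : F) (2 * 0 + 1) = ((Fintype.card F : ℝ) ^ (2 * 0 + 1) - 1) * sC (1 : F) (2 * 0) := by
      simp [sC_zero, sC_one_pos]
    exact ⟨this, step 0 this⟩
  | succ k ih =>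
    have : sC (1 : F) (2 * (k + 1) + 1) =
        ((Fintype.card F : ℝ) ^ (2 * (k + 1) + 1) - 1) * sC (1 : F) (2 * (k + 1)) := by
      rw [show 2 * (k + 1) + 1 = 2 * k + 1 + 2 by ring, sC_pos_rec,
        show 2 * k + 1 + 1 = 2 * k + 2 by ring, show 2 * (k + 1) = 2 * k + 2 by ring, ih.2]; ring
    exact ⟨this, step _ this⟩

end Cnt
end FF

namespace FF
section qs

/-- `(p;p)_k` -/
noncomputable def qp (p : ℝ) (k : ℕ) : ℝ := ∏ i ∈ Finset.range k, (1 - p ^ (i + 1))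

lemma qp_pos {p : ℝ} (h0 : 0 ≤ p) (h1 : p < 1) (k : ℕ) : 0 < qp p k := by
  apply Finset.prod_pos
  intro i _
  have := pow_lt_one₀ h0 h1 (Nat.succ_ne_zero i)
  simpa using this

lemma qp_succ (p : ℝ) (k : ℕ) : qp p (k + 1) = qp p k * (1 - p ^ (k + 1)) := by
  rw [qp, Finset.prod_range_succ, qp]

lemma qdiff {p : ℝ} (h0 : 0 ≤ p) (h1 : p < 1) (a : ℝ) (φ G : ℕ → ℝ) (hφ0 : φ 0 = 1) (hG0 : G 0 = 1)
    (hφ : ∀ k, φ (k + 1) * (1 - p ^ (k + 1)) = a * φ k)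
    (hG : ∀ k, G (k + 1) * (1 - p ^ (k + 1)) = G k * (1 - a * p ^ k)) :
    PowerSeries.mk φ * PowerSeries.mk G = PowerSeries.mk (fun k => 1 / qp p k) := by
  have e1 : PowerSeries.mk φ * (1 - PowerSeries.C a * PowerSeries.X) =
      PowerSeries.rescale p (PowerSeries.mk φ) := by
    ext n
    rw [mul_sub, mul_one, map_sub, ← mul_assoc]
    cases n with
    | zero => simp [PowerSeries.coeff_zero_mul_X, PowerSeries.coeff_rescale]
    | succ n =>
      rw [PowerSeries.coeff_succ_mul_X, mul_comm, PowerSeries.coeff_C_mul]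
      simp only [PowerSeries.coeff_mk, PowerSeries.coeff_rescale]
      linarith [hφ n]
  have e2 : PowerSeries.mk G * (1 - PowerSeries.X) =
      (1 - PowerSeries.C a * PowerSeries.X) * PowerSeries.rescale p (PowerSeries.mk G) := by
    ext n
    rw [mul_sub, mul_one, map_sub, sub_mul, one_mul, map_sub, mul_assoc, PowerSeries.coeff_C_mul]
    cases n with
    | zero => simp [PowerSeries.coeff_zero_mul_X, PowerSeries.coeff_zero_X_mul, PowerSeries.coeff_rescale]
    | succ n =>
      rw [PowerSeries.coeff_succ_mul_X, PowerSeries.coeff_succ_X_mul]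
      simp only [PowerSeries.coeff_mk, PowerSeries.coeff_rescale]
      linarith [hG n]
  have e3 : (PowerSeries.mk φ * PowerSeries.mk G) * (1 - PowerSeries.X) =
      PowerSeries.rescale p (PowerSeries.mk φ * PowerSeries.mk G) := by
    rw [map_mul, mul_assoc, e2, ← mul_assoc, e1]
  set c := PowerSeries.mk φ * PowerSeries.mk G with hc
  ext n
  rw [PowerSeries.coeff_mk]
  induction n with
  | zero => simp [hc, qp, PowerSeries.coeff_mul, hφ0, hG0]
  | succ n ih =>
    have := congrArg (PowerSeries.coeff (n + 1)) e3
    rw [mul_sub, mul_one, map_sub, PowerSeries.coeff_succ_mul_X, PowerSeries.coeff_rescale, ih] at this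
    have hp := pow_lt_one₀ h0 h1 (Nat.succ_ne_zero n)
    have hp' : (1 - p ^ (n + 1)) ≠ 0 := by simp at hp; linarith
    have hq := (qp_pos h0 h1 n).ne'
    rw [qp_succ]
    field_simp
    field_simp at this
    linarith

lemma sum_even (u : ℕ → ℝ) (hu : ∀ j, u (2 * j + 1) = 0) (k : ℕ) :
    ∑ l ∈ Finset.range (2 * k + 1), u l = ∑ j ∈ Finset.range (k + 1), u (2 * j) := by
  induction k with
  | zero => simp
  | succ k ih =>
    rw [show 2 * (k + 1) + 1 = 2 * k + 1 + 1 + 1 by ring, Finset.sum_range_succ, Finset.sum_range_succ,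
      ih, hu, Finset.sum_range_succ _ (k + 1), add_zero, show 2 * k + 1 + 1 = 2 * (k + 1) by ring]

end qs

section fres
variable {F : Type} [Field F] [Fintype F]

local notation "qq" => (Fintype.card F : ℝ)

lemma gl_succ (m : ℕ) : gl F (m + 1) = (qq ^ (m + 1) - 1) * qq ^ m * gl F m := by
  have := gl_split (F := F) 1 m
  rw [add_comm] at this
  simpa using this

lemma gl_zero : gl F 0 = 1 := by simp [gl]

lemma sC_ratio (h2 : (2 : F) ≠ 0) (k : ℕ) :
    sC (1 : F) (2 * k) = qq ^ (2 * k) * sC (-1 : F) (2 * k) := by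
  induction k with
  | zero => simp [sC_zero]
  | succ k ih =>
    rw [show 2 * (k + 1) = 2 * k + 2 by ring, (sC_pos_pair k).2, (sC_pos_pair k).1, ih, sC_neg_rec h2]
    ring

lemma frm_ratio (h2 : (2 : F) ≠ 0) (k : ℕ) : (Nat.card (FrmS (1 : F) (Fin k)) : ℝ) =
    qq ^ k * Nat.card (FrmS (-1 : F) (Fin k)) := by
  induction k with
  | zero => rw [card_FrmS_zero, card_FrmS_zero]; simp
  | succ k ih =>
    rw [frm_pos, ih, frm_neg h2]

lemma q_pow_pos (k : ℕ) : 0 < qq ^ k := pow_pos (by linarith [one_lt_card (F := F)]) _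

lemma q_pow_gt (k : ℕ) : 0 < qq ^ (k + 1) - 1 := by
  have := one_lt_pow₀ (one_lt_card (F := F)) (Nat.succ_ne_zero k)
  simpa using this

noncomputable def pF (F : Type) [Fintype F] : ℝ := ((Fintype.card F : ℝ) ^ 2)⁻¹

lemma pF_nonneg : 0 ≤ pF F := by rw [pF]; positivity
lemma pF_lt : pF F < 1 := by
  rw [pF]
  apply inv_lt_one_of_one_lt₀
  exact one_lt_pow₀ (one_lt_card (F := F)) (by norm_num)

lemma one_sub_pF (k : ℕ) : 1 - pF F ^ (k + 1) = (qq ^ (2 * k + 2) - 1) / qq ^ (2 * k + 2) := by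
  have := (q_pow_pos (F := F) (2 * k + 2)).ne'
  rw [pF, inv_pow, ← pow_mul, show 2 * (k + 1) = 2 * k + 2 by ring]
  field_simp

/-- the left hand side of the Fitting recursion -/
lemma lhs_neg_even (h2 : (2 : F) ≠ 0) (k : ℕ) :
    sC (-1 : F) (2 * k) * Nat.card (FrmS (1 : F) (Fin (2 * k))) / gl F (2 * k) = 1 / qp (pF F) k := by
  induction k with
  | zero => rw [mul_zero, sC_zero, card_FrmS_zero, gl_zero]; simp [qp]
  | succ k ih =>
    rw [show 2 * (k + 1) = 2 * k + 1 + 1 by ring, gl_succ, gl_succ, sC_neg_rec h2, frm_pos, frm_pos,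
      qp_succ, one_sub_pF, ← div_div 1, ← ih]
    have h1 := (q_pow_pos (F := F) (2 * k)).ne'
    have h3 := (q_pow_gt (F := F) (2 * k)).ne'
    have h4 := (q_pow_gt (F := F) (2 * k + 1)).ne'
    have h5 := (gl_pos (F := F) (2 * k)).ne'
    have h6 := (q_pow_pos (F := F) 1).ne'
    rw [show 2 * k + 1 + 1 = 2 * k + 2 by ring] at *
    field_simp

lemma lhs_pos_even (h2 : (2 : F) ≠ 0) (k : ℕ) :
    sC (1 : F) (2 * k) * Nat.card (FrmS (-1 : F) (Fin (2 * k))) / gl F (2 * k) = 1 / qp (pF F) k := by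
  rw [← lhs_neg_even h2, sC_ratio h2, frm_ratio h2]
  ring

lemma lhs_pos_odd (h2 : (2 : F) ≠ 0) (k : ℕ) :
    sC (1 : F) (2 * k + 1) * Nat.card (FrmS (-1 : F) (Fin (2 * k + 1))) / gl F (2 * k + 1) =
      1 / qp (pF F) k := by
  rw [← lhs_pos_even h2, (sC_pos_pair k).1, frm_neg h2, gl_succ]
  have h1 := (q_pow_pos (F := F) (2 * k)).ne'
  have h3 := (q_pow_gt (F := F) (2 * k)).ne'
  have h5 := (gl_pos (F := F) (2 * k)).ne'
  field_simp

noncomputable def gF (F : Type) [Field F] [Fintype F] (j : ℕ) : ℝ :=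
  sC (1 : F) (2 * j) * sC (-1 : F) (2 * j) / gl F (2 * j)

lemma gF_zero : gF F 0 = 1 := by simp [gF, sC_zero, gl_zero]

lemma gF_succ (h2 : (2 : F) ≠ 0) (k : ℕ) : gF F (k + 1) * (1 - pF F ^ (k + 1)) =
    gF F k * (1 - qq⁻¹ * pF F ^ k) := by
  rw [one_sub_pF, gF, gF, pF, inv_pow, ← pow_mul, show 2 * (k + 1) = 2 * k + 1 + 1 by ring, gl_succ,
    gl_succ, sC_neg_rec h2, (sC_pos_pair k).2, (sC_pos_pair k).1]
  have h1 := (q_pow_pos (F := F) (2 * k)).ne'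
  have h3 := (q_pow_gt (F := F) (2 * k)).ne'
  have h4 := (q_pow_gt (F := F) (2 * k + 1)).ne'
  have h5 := (gl_pos (F := F) (2 * k)).ne'
  have h6 : qq ≠ 0 := by have := (q_pow_pos (F := F) 1).ne'; simpa using this
  rw [show 2 * k + 1 + 1 = 2 * k + 2 by ring] at *
  field_simp
  ring

noncomputable def phi (F : Type) [Field F] [Fintype F] (k : ℕ) : ℝ :=
  ((Fintype.card F : ℝ)⁻¹) ^ k / qp (pF F) k

lemma phi_zero : phi F 0 = 1 := by simp [phi, qp]

lemma phi_succ (k : ℕ) : phi F (k + 1) * (1 - pF F ^ (k + 1)) = qq⁻¹ * phi F k := by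
  have h := (qp_pos (pF_nonneg (F := F)) (pF_lt (F := F)) k).ne'
  have h' := (qp_pos (pF_nonneg (F := F)) (pF_lt (F := F)) (k + 1)).ne'
  rw [qp_succ] at h'
  rw [phi, phi, qp_succ]
  have h3 : (1 - pF F ^ (k + 1)) ≠ 0 := right_ne_zero_of_mul h'
  rw [pow_succ]
  field_simp

lemma phi_unique (h2 : (2 : F) ≠ 0) (h : ℕ → ℝ)
    (hh : ∀ k, 1 / qp (pF F) k = ∑ j ∈ Finset.range (k + 1), h (k - j) * gF F j) : h = phi F := by
  have e1 := qdiff (pF_nonneg (F := F)) (pF_lt (F := F)) (qq⁻¹) (phi F) (gF F) phi_zero gF_zero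
    phi_succ (gF_succ h2)
  have e2 : PowerSeries.mk h * PowerSeries.mk (gF F) = PowerSeries.mk (fun k => 1 / qp (pF F) k) := by
    ext n
    rw [mul_comm, PowerSeries.coeff_mul, PowerSeries.coeff_mk, hh,
      Finset.Nat.sum_antidiagonal_eq_sum_range_succ_mk]
    refine Finset.sum_congr rfl fun j _ => ?_
    simp [mul_comm]
  have hne : PowerSeries.mk (gF F) ≠ 0 := by
    intro h0
    have := congrArg (PowerSeries.coeff 0) h0
    rw [PowerSeries.coeff_mk, gF_zero] at this
    simp at this
  have := mul_right_cancel₀ hne (e2.trans e1.symm)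
  funext k
  have := congrArg (PowerSeries.coeff k) this
  simpa using this

lemma fN_neg_odd (h2 : (2 : F) ≠ 0) (k : ℕ) : fN (-1 : F) (2 * k + 1) = 0 := by
  have h := sC_neg_odd h2 k
  rw [sC, Nat.cast_eq_zero, Nat.card_eq_zero] at h
  have : IsEmpty (NilS (-1 : F) (Fin (2 * k + 1))) := by
    rcases h with h | h
    · exact ⟨fun t => h.false ⟨t.1.1, t.2.1, t.2.2.1⟩⟩
    · exact absurd (inferInstance : Finite (SS (-1 : F) (Fin (2 * k + 1)))) (not_finite_iff_infinite.2 h)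
  rw [fN]; simp

lemma fN_neg_even (h2 : (2 : F) ≠ 0) (k : ℕ) : fN (-1 : F) (2 * k) = phi F k := by
  refine congrFun (phi_unique h2 (fun k => fN (-1 : F) (2 * k)) fun k => ?_) k
  have h := fit_rec (F := F) (ε := -1) (by norm_num) (2 * k)
  rw [neg_neg, ← sC, lhs_neg_even h2] at h
  rw [h, sum_even]
  · refine Finset.sum_congr rfl fun j _ => ?_
    rw [show 2 * k - 2 * j = 2 * (k - j) by omega, gF, sC, sC]
    ring
  · intro j
    rw [← sC, sC_neg_odd h2]; simp

lemma fN_pos_even (h2 : (2 : F) ≠ 0) (k : ℕ) : fN (1 : F) (2 * k) = phi F k := by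
  refine congrFun (phi_unique h2 (fun k => fN (1 : F) (2 * k)) fun k => ?_) k
  have h := fit_rec (F := F) (ε := 1) (by norm_num) (2 * k)
  rw [← sC, lhs_pos_even h2] at h
  rw [h, sum_even]
  · refine Finset.sum_congr rfl fun j _ => ?_
    rw [show 2 * k - 2 * j = 2 * (k - j) by omega, gF, sC, sC]
  · intro j
    rw [← sC, ← sC, sC_neg_odd h2]; simp

lemma fN_pos_odd (h2 : (2 : F) ≠ 0) (k : ℕ) : fN (1 : F) (2 * k + 1) = phi F k := by
  refine congrFun (phi_unique h2 (fun k => fN (1 : F) (2 * k + 1)) fun k => ?_) k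
  have h := fit_rec (F := F) (ε := 1) (by norm_num) (2 * k + 1)
  rw [← sC, lhs_pos_odd h2] at h
  rw [h, Finset.sum_range_succ, sum_even]
  · rw [← sC, ← sC, sC_neg_odd h2, mul_zero, zero_div, mul_zero, add_zero]
    refine Finset.sum_congr rfl fun j hj => ?_
    rw [Finset.mem_range] at hj
    rw [show 2 * k + 1 - 2 * j = 2 * (k - j) + 1 by omega, gF, sC, sC]
  · intro j
    rw [← sC, ← sC, sC_neg_odd h2]; simp

/-- relation with the order of the symplectic group -/
lemma sC_neg_order (h2 : (2 : F) ≠ 0) (n : ℕ) : sC (-1 : F) (2 * n) *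
    (qq ^ (n ^ 2) * ∏ i ∈ Finset.range n, (qq ^ (2 * (i + 1)) - 1)) = gl F (2 * n) := by
  induction n with
  | zero => simp [sC_zero, gl_zero]
  | succ n ih =>
    rw [show 2 * (n + 1) = 2 * n + 1 + 1 by ring, gl_succ, gl_succ, sC_neg_rec h2, ← ih,
      Finset.prod_range_succ]
    ring

end fres
end FF

namespace FF
section Darb
variable {F : Type} [Field F] [Fintype F]

def JJ (F : Type) [Field F] (α : Type) [DecidableEq α] : Matrix (α ⊕ α) (α ⊕ α) F :=
  fromBlocks 0 1 (-1) 0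

lemma JJ_step {α β : Type} [Fintype α] [DecidableEq α] [Fintype β] [DecidableEq β] 
    (σ : Matrix β β F) (e : Matrix β (Fin 1) F) (Ps : Matrix β (α ⊕ α) F)
    (hPs : Psᵀ * σ * Ps = JJ F α) :
    ∃ R : Matrix (Fin 1 ⊕ (β ⊕ Fin 1)) ((Fin 1 ⊕ α) ⊕ (Fin 1 ⊕ α)) F,
      Rᵀ * (fromBlocks (0 : Matrix (Fin 1) (Fin 1) F) (fromCols 0 1 : Matrix (Fin 1) (β ⊕ Fin 1) F)
      ((-1 : F) • (fromCols 0 1 : Matrix (Fin 1) (β ⊕ Fin 1) F)ᵀ)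
        (fromBlocks σ e ((-1 : F) • eᵀ) 0)) * R = JJ F (Fin 1 ⊕ α) := by
  obtain ⟨U, hU⟩ : ∃ U : Matrix (Fin 1) ((Fin 1 ⊕ α) ⊕ (Fin 1 ⊕ α)) F,
    U = fromCols (fromCols 1 0) 0 := ⟨_, rfl⟩
  obtain ⟨R4, hR4⟩ : ∃ U : Matrix (Fin 1) ((Fin 1 ⊕ α) ⊕ (Fin 1 ⊕ α)) F,
    U = fromCols 0 (fromCols 1 0) := ⟨_, rfl⟩
  obtain ⟨V, hV⟩ : ∃ U : Matrix (α ⊕ α) ((Fin 1 ⊕ α) ⊕ (Fin 1 ⊕ α)) F,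
    U = fromBlocks (fromCols 0 1) 0 0 (fromCols 0 1) := ⟨_, rfl⟩
  have key : Uᵀ * R4 - R4ᵀ * U + Vᵀ * (JJ F α * V) = JJ F (Fin 1 ⊕ α) := by
    rw [hU, hR4, hV, JJ, JJ]
    simp only [transpose_fromCols, fromBlocks_transpose, fromBlocks_multiply, fromRows_mul_fromCols]
    ext ((i | i) | (i | i)) ((j | j) | (j | j)) <;>
      simp [fromRows_mul, mul_fromCols, fromBlocks, Matrix.one_apply]
  obtain ⟨R3, hR3⟩ : ∃ R3, R3 = Ps * V := ⟨_, rfl⟩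
  refine ⟨fromRows (U - eᵀ * R3) (fromRows R3 R4), ?_⟩
  have h1 : (fromBlocks (0 : Matrix (Fin 1) (Fin 1) F) (fromCols 0 1 : Matrix (Fin 1) (β ⊕ Fin 1) F)
      ((-1 : F) • (fromCols 0 1 : Matrix (Fin 1) (β ⊕ Fin 1) F)ᵀ)
        (fromBlocks σ e ((-1 : F) • eᵀ) 0)) * (fromRows (U - eᵀ * R3) (fromRows R3 R4)) =
      fromRows R4 (fromRows (σ * R3 + e * R4) (-(U - eᵀ * R3) - eᵀ * R3)) := by
    rw [fromBlocks_mul_fromRows, transpose_fromCols, fromCols_mul_fromRows, fromBlocks_mul_fromRows]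
    congr 1
    · simp
    · ext (i | i) j <;> simp [fromRows_mul, sub_eq_add_neg]
  rw [Matrix.mul_assoc, h1, transpose_fromRows, fromCols_mul_fromRows, transpose_fromRows,
    fromCols_mul_fromRows, ← key, ← hPs]
  have h3 : Vᵀ * (Psᵀ * σ * Ps * V) = R3ᵀ * (σ * R3) := by
    rw [hR3, transpose_mul]; simp only [Matrix.mul_assoc]
  rw [h3]
  simp only [transpose_sub, transpose_mul, transpose_transpose, Matrix.sub_mul, Matrix.mul_sub,
    Matrix.mul_add, Matrix.mul_neg, Matrix.mul_assoc]
  abel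

lemma darboux_aux (h2 : (2 : F) ≠ 0) (n : ℕ) : ∀ (ι : Type) [Fintype ι] [DecidableEq ι]
    (ω : Matrix ι ι F), Fintype.card ι = 2 * n → ω ∈ SS (-1 : F) ι →
    ∃ (α : Type) (_ : Fintype α) (_ : DecidableEq α) (P : Matrix ι (α ⊕ α) F),
      Fintype.card α = n ∧ Pᵀ * ω * P = JJ F α := by
  induction n with
  | zero =>
    intro ι _ _ ω hι _
    have : IsEmpty ι := by rw [← Fintype.card_eq_zero_iff]; omega
    exact ⟨Fin 0, inferInstance, inferInstance, 0, by simp, by ext (i | i); exact i.elim0; exact i.elim0⟩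
  | succ n ih =>
    intro ι _ _ ω hι hω
    obtain ⟨P0, P0', e1, e2⟩ := exists_perm (F := F) (ι := ι) (κ := Fin 1 ⊕ Fin (2 * n + 1))
      (by simp; omega)
    have hs := tr_sym P0 hω.1
    have hu := tr_unit e1 e2 hω.2
    obtain ⟨a, η, c, h1, ha, hc⟩ := (mem_frm_block (ε := (-1 : F)) (by norm_num) _).1 hs
    have ha := skew_one h2 ha
    subst ha
    rw [h1] at hu
    have hz : c ∈ ZS (-1 : F) η := ⟨hc, hu⟩
    obtain ⟨Q, Q', f1, f2, f3⟩ := right_normal η (row_indep (ZS_ne hz)) (m := 2 * n) (by simp; omega)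
    have hz2 := ZS_tr η f1 f2 hz
    rw [f3] at hz2
    obtain ⟨σ, e, d, g1, hσ, hd⟩ := (mem_frm_block (ε := (-1 : F)) (by norm_num) _).1 hz2.1
    have hd := skew_one h2 hd
    subst hd
    have hu2 := hz2.2
    rw [g1, ZS_unit (by norm_num)] at hu2
    obtain ⟨α, i1, i2, Ps, hα, hPs⟩ := ih (Fin (2 * n)) σ (by simp) ⟨hσ, hu2⟩
    obtain ⟨R, hR⟩ := JJ_step σ e Ps hPs
    obtain ⟨G, hG⟩ : ∃ G : Matrix (Fin 1 ⊕ Fin (2 * n + 1)) (Fin 1 ⊕ (Fin (2 * n) ⊕ Fin 1)) F,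
      G = fromBlocks 1 0 0 Q := ⟨_, rfl⟩
    refine ⟨Fin 1 ⊕ α, inferInstance, inferInstance, P0 * G * R, by simp [hα]; omega, ?_⟩
    rw [← hR, ← g1, ← f3]
    have : Gᵀ * (P0ᵀ * ω * P0) * G =
        fromBlocks 0 (η * Q) ((-1 : F) • (η * Q)ᵀ) (Qᵀ * c * Q) := by
      rw [h1, hG, fromBlocks_transpose, fromBlocks_multiply, fromBlocks_multiply]
      simp [transpose_mul]
    rw [← this]
    simp only [transpose_mul, Matrix.mul_assoc]

lemma darboux (h2 : (2 : F) ≠ 0) (n : ℕ) (ω : Matrix (Fin n ⊕ Fin n) (Fin n ⊕ Fin n) F)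
    (hω : ω ∈ SS (-1 : F) (Fin n ⊕ Fin n)) :
    ∃ P P' : Matrix (Fin n ⊕ Fin n) (Fin n ⊕ Fin n) F, P * P' = 1 ∧ P' * P = 1 ∧
      Pᵀ * ω * P = sympJ F n := by
  obtain ⟨α, _, _, P, hα, hP⟩ := darboux_aux h2 n _ ω (by simp; omega) hω
  have eα : Fin n ≃ α := (Fintype.equivFinOfCardEq hα).symm
  have hJ : Pᵀ.submatrix (Sum.map eα eα) id * ω * P.submatrix id (Sum.map eα eα) = sympJ F n := by
    have := congrArg (fun M => M.submatrix (Sum.map eα eα) (Sum.map eα eα)) hP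
    rw [submatrix_mul _ _ _ id _ Function.bijective_id, submatrix_mul _ _ _ id _ Function.bijective_id] at this
    rw [submatrix_id_id] at this
    rw [this, JJ, sympJ]
    ext (i | i) (j | j) <;> simp [Matrix.one_apply]
  set P1 := P.submatrix id (Sum.map eα eα) with hP1
  have hP1t : Pᵀ.submatrix (Sum.map eα eα) id = P1ᵀ := by rw [hP1]; rfl
  rw [hP1t] at hJ
  have hJJ : (-sympJ F n) * sympJ F n = 1 := by
    rw [sympJ, fromBlocks_neg, fromBlocks_multiply]; simp
  have h3 : ((-sympJ F n) * P1ᵀ * ω) * P1 = 1 := by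
    rw [← hJJ, ← hJ]; simp [Matrix.mul_assoc]
  exact ⟨P1, (-sympJ F n) * P1ᵀ * ω, mul_eq_one_comm.1 h3, h3, hJ⟩

lemma sympJ_mem (n : ℕ) : sympJ F n ∈ SS (-1 : F) (Fin n ⊕ Fin n) := by
  constructor
  · rw [sympJ, fromBlocks_transpose, fromBlocks_smul]; simp
  · apply IsUnit.of_mul_eq_one_right (-sympJ F n)
    rw [sympJ, fromBlocks_neg, fromBlocks_multiply]; simp

lemma sym_iff (n : ℕ) (A : Matrix (Fin n ⊕ Fin n) (Fin n ⊕ Fin n) F) :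
    A * sympJ F n = (A * sympJ F n)ᵀ ↔ Aᵀ * sympJ F n = -(sympJ F n * A) := by
  have hJJ : sympJ F n * sympJ F n = -1 := by
    rw [sympJ, fromBlocks_multiply, ← fromBlocks_one, fromBlocks_neg]; simp
  have hJt : (sympJ F n)ᵀ = - sympJ F n := by
    have := (sympJ_mem (F := F) n).1; simpa using this
  rw [transpose_mul, hJt]
  generalize sympJ F n = J at *
  constructor
  · intro h
    have := congrArg (fun M => J * M * J) h
    have h4 : J * (A * J) * J = -(J * A) := by
      rw [Matrix.mul_assoc, Matrix.mul_assoc, hJJ]; simp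
    have h5 : J * (-J * Aᵀ) * J = Aᵀ * J := by
      rw [← Matrix.mul_assoc, Matrix.mul_neg, hJJ]; simp
    rw [← h5, ← this, h4]
  · intro h
    have := congrArg (fun M => J * M * J) h
    have h4 : J * (Aᵀ * J) * J = -(J * Aᵀ) := by
      rw [Matrix.mul_assoc, Matrix.mul_assoc, hJJ]; simp
    have h5 : J * (-(J * A)) * J = A * J := by
      rw [Matrix.mul_neg, ← Matrix.mul_assoc, hJJ]; simp
    rw [← h5, ← this, h4, Matrix.neg_mul]

def fibX (n : ℕ) (ω : Matrix (Fin n ⊕ Fin n) (Fin n ⊕ Fin n) F) :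
    Set (Matrix (Fin n ⊕ Fin n) (Fin n ⊕ Fin n) F × Matrix (Fin n ⊕ Fin n) (Fin n ⊕ Fin n) F) :=
  {t | IsX (-1 : F) ω t.1 t.2}

lemma card_fibX_J (n : ℕ) : Nat.card (fibX (F := F) n (sympJ F n)) = spNilCommPairs F n := by
  refine Nat.card_congr (Equiv.subtypeEquivRight fun t => ?_)
  rw [sym_iff, sym_iff]
  constructor
  · intro h; exact ⟨h.skA, h.skB, h.nA, h.nB, h.com⟩
  · rintro ⟨h1, h3, h4, h5, h6⟩
    exact ⟨(sympJ_mem n).1, (sympJ_mem n).2, h1, h3, h4, h5, h6⟩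

lemma card_fibX (h2 : (2 : F) ≠ 0) (n : ℕ) {ω : Matrix (Fin n ⊕ Fin n) (Fin n ⊕ Fin n) F}
    (hω : ω ∈ SS (-1 : F) (Fin n ⊕ Fin n)) : Nat.card (fibX n ω) = spNilCommPairs F n := by
  rw [← card_fibX_J]
  obtain ⟨P, P', h1, h3, hP⟩ := darboux h2 n ω hω
  have hP' : P'ᵀ * sympJ F n * P' = ω := by rw [← hP, tr_inv h1]
  refine Nat.card_congr (Equiv.mk
    (fun t => ⟨(P' * t.1.1 * P, P' * t.1.2 * P), by
      have := IsX.tr t.2 h1 h3; rwa [hP] at this⟩)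
    (fun t => ⟨(P * t.1.1 * P', P * t.1.2 * P'), by
      have := IsX.tr t.2 h3 h1; rwa [hP'] at this⟩) ?_ ?_)
  · rintro ⟨⟨A, B⟩, ht⟩
    simp [cj_inv h1]
  · rintro ⟨⟨A, B⟩, ht⟩
    simp [cj_inv h3]

lemma NS_eq (h2 : (2 : F) ≠ 0) (n : ℕ) :
    (spNilCommPairs F n : ℝ) / spOrder (Fintype.card F) n =
      ∑ w ∈ Finset.range (2 * n + 1), TX (-1 : F) (2 * n) w := by
  have h1 : ∑ w ∈ Finset.range (2 * n + 1), Nat.card (XS (-1 : F) (Fin n ⊕ Fin n) w) =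
      Nat.card {t : Matrix (Fin n ⊕ Fin n) (Fin n ⊕ Fin n) F × Matrix (Fin n ⊕ Fin n) (Fin n ⊕ Fin n) F
        × Matrix (Fin n ⊕ Fin n) (Fin n ⊕ Fin n) F | IsX (-1 : F) t.1 t.2.1 t.2.2} := by
    classical
    have := Finset.card_eq_sum_card_fiberwise (s := {t : Matrix (Fin n ⊕ Fin n) (Fin n ⊕ Fin n) F × Matrix (Fin n ⊕ Fin n) (Fin n ⊕ Fin n) F
        × Matrix (Fin n ⊕ Fin n) (Fin n ⊕ Fin n) F | IsX (-1 : F) t.1 t.2.1 t.2.2}.toFinset)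
      (t := Finset.range (2 * n + 1)) (f := fun t => t.2.1.rank) (by
        intro t _
        have := rank_le_card_height t.2.1
        simp at this ⊢; omega)
    rw [Nat.card_eq_fintype_card, ← Set.toFinset_card, this]
    refine Finset.sum_congr rfl fun l _ => ?_
    rw [Nat.card_eq_fintype_card, ← Set.toFinset_card]
    congr 1
    ext t
    rw [Set.mem_toFinset, Finset.mem_filter, Set.mem_toFinset]; rfl
  have h3 : Nat.card {t : Matrix (Fin n ⊕ Fin n) (Fin n ⊕ Fin n) F × Matrix (Fin n ⊕ Fin n) (Fin n ⊕ Fin n) F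
        × Matrix (Fin n ⊕ Fin n) (Fin n ⊕ Fin n) F | IsX (-1 : F) t.1 t.2.1 t.2.2} =
      Nat.card (SS (-1 : F) (Fin n ⊕ Fin n)) * spNilCommPairs F n := by
    classical
    have : ∑ ω : SS (-1 : F) (Fin n ⊕ Fin n), Nat.card (fibX n ω.1) =
        Nat.card (SS (-1 : F) (Fin n ⊕ Fin n)) * spNilCommPairs F n := by
      rw [Finset.sum_congr rfl fun ω _ => card_fibX h2 n ω.2]
      simp
    rw [← this, ← Nat.card_sigma]
    refine Nat.card_congr (Equiv.mk (fun t => ⟨⟨t.1.1, t.2.sym, t.2.unit⟩, ⟨t.1.2, t.2⟩⟩)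
      (fun t => ⟨(t.1.1, t.2.1), t.2.2⟩) ?_ ?_)
    · intro t; rfl
    · intro t; rfl
  rw [h3] at h1
  have h4 := sC_neg_order h2 n
  rw [← spOrder, sC, card_SS (κ := Fin n ⊕ Fin n) (-1 : F) (by simp; omega)] at h4
  have hg := gl_pos (F := F) (2 * n)
  rw [← h4] at hg
  have ho : spOrder (Fintype.card F) n ≠ 0 := right_ne_zero_of_mul hg.ne'
  have hs : (Nat.card (SS (-1 : F) (Fin n ⊕ Fin n)) : ℝ) ≠ 0 := left_ne_zero_of_mul hg.ne'
  simp only [TX]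
  rw [← Finset.sum_div, Finset.sum_congr rfl fun w _ => by
    rw [card_XS (κ := Fin n ⊕ Fin n) (-1 : F) w (by simp; omega)], ← Nat.cast_sum, h1, ← h4]
  push_cast
  field_simp

lemma TX_odd (h2 : (2 : F) ≠ 0) (k w : ℕ) : TX (-1 : F) (2 * k + 1) w = 0 := by
  have h := sC_neg_odd h2 k
  rw [sC, Nat.cast_eq_zero, Nat.card_eq_zero] at h
  have : IsEmpty (XS (-1 : F) (Fin (2 * k + 1)) w) := by
    rcases h with h | h
    · exact ⟨fun t => h.false ⟨t.1.1, t.2.1.sym, t.2.1.unit⟩⟩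
    · exact absurd (inferInstance : Finite (SS (-1 : F) (Fin (2 * k + 1)))) (not_finite_iff_infinite.2 h)
  rw [TX]; simp

lemma TX_diag (ε : F) (v : ℕ) (hv : v ≠ 0) : TX ε v v = 0 := by
  have : IsEmpty (XS ε (Fin v) v) := by
    refine ⟨fun t => ?_⟩
    obtain ⟨⟨ω, A, B⟩, hX, hr⟩ := t
    have hu : IsUnit A := by
      rw [← Matrix.mulVec_surjective_iff_isUnit]
      have h3 : LinearMap.range A.mulVecLin = ⊤ := by
        apply Submodule.eq_top_of_finrank_eq
        rw [Module.finrank_fintype_fun_eq_card, Fintype.card_fin]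
        exact hr
      intro y
      have : y ∈ LinearMap.range A.mulVecLin := by rw [h3]; trivial
      exact this
    have : NeZero v := ⟨hv⟩
    obtain ⟨k, hk⟩ := hX.nA
    dsimp only at hk
    exact not_isUnit_zero (hk ▸ hu.pow k)
  rw [TX]; simp

lemma TX_zero (ε : F) : TX ε 0 0 = 1 := by
  have : XS ε (Fin 0) 0 = Set.univ := by
    ext ⟨ω, A, B⟩
    simp only [Set.mem_univ, iff_true]
    refine ⟨⟨Subsingleton.elim _ _, isUnit_of_subsingleton _, Subsingleton.elim _ _,
      Subsingleton.elim _ _, ⟨1, Subsingleton.elim _ _⟩, ⟨1, Subsingleton.elim _ _⟩,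
      Subsingleton.elim _ _⟩, ?_⟩
    have := rank_le_card_height A
    simpa using this
  rw [TX, this, gl_zero, Nat.card_univ, Nat.card_prod, Nat.card_prod]
  push_cast
  rw [card_mat]
  simp

end Darb
end FF

namespace FF

/-! ### Abstract analysis of the two-type recursion -/

/-- depth-truncated version of the recursion -/
noncomputable def Td (f : Bool → ℕ → ℝ) : ℕ → Bool → ℕ → ℕ → ℝ
  | 0, _, c, w => if c = 0 ∧ w = 0 then 1 else 0
  | d + 1, b, c, w => ∑ c' ∈ Finset.range (min c w + 1), f b (c - c') * Td f d (!b) c' (w - c')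

/-- the finite products of generating functions -/
noncomputable def PP {𝕜 : Type} [RCLike 𝕜] (f : Bool → ℕ → ℝ) (x : 𝕜) : ℕ → Bool → ℕ → 𝕜
  | 0, _, _ => 1
  | d + 1, b, i => (∑' m, ((f b m : ℝ) : 𝕜) * (x ^ i) ^ m) * PP f x d (!b) (i + 1)

lemma Td_nonneg (f : Bool → ℕ → ℝ) (hf : ∀ b m, 0 ≤ f b m) (d : ℕ) :
    ∀ b c w, 0 ≤ Td f d b c w := by
  induction d with
  | zero => intro b c w; rw [Td]; split_ifs <;> norm_num
  | succ d ih =>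
    intro b c w; rw [Td]
    exact Finset.sum_nonneg fun i _ => mul_nonneg (hf _ _) (ih _ _ _)

lemma Td_le (f : Bool → ℕ → ℝ) (hf : ∀ b m, 0 ≤ f b m) (T : Bool → ℕ → ℕ → ℝ)
    (hT0 : ∀ b c w, 0 ≤ T b c w) (hT1 : ∀ b, T b 0 0 = 1)
    (hT : ∀ b c w, T b c w = ∑ c' ∈ Finset.range (min c w + 1), f b (c - c') * T (!b) c' (w - c'))
    (d : ℕ) : ∀ b c w, Td f d b c w ≤ T b c w := by
  induction d with
  | zero =>
    intro b c w; rw [Td]; split_ifs with h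
    · rw [h.1, h.2, hT1]
    · exact hT0 _ _ _
  | succ d ih =>
    intro b c w; rw [Td, hT]
    exact Finset.sum_le_sum fun i _ => mul_le_mul_of_nonneg_left (ih _ _ _) (hf _ _)

lemma Td_zero_left (f : Bool → ℕ → ℝ) (hf1 : ∀ b, f b 0 = 1) (d : ℕ) :
    ∀ b w, Td f d b 0 w = if w = 0 then 1 else 0 := by
  induction d with
  | zero => intro b w; rw [Td]; simp
  | succ d ih => intro b w; rw [Td]; simp [ih, hf1]

lemma Td_eq (f : Bool → ℕ → ℝ) (hf1 : ∀ b, f b 0 = 1) (T : Bool → ℕ → ℕ → ℝ)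
    (hT1 : ∀ b w, T b 0 w = if w = 0 then 1 else 0)
    (hT : ∀ b c w, T b c w = ∑ c' ∈ Finset.range (min c w + 1), f b (c - c') * T (!b) c' (w - c'))
    (d : ℕ) : ∀ b c w, c + w < d → Td f d b c w = T b c w := by
  induction d with
  | zero => intro b c w h; omega
  | succ d ih =>
    intro b c w h
    rcases Nat.eq_zero_or_pos c with rfl | hc
    · rw [Td_zero_left f hf1, hT1]
    rw [Td, hT]
    refine Finset.sum_congr rfl fun i hi => ?_
    rw [Finset.mem_range] at hi
    rw [ih _ _ _ (by omega)]

lemma f_summable {𝕜 : Type} [RCLike 𝕜] (f : ℕ → ℝ) (hf : ∀ m, 0 ≤ f m) (hf' : ∀ m, f m ≤ 1)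
    (a : 𝕜) (ha : ‖a‖ < 1) : Summable fun m => ‖((f m : ℝ) : 𝕜) * a ^ m‖ := by
  refine Summable.of_nonneg_of_le (fun _ => norm_nonneg _) (fun m => ?_)
    (summable_geometric_of_lt_one (norm_nonneg a) ha)
  rw [norm_mul, RCLike.norm_ofReal, abs_of_nonneg (hf m), norm_pow]
  exact mul_le_of_le_one_left (by positivity) (hf' m)

lemma Td_hasSum {𝕜 : Type} [RCLike 𝕜] (f : Bool → ℕ → ℝ) (hf : ∀ b m, 0 ≤ f b m)
    (hf' : ∀ b m, f b m ≤ 1) (x : 𝕜) (hx : ‖x‖ < 1) (d : ℕ) :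
    ∀ b i, 0 < i → 
      HasSum (fun cw : ℕ × ℕ => ((Td f d b cw.1 cw.2 : ℝ) : 𝕜) * x ^ (i * cw.1 + cw.2))
        (PP f x d b i) := by
  induction d with
  | zero =>
    intro b i hi
    rw [PP]
    convert hasSum_ite_eq ((0 : ℕ), (0 : ℕ)) (1 : 𝕜) using 1
    funext cw
    obtain ⟨c, w⟩ := cw
    rw [Td]
    by_cases h : c = 0 ∧ w = 0
    · obtain ⟨rfl, rfl⟩ := h; simp
    · rw [if_neg h, if_neg (by rw [Prod.ext_iff]; exact h)]; simp
  | succ d ih =>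
    intro b i hi
    rw [PP]
    have h1 := ih (!b) (i + 1) (by omega)
    have h1n := h1.summable.norm
    have hxi : ‖x ^ i‖ < 1 := by
      rw [norm_pow]; exact pow_lt_one₀ (norm_nonneg _) hx (by omega)
    have h2n := f_summable (f b) (hf b) (hf' b) (x ^ i) hxi
    have h3 := (summable_mul_of_summable_norm h2n h1n).hasSum
    rw [← tsum_mul_tsum_of_summable_norm h2n h1n, h1.tsum_eq] at h3
    have h4 := h3.tsum_fiberwise (fun z : ℕ × (ℕ × ℕ) => (z.1 + z.2.1, z.2.1 + z.2.2))
    refine Eq.mp (congrArg (fun g => HasSum g _) (funext fun cw => ?_)) h4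
    symm
    obtain ⟨c, w⟩ := cw
    have hset : ((fun z : ℕ × (ℕ × ℕ) => (z.1 + z.2.1, z.2.1 + z.2.2)) ⁻¹' {(c, w)}) =
        ↑((Finset.range (min c w + 1)).image (fun c' => (c - c', (c', w - c')))) := by
      ext ⟨m, c', w'⟩
      simp only [Set.mem_preimage, Set.mem_singleton_iff, Prod.mk.injEq, Finset.coe_image,
        Set.mem_image, Finset.coe_range, Set.mem_Iio]
      constructor
      · rintro ⟨h, h'⟩; exact ⟨c', by omega, by omega, rfl, by omega⟩
      · rintro ⟨k, h, h', h'', h'''⟩; omega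
    rw [hset, Finset.tsum_subtype' _ (fun z : ℕ × (ℕ × ℕ) => ((f b z.1 : ℝ) : 𝕜) * (x ^ i) ^ z.1 *
      (((Td f d (!b) z.2.1 z.2.2 : ℝ) : 𝕜) * x ^ ((i + 1) * z.2.1 + z.2.2))), Finset.sum_image]
    · dsimp only
      rw [Td, RCLike.ofReal_sum, Finset.sum_mul]
      refine Finset.sum_congr rfl fun k hk => ?_
      rw [Finset.mem_range] at hk
      have e : x ^ (i * c + w) = (x ^ i) ^ (c - k) * x ^ ((i + 1) * k + (w - k)) := by
        rw [← pow_mul, ← pow_add]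
        congr 1
        obtain ⟨c0, rfl⟩ : ∃ c0, c = c0 + k := ⟨c - k, by omega⟩
        obtain ⟨w0, rfl⟩ : ∃ w0, w = w0 + k := ⟨w - k, by omega⟩
        simp only [Nat.add_sub_cancel]
        ring
      rw [e, RCLike.ofReal_mul]
      ring
    · intro a _ a' _ h
      exact (Prod.ext_iff.1 (Prod.ext_iff.1 h).2).1

lemma PP_bound (f : Bool → ℕ → ℝ) (hf : ∀ b m, 0 ≤ f b m)
    (hf' : ∀ b m, f b m ≤ 1) (hf1 : ∀ b, f b 0 = 1) (y : ℝ) (hy0 : 0 ≤ y) (hy : y < 1) (d : ℕ) :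
    ∀ b i, 0 < i → 0 ≤ PP f y d b i ∧
      PP f y d b i ≤ Real.exp (∑ j ∈ Finset.range d, y ^ (i + j) / (1 - y)) := by
  induction d with
  | zero => intro b i hi; simp [PP]
  | succ d ih =>
    intro b i hi
    obtain ⟨h1, h2⟩ := ih (!b) (i + 1) (by omega)
    have hyi : y ^ i < 1 := pow_lt_one₀ hy0 hy (by omega)
    have hyi0 : 0 ≤ y ^ i := pow_nonneg hy0 i
    have hs : Summable fun m => f b m * (y ^ i) ^ m := by
      have := (f_summable (𝕜 := ℝ) (f b) (hf b) (hf' b) (y ^ i) (by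
        rw [Real.norm_of_nonneg hyi0]; exact hyi)).of_norm
      simpa using this
    have hG0 : 0 ≤ ∑' m, f b m * (y ^ i) ^ m :=
      tsum_nonneg fun m => mul_nonneg (hf _ _) (pow_nonneg hyi0 _)
    have hG : ∑' m, f b m * (y ^ i) ^ m ≤ Real.exp (y ^ i / (1 - y)) := by
      rw [hs.tsum_eq_zero_add]
      have h3 : ∑' m, f b (m + 1) * (y ^ i) ^ (m + 1) ≤ ∑' m, y ^ i * y ^ m := by
        refine Summable.tsum_le_tsum (fun m => ?_) ((summable_nat_add_iff 1).2 hs)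
          ((summable_geometric_of_lt_one hy0 hy).mul_left _)
        calc f b (m + 1) * (y ^ i) ^ (m + 1) ≤ (y ^ i) ^ (m + 1) :=
              mul_le_of_le_one_left (pow_nonneg hyi0 _) (hf' _ _)
          _ = y ^ i * (y ^ i) ^ m := by ring
          _ ≤ y ^ i * y ^ m := by
              refine mul_le_mul_of_nonneg_left (pow_le_pow_left₀ hyi0 ?_ m) hyi0
              exact pow_le_of_le_one hy0 hy.le (by omega)
      rw [tsum_mul_left, tsum_geometric_of_lt_one hy0 hy] at h3
      have := Real.add_one_le_exp (y ^ i / (1 - y))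
      rw [hf1]; simp only [pow_zero, mul_one]
      rw [div_eq_mul_inv] at this ⊢
      linarith
    rw [PP]
    simp only [RCLike.ofReal_real_eq_id, id]
    refine ⟨mul_nonneg hG0 h1, ?_⟩
    rw [Finset.sum_range_succ', Real.exp_add, add_zero, mul_comm (Real.exp _)]
    refine mul_le_mul hG (h2.trans_eq ?_) h1 (Real.exp_nonneg _)
    congr 1
    exact Finset.sum_congr rfl fun j _ => by congr 2; omega

lemma T_summable (f : Bool → ℕ → ℝ) (hf : ∀ b m, 0 ≤ f b m)
    (hf' : ∀ b m, f b m ≤ 1) (hf1 : ∀ b, f b 0 = 1) (T : Bool → ℕ → ℕ → ℝ)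
    (hT0 : ∀ b c w, 0 ≤ T b c w) (hT1 : ∀ b w, T b 0 w = if w = 0 then 1 else 0)
    (hT : ∀ b c w, T b c w = ∑ c' ∈ Finset.range (min c w + 1), f b (c - c') * T (!b) c' (w - c'))
    (b : Bool) (y : ℝ) (hy0 : 0 ≤ y) (hy : y < 1) :
    Summable fun cw : ℕ × ℕ => T b cw.1 cw.2 * y ^ (cw.1 + cw.2) := by
  have hny : ‖y‖ < 1 := by rwa [Real.norm_of_nonneg hy0]
  refine summable_of_sum_le (c := Real.exp ((1 - y)⁻¹ / (1 - y))) ?_ ?_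
  · intro cw; exact mul_nonneg (hT0 _ _ _) (pow_nonneg hy0 _)
  intro S
  obtain ⟨d, hd⟩ : ∃ d, ∀ cw ∈ S, cw.1 + cw.2 < d := by
    refine ⟨S.sup (fun cw => cw.1 + cw.2) + 1, fun cw h => ?_⟩
    exact Nat.lt_succ_of_le (Finset.le_sup (f := fun cw : ℕ × ℕ => cw.1 + cw.2) h)
  have h := Td_hasSum (𝕜 := ℝ) f hf hf' y hny d b 1 one_pos
  simp only [RCLike.ofReal_real_eq_id, id, one_mul] at h
  have h1 : ∑ cw ∈ S, T b cw.1 cw.2 * y ^ (cw.1 + cw.2) ≤ PP f y d b 1 := by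
    rw [← h.tsum_eq]
    calc _ = ∑ cw ∈ S, Td f d b cw.1 cw.2 * y ^ (cw.1 + cw.2) :=
          Finset.sum_congr rfl fun cw hcw => by rw [Td_eq f hf1 T hT1 hT d b _ _ (hd cw hcw)]
      _ ≤ _ := h.summable.sum_le_tsum S fun cw _ =>
          mul_nonneg (Td_nonneg f hf _ _ _ _) (pow_nonneg hy0 _)
  refine (h1.trans (PP_bound f hf hf' hf1 y hy0 hy d b 1 one_pos).2).trans ?_
  apply Real.exp_le_exp.2
  rw [← Finset.sum_div]
  refine div_le_div_of_nonneg_right ?_ (by linarith)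
  calc ∑ j ∈ Finset.range d, y ^ (1 + j) ≤ ∑ j ∈ Finset.range d, y ^ j :=
        Finset.sum_le_sum fun j _ => pow_le_pow_of_le_one hy0 hy.le (by omega)
    _ ≤ ∑' j, y ^ j := (summable_geometric_of_lt_one hy0 hy).sum_le_tsum _
        fun j _ => pow_nonneg hy0 j
    _ = _ := tsum_geometric_of_lt_one hy0 hy

lemma T_limit {𝕜 : Type} [RCLike 𝕜] (f : Bool → ℕ → ℝ) (hf : ∀ b m, 0 ≤ f b m)
    (hf' : ∀ b m, f b m ≤ 1) (hf1 : ∀ b, f b 0 = 1) (T : Bool → ℕ → ℕ → ℝ)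
    (hT0 : ∀ b c w, 0 ≤ T b c w) (hT1 : ∀ b w, T b 0 w = if w = 0 then 1 else 0)
    (hT : ∀ b c w, T b c w = ∑ c' ∈ Finset.range (min c w + 1), f b (c - c') * T (!b) c' (w - c'))
    (b : Bool) (x : 𝕜) (hx : ‖x‖ < 1) :
    Summable (fun cw : ℕ × ℕ => ((T b cw.1 cw.2 : ℝ) : 𝕜) * x ^ (cw.1 + cw.2)) ∧
    Filter.Tendsto (fun d => PP f x d b 1) Filter.atTop
      (nhds (∑' cw : ℕ × ℕ, ((T b cw.1 cw.2 : ℝ) : 𝕜) * x ^ (cw.1 + cw.2))) := by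
  have hb := T_summable f hf hf' hf1 T hT0 hT1 hT b ‖x‖ (norm_nonneg _) hx
  constructor
  · refine Summable.of_norm_bounded hb fun cw => ?_
    rw [norm_mul, norm_pow, RCLike.norm_ofReal, abs_of_nonneg (hT0 _ _ _)]
  have e : (fun d => PP f x d b 1) = fun d =>
      ∑' cw : ℕ × ℕ, ((Td f d b cw.1 cw.2 : ℝ) : 𝕜) * x ^ (cw.1 + cw.2) := by
    funext d
    have := (Td_hasSum f hf hf' x hx d b 1 one_pos).tsum_eq
    simp only [one_mul] at this
    exact this.symm
  rw [e]
  refine tendsto_tsum_of_dominated_convergence hb (fun cw => ?_) (Filter.Eventually.of_forall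
    fun d cw => ?_)
  · refine tendsto_const_nhds.congr' ?_
    filter_upwards [Filter.eventually_gt_atTop (cw.1 + cw.2)] with d hd
    rw [Td_eq f hf1 T hT1 hT d b _ _ hd]
  · rw [norm_mul, norm_pow, RCLike.norm_ofReal, abs_of_nonneg (Td_nonneg f hf _ _ _ _)]
    exact mul_le_mul_of_nonneg_right
      (Td_le f hf T hT0 (fun b => by rw [hT1]; simp) hT d _ _ _) (by positivity)

end FF

namespace FF

variable {F : Type} [Field F] [Fintype F]

local notation "qq" => (Fintype.card F : ℝ)

noncomputable def sg (F : Type) [Field F] (b : Bool) : F := if b then 1 else -1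

lemma sg_sq (b : Bool) : sg F b * sg F b = 1 := by cases b <;> simp [sg]

lemma sg_not (b : Bool) : sg F (!b) = - sg F b := by cases b <;> simp [sg]

lemma q_ge_three (h2 : (2 : F) ≠ 0) : (3 : ℝ) ≤ qq := by
  have h1 : 1 < Fintype.card F := Fintype.one_lt_card
  have h3 : Fintype.card F ≠ 2 := by
    intro h
    have := Nat.cast_card_eq_zero F
    rw [h] at this
    exact h2 (by exact_mod_cast this)
  exact_mod_cast (by omega : 3 ≤ Fintype.card F)

lemma phi_nonneg (k : ℕ) : 0 ≤ phi F k := by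
  rw [phi]
  have := qp_pos (pF_nonneg (F := F)) (pF_lt (F := F)) k
  positivity

lemma phi_le_one (h2 : (2 : F) ≠ 0) (k : ℕ) : phi F k ≤ 1 := by
  induction k with
  | zero => rw [phi_zero]
  | succ k ih =>
    have h3 := q_ge_three h2
    have h := phi_succ (F := F) k
    have hq : qq⁻¹ ≤ 1 / 3 := by
      rw [inv_eq_one_div]; exact one_div_le_one_div_of_le (by norm_num) h3
    have hq0 : 0 ≤ qq⁻¹ := by positivity
    have hp : pF F ≤ 1 / 3 := by
      rw [pF, ← inv_pow]; nlinarith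
    have hp' : pF F ^ (k + 1) ≤ 1 / 3 :=
      (pow_le_of_le_one pF_nonneg pF_lt.le (by omega)).trans hp
    have h0 := phi_nonneg (F := F) k
    have h1 := phi_nonneg (F := F) (k + 1)
    nlinarith

lemma fN_sg_nonneg (b : Bool) (m : ℕ) : 0 ≤ fN (sg F b) m := by
  rw [fN]
  have := (gl_pos (F := F) m).le
  positivity

lemma fN_sg_le_one (h2 : (2 : F) ≠ 0) (b : Bool) (m : ℕ) : fN (sg F b) m ≤ 1 := by
  rcases Nat.even_or_odd' m with ⟨k, rfl | rfl⟩ <;> cases b <;> simp only [sg]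
  · simpa [fN_neg_even h2] using phi_le_one h2 k
  · simpa [fN_pos_even h2] using phi_le_one h2 k
  · simp [fN_neg_odd h2]
  · simpa [fN_pos_odd h2] using phi_le_one h2 k

lemma fN_sg_zero (h2 : (2 : F) ≠ 0) (b : Bool) : fN (sg F b) 0 = 1 := by
  cases b
  · simpa [sg, phi_zero] using fN_neg_even h2 0
  · simpa [sg, phi_zero] using fN_pos_even h2 0

lemma TX_nonneg (ε : F) (v w : ℕ) : 0 ≤ TX ε v w := by
  rw [TX]
  have := (gl_pos (F := F) v).le
  positivity

lemma T_rec (h2 : (2 : F) ≠ 0) (b : Bool) (c w : ℕ) :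
    TX (sg F b) (w + c) w = ∑ c' ∈ Finset.range (min c w + 1),
      fN (sg F b) (c - c') * TX (sg F (!b)) (w - c' + c') (w - c') := by
  rw [TX_rec h2 (sg_sq b), sg_not, ← Finset.sum_range_reflect]
  symm
  have hsub : Finset.range (min c w + 1) ⊆ Finset.range (w + 1) :=
    Finset.range_subset_range.2 (by omega)
  refine (Finset.sum_congr rfl fun k hk => ?_).trans (Finset.sum_subset hsub fun k hk hk' => ?_)
  · rw [Finset.mem_range] at hk
    rw [if_pos (by omega)]
    congr 2 <;> omega
  · rw [Finset.mem_range] at hk hk'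
    rw [if_neg (by omega)]

lemma T_zero_left (b : Bool) (w : ℕ) : TX (sg F b) (w + 0) w = if w = 0 then 1 else 0 := by
  rw [add_zero]
  split_ifs with h
  · subst h; exact TX_zero _
  · exact TX_diag _ _ h

/-! ### The Euler function -/

noncomputable def EE (F : Type) [Field F] [Fintype F] (v : ℝ) : ℝ := ∑' k, phi F k * v ^ k

lemma EE_summable (h2 : (2 : F) ≠ 0) (v : ℝ) (hv : |v| < 1) :
    Summable fun k => phi F k * v ^ k := by
  have := (f_summable (𝕜 := ℝ) (phi F) phi_nonneg (phi_le_one h2) v hv).of_norm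
  simpa using this

lemma EE_zero : EE F 0 = 1 := by
  rw [EE, tsum_eq_single 0]
  · simp [phi_zero]
  · intro k hk; simp [hk]

lemma EE_func (h2 : (2 : F) ≠ 0) (v : ℝ) (hv : |v| < 1) :
    EE F v * (1 - v * qq⁻¹) = EE F (pF F * v) := by
  have hp0 := pF_nonneg (F := F)
  have hp1 := pF_lt (F := F)
  have hs := EE_summable h2 v hv
  have hpv : |pF F * v| < 1 := by
    rw [abs_mul, abs_of_nonneg hp0]
    nlinarith [abs_nonneg v]
  have hs' := EE_summable h2 _ hpv
  have h1 : EE F v - EE F (pF F * v) = v * qq⁻¹ * EE F v := by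
    rw [EE, EE, ← hs.tsum_sub hs', (hs.sub hs').tsum_eq_zero_add, ← tsum_mul_left]
    simp only [pow_zero, mul_one, sub_self, zero_add]
    refine tsum_congr fun k => ?_
    have := phi_succ (F := F) k
    rw [mul_pow]
    linear_combination v ^ (k + 1) * this
  linarith

lemma EE_tendsto (h2 : (2 : F) ≠ 0) (v : ℝ) (hv : |v| < 1) :
    Filter.Tendsto (fun n : ℕ => EE F (pF F ^ n * v)) Filter.atTop (nhds 1) := by
  have hp0 := pF_nonneg (F := F)
  have hp1 := pF_lt (F := F)
  rw [← EE_zero (F := F)]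
  refine tendsto_tsum_of_dominated_convergence (bound := fun k => |v| ^ k)
    (summable_geometric_of_lt_one (abs_nonneg _) hv) (fun k => ?_)
    (Filter.Eventually.of_forall fun n k => ?_)
  · have h0 : Filter.Tendsto (fun n : ℕ => pF F ^ n * v) Filter.atTop (nhds 0) := by
      simpa using (tendsto_pow_atTop_nhds_zero_of_lt_one hp0 hp1).mul_const v
    exact (h0.pow k).const_mul _
  · rw [norm_mul, Real.norm_of_nonneg (phi_nonneg k), norm_pow, norm_mul, norm_pow,
      Real.norm_of_nonneg hp0, Real.norm_eq_abs]
    calc phi F k * (pF F ^ n * |v|) ^ k ≤ 1 * (1 * |v|) ^ k := by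
          have := pow_le_one₀ (n := n) hp0 hp1.le
          have := phi_le_one h2 k
          have := phi_nonneg (F := F) k
          gcongr
      _ = _ := by simp

lemma q_zpow (l : ℕ) : qq ^ (-(2 * l + 1 : ℤ)) = pF F ^ l * qq⁻¹ := by
  have hq : qq ≠ 0 := by
    have : 0 < Fintype.card F := Fintype.card_pos
    positivity
  rw [pF, _root_.zpow_neg, ← inv_pow, ← pow_mul, ← pow_succ, inv_pow]
  norm_cast

lemma a_bound (h2 : (2 : F) ≠ 0) (v : ℝ) (hv : |v| < 1) (l : ℕ) :
    |v * qq ^ (-(2 * l + 1 : ℤ))| ≤ |v| * pF F ^ l ∧ |v * qq ^ (-(2 * l + 1 : ℤ))| ≤ 1 / 3 := by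
  have hp0 := pF_nonneg (F := F)
  have hp1 := pF_lt (F := F)
  have h3 := q_ge_three h2
  have hq : qq⁻¹ ≤ 1 / 3 := by
    rw [inv_eq_one_div]; exact one_div_le_one_div_of_le (by norm_num) h3
  have hq0 : 0 ≤ qq⁻¹ := by positivity
  have hl := pow_le_one₀ (n := l) hp0 hp1.le
  have hl0 := pow_nonneg hp0 l
  rw [q_zpow, abs_mul, abs_of_nonneg (mul_nonneg hl0 hq0)]
  constructor
  · refine mul_le_mul_of_nonneg_left ?_ (abs_nonneg _)
    nlinarith
  · calc |v| * (pF F ^ l * qq⁻¹) ≤ 1 * (1 * (1 / 3)) := by gcongr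
      _ = _ := by norm_num

/-- the factor `(1-a)⁻¹` as `1 + b` with `b` small -/
lemma inv_form (a : ℝ) (ha : |a| ≤ 1 / 3) : (1 - a)⁻¹ = 1 + a / (1 - a) ∧ |a / (1 - a)| ≤ 2 * |a| := by
  have h1 : 2 / 3 ≤ 1 - a := by have := (abs_le.1 ha).2; linarith
  constructor
  · field_simp; ring
  · rw [abs_div, abs_of_pos (by linarith : 0 < 1 - a), div_le_iff₀ (by linarith)]
    nlinarith [abs_nonneg a]

lemma mult_pairs (h2 : (2 : F) ≠ 0) (u : ℝ) (hu : |u| < 1) :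
    Multipliable (fun il : ℕ × ℕ => (1 - u ^ (il.1 + 1) * qq ^ (-(2 * il.2 + 1 : ℤ)))⁻¹) := by
  have hp0 := pF_nonneg (F := F)
  have hp1 := pF_lt (F := F)
  have hui : ∀ i, |u ^ (i + 1)| < 1 := fun i => by
    rw [abs_pow]; exact pow_lt_one₀ (abs_nonneg _) hu (by omega)
  have e : (fun il : ℕ × ℕ => (1 - u ^ (il.1 + 1) * qq ^ (-(2 * il.2 + 1 : ℤ)))⁻¹) =
      fun il : ℕ × ℕ => 1 + (u ^ (il.1 + 1) * qq ^ (-(2 * il.2 + 1 : ℤ))) /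
        (1 - u ^ (il.1 + 1) * qq ^ (-(2 * il.2 + 1 : ℤ))) := by
    funext il
    exact (inv_form _ (a_bound h2 _ (hui _) _).2).1
  rw [e]
  apply multipliable_one_add_of_summable
  have hs : Summable fun il : ℕ × ℕ => |u| ^ il.1 * pF F ^ il.2 :=
    (summable_geometric_of_lt_one (abs_nonneg u) hu).mul_of_nonneg
      (summable_geometric_of_lt_one hp0 hp1) (fun _ => by positivity) (fun _ => pow_nonneg hp0 _)
  refine Summable.of_nonneg_of_le (fun _ => norm_nonneg _) (fun il => ?_) (hs.mul_left 2)
  refine (inv_form _ (a_bound h2 _ (hui _) _).2).2.trans ?_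
  refine mul_le_mul_of_nonneg_left ((a_bound h2 _ (hui _) _).1.trans ?_) (by norm_num)
  rw [abs_pow]
  exact mul_le_mul_of_nonneg_right
    (pow_le_pow_of_le_one (abs_nonneg _) hu.le (by omega)) (pow_nonneg hp0 _)

lemma EE_hasProd (h2 : (2 : F) ≠ 0) (v : ℝ) (hv : |v| < 1) :
    HasProd (fun l : ℕ => (1 - v * qq ^ (-(2 * l + 1 : ℤ)))⁻¹) (EE F v) := by
  have hp0 := pF_nonneg (F := F)
  have hp1 := pF_lt (F := F)
  have hm : Multipliable (fun l : ℕ => (1 - v * qq ^ (-(2 * l + 1 : ℤ)))⁻¹) := by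
    have e : (fun l : ℕ => (1 - v * qq ^ (-(2 * l + 1 : ℤ)))⁻¹) =
        fun l : ℕ => 1 + (v * qq ^ (-(2 * l + 1 : ℤ))) / (1 - v * qq ^ (-(2 * l + 1 : ℤ))) := by
      funext l
      exact (inv_form _ (a_bound h2 _ hv _).2).1
    rw [e]
    apply multipliable_one_add_of_summable
    refine Summable.of_nonneg_of_le (fun _ => norm_nonneg _) (fun l => ?_)
      ((summable_geometric_of_lt_one hp0 hp1).mul_left 2)
    refine (inv_form _ (a_bound h2 _ hv _).2).2.trans ?_
    refine mul_le_mul_of_nonneg_left ((a_bound h2 _ hv _).1.trans ?_) (by norm_num)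
    exact mul_le_of_le_one_left (pow_nonneg hp0 _) hv.le
  have h1 := hm.tendsto_prod_tprod_nat
  have h3 : ∀ n : ℕ, EE F v =
      (∏ l ∈ Finset.range n, (1 - v * qq ^ (-(2 * l + 1 : ℤ)))⁻¹) * EE F (pF F ^ n * v) := by
    intro n
    induction n with
    | zero => simp
    | succ n ih =>
      have hb := (abs_le.1 (a_bound h2 v hv n).2).2
      have hpv : |pF F ^ n * v| < 1 := by
        rw [abs_mul, abs_of_nonneg (pow_nonneg hp0 n)]
        have := pow_le_one₀ (n := n) hp0 hp1.le
        nlinarith [abs_nonneg v, pow_nonneg hp0 n]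
      have hf := EE_func h2 _ hpv
      have e1 : pF F ^ n * v * qq⁻¹ = v * qq ^ (-(2 * n + 1 : ℤ)) := by rw [q_zpow]; ring
      rw [e1] at hf
      rw [Finset.prod_range_succ, pow_succ', mul_assoc (pF F), ← hf, ih]
      have : (1 - v * qq ^ (-(2 * n + 1 : ℤ))) ≠ 0 := by linarith
      field_simp
  have h4 := h1.mul (EE_tendsto h2 v hv)
  rw [mul_one] at h4
  have h5 : EE F v = ∏' l : ℕ, (1 - v * qq ^ (-(2 * l + 1 : ℤ)))⁻¹ := by
    refine tendsto_nhds_unique ?_ h4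
    exact tendsto_const_nhds.congr h3
  rw [h5]
  exact hm.hasProd

/-! ### Generating functions of the `fN` -/

lemma even_odd_C (f : ℕ → ℂ) (a b : ℂ) (h : HasSum (fun k => f (2 * k)) a)
    (h' : HasSum (fun k => f (2 * k + 1)) b) : ∑' m, f m = a + b :=
  (h.even_add_odd h').tsum_eq

lemma hasSum_even_C (g : ℕ → ℂ) (a : ℂ) (h : HasSum g a) (h0 : ∀ k, g (2 * k + 1) = 0) :
    HasSum (fun n => g (2 * n)) a := by
  have hinj : Function.Injective (fun n : ℕ => 2 * n) := fun a b h => by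
    dsimp only at h; omega
  refine (hinj.hasSum_iff ?_).2 h
  intro v hv
  rcases Nat.even_or_odd' v with ⟨k, rfl | rfl⟩
  · exact absurd ⟨k, rfl⟩ hv
  · exact h0 k

lemma hasSum_fun_congr {f g : ℕ → ℂ} {a : ℂ} (h : ∀ k, g k = f k) (hf : HasSum f a) :
    HasSum g a := by
  rw [funext h]; exact hf

lemma EE_hasSum_C (h2 : (2 : F) ≠ 0) (v : ℝ) (hv : |v| < 1) :
    HasSum (fun k => ((phi F k : ℝ) : ℂ) * (v : ℂ) ^ k) (EE F v : ℂ) := by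
  have := Complex.hasSum_ofReal.2 (EE_summable h2 v hv).hasSum
  simpa [EE] using this

lemma G_neg (h2 : (2 : F) ≠ 0) (a : ℂ) (v : ℝ) (hv : |v| < 1) (ha : a ^ 2 = v) :
    ∑' m, ((fN (sg F false) m : ℝ) : ℂ) * a ^ m = EE F v := by
  have h1 := EE_hasSum_C h2 v hv
  have h3 : HasSum (fun k => ((fN (sg F false) (2 * k) : ℝ) : ℂ) * a ^ (2 * k)) (EE F v : ℂ) := by
    refine hasSum_fun_congr (fun k => ?_) h1
    rw [pow_mul, ha]; simp [sg, fN_neg_even h2]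
  have h4 : HasSum (fun k => ((fN (sg F false) (2 * k + 1) : ℝ) : ℂ) * a ^ (2 * k + 1)) 0 := by
    refine hasSum_fun_congr (fun k => ?_) (hasSum_zero (α := ℂ) (β := ℕ))
    simp [sg, fN_neg_odd h2]
  rw [even_odd_C (fun m => ((fN (sg F false) m : ℝ) : ℂ) * a ^ m) _ _ h3 h4, add_zero]

lemma G_pos (h2 : (2 : F) ≠ 0) (a : ℂ) (v : ℝ) (hv : |v| < 1) (ha : a ^ 2 = v) :
    ∑' m, ((fN (sg F true) m : ℝ) : ℂ) * a ^ m = (1 + a) * EE F v := by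
  have h1 := EE_hasSum_C h2 v hv
  have h3 : HasSum (fun k => ((fN (sg F true) (2 * k) : ℝ) : ℂ) * a ^ (2 * k)) (EE F v : ℂ) := by
    refine hasSum_fun_congr (fun k => ?_) h1
    rw [pow_mul, ha]; simp [sg, fN_pos_even h2]
  have h4 : HasSum (fun k => ((fN (sg F true) (2 * k + 1) : ℝ) : ℂ) * a ^ (2 * k + 1))
      (a * EE F v) := by
    refine hasSum_fun_congr (fun k => ?_) (h1.mul_left a)
    rw [pow_succ, pow_mul, ha]
    simp [sg, fN_pos_odd h2]
    ring
  rw [even_odd_C (fun m => ((fN (sg F true) m : ℝ) : ℂ) * a ^ m) _ _ h3 h4]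
  ring

lemma PP_even (h2 : (2 : F) ≠ 0) (u : ℝ) (hu : |u| < 1) (x : ℂ) (hx : x ^ 2 = u) (D : ℕ) :
    ∀ k, PP (fun b m => fN (sg F b) m) x (2 * D) false (2 * k + 1) =
      (((∏ j ∈ Finset.range D, (1 + u ^ (k + j + 1))) *
        ∏ i ∈ Finset.range (2 * D), EE F (u ^ (2 * k + i + 1)) : ℝ) : ℂ) := by
  have hui : ∀ i, |u ^ (i + 1)| < 1 := fun i => by
    rw [abs_pow]; exact pow_lt_one₀ (abs_nonneg _) hu (by omega)
  induction D with
  | zero => intro k; simp [PP]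
  | succ D ih =>
    intro k
    rw [show 2 * (D + 1) = 2 * D + 1 + 1 by ring, PP, PP]
    have e1 := G_neg h2 (x ^ (2 * k + 1)) (u ^ (2 * k + 1)) (hui _) (by
      rw [← pow_mul, mul_comm, pow_mul, hx]; norm_cast)
    have e2 := G_pos h2 (x ^ (2 * k + 1 + 1)) (u ^ (2 * k + 1 + 1)) (hui _) (by
      rw [← pow_mul, mul_comm, pow_mul, hx]; norm_cast)
    have e3 := ih (k + 1)
    have e4 : x ^ (2 * k + 1 + 1) = ((u ^ (k + 1) : ℝ) : ℂ) := by
      rw [show 2 * k + 1 + 1 = 2 * (k + 1) by ring, pow_mul, hx]; norm_cast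
    rw [e4] at e2
    simp only [Bool.not_false, Bool.not_true]
    rw [e4]
    rw [show 2 * k + 1 + 1 + 1 = 2 * (k + 1) + 1 by ring, e3]
    have e1' : (∑' m, ((fN (sg F false) m : ℝ) : ℂ) * (x ^ (2 * k + 1)) ^ m) = _ := e1
    have key : ∀ (A B C : ℂ) (a b : ℂ), A = a → B = b → A * (B * C) = a * (b * C) := by
      intro A B C a b h h'; rw [h, h']
    refine (key _ _ _ _ _ e1 e2).trans ?_
    rw [Finset.prod_range_succ', Finset.prod_range_succ', Finset.prod_range_succ' _ (2 * D)]
    have p1 : ∏ j ∈ Finset.range D, (1 + u ^ (k + (j + 1) + 1)) =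
        ∏ j ∈ Finset.range D, (1 + u ^ (k + 1 + j + 1)) :=
      Finset.prod_congr rfl fun j _ => by congr 2; ring
    have p2 : ∏ i ∈ Finset.range (2 * D), EE F (u ^ (2 * k + (i + 1 + 1) + 1)) =
        ∏ i ∈ Finset.range (2 * D), EE F (u ^ (2 * (k + 1) + i + 1)) :=
      Finset.prod_congr rfl fun j _ => by congr 2; ring
    rw [p1, p2]
    push_cast
    simp only [add_zero, zero_add]
    ring

set_option maxHeartbeats 1000000 in
/-- the main theorem, in terms of `F` -/
lemma main (h2 : (2 : F) ≠ 0) (u : ℝ) (hu : |u| < 1) :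
    Multipliable (fun i : ℕ => 1 + u ^ (i + 1)) ∧
    HasSum (fun n : ℕ => (spNilCommPairs F n : ℝ) * u ^ n / spOrder (Fintype.card F) n)
      ((∏' i : ℕ, (1 + u ^ (i + 1))) *
        ∏' il : ℕ × ℕ, (1 - u ^ (il.1 + 1) * qq ^ (-(2 * il.2 + 1 : ℤ)))⁻¹) := by
  have hui : ∀ i, |u ^ (i + 1)| < 1 := fun i => by
    rw [abs_pow]; exact pow_lt_one₀ (abs_nonneg _) hu (by omega)
  have hm1 : Multipliable (fun i : ℕ => 1 + u ^ (i + 1)) := by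
    apply multipliable_one_add_of_summable
    simp only [norm_pow, Real.norm_eq_abs]
    exact (summable_nat_add_iff 1).2 (summable_geometric_of_lt_one (abs_nonneg u) hu)
  refine ⟨hm1, ?_⟩
  have hm2 := mult_pairs h2 u hu
  have hE : HasProd (fun i : ℕ => EE F (u ^ (i + 1)))
      (∏' il : ℕ × ℕ, (1 - u ^ (il.1 + 1) * qq ^ (-(2 * il.2 + 1 : ℤ)))⁻¹) :=
    hm2.hasProd.prod_fiberwise fun i => EE_hasProd h2 _ (hui i)
  obtain ⟨x, hx⟩ : ∃ x : ℂ, x ^ 2 = (u : ℂ) := IsAlgClosed.exists_pow_nat_eq _ (by norm_num)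
  have hxn : ‖x‖ < 1 := by
    have : ‖x‖ ^ 2 = |u| := by rw [← norm_pow, hx, Complex.norm_real, Real.norm_eq_abs]
    by_contra h
    push Not at h
    have := one_le_pow₀ (n := 2) h
    linarith
  obtain ⟨hs, hlim⟩ := T_limit (𝕜 := ℂ) (fun b m => fN (sg F b) m) fN_sg_nonneg
    (fN_sg_le_one h2) (fN_sg_zero h2) (fun b c w => TX (sg F b) (w + c) w)
    (fun b c w => TX_nonneg _ _ _) T_zero_left (T_rec h2) false x hxn
  have hev : Filter.Tendsto (fun D : ℕ => 2 * D) Filter.atTop Filter.atTop :=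
    Filter.tendsto_id.const_mul_atTop' (by norm_num)
  have hlim2 := hlim.comp hev
  have e1 : ((fun d => PP (fun b m => fN (sg F b) m) x d false 1) ∘ fun D : ℕ => 2 * D) =
      fun D : ℕ => (((∏ j ∈ Finset.range D, (1 + u ^ (j + 1))) *
        ∏ i ∈ Finset.range (2 * D), EE F (u ^ (i + 1)) : ℝ) : ℂ) := by
    funext D
    have := PP_even h2 u hu x hx D 0
    simpa using this
  rw [e1] at hlim2
  have hlim3 : Filter.Tendsto (fun D : ℕ => (((∏ j ∈ Finset.range D, (1 + u ^ (j + 1))) *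
        ∏ i ∈ Finset.range (2 * D), EE F (u ^ (i + 1)) : ℝ) : ℂ)) Filter.atTop
      (nhds (((∏' i : ℕ, (1 + u ^ (i + 1))) *
        ∏' il : ℕ × ℕ, (1 - u ^ (il.1 + 1) * qq ^ (-(2 * il.2 + 1 : ℤ)))⁻¹ : ℝ) : ℂ)) :=
    (Complex.continuous_ofReal.tendsto _).comp
      (hm1.tendsto_prod_tprod_nat.mul (hE.tendsto_prod_nat.comp hev))
  have heq := tendsto_nhds_unique hlim2 hlim3
  have hS := hs.hasSum
  rw [heq] at hS
  have hS2 := hS.tsum_fiberwise (fun cw : ℕ × ℕ => cw.1 + cw.2)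
  have e2 : ∀ v : ℕ, (∑' cw : ((fun cw : ℕ × ℕ => cw.1 + cw.2) ⁻¹' {v} : Set (ℕ × ℕ)),
      ((TX (sg F false) (cw.1.2 + cw.1.1) cw.1.2 : ℝ) : ℂ) * x ^ (cw.1.1 + cw.1.2)) =
      ((∑ w ∈ Finset.range (v + 1), TX (-1 : F) v w : ℝ) : ℂ) * x ^ v := by
    intro v
    have hset : ((fun cw : ℕ × ℕ => cw.1 + cw.2) ⁻¹' {v}) =
        ↑((Finset.range (v + 1)).image (fun w => (v - w, w))) := by
      ext ⟨c, w⟩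
      simp only [Set.mem_preimage, Set.mem_singleton_iff, Prod.mk.injEq, Finset.coe_image,
        Set.mem_image, Finset.coe_range, Set.mem_Iio]
      constructor
      · intro h; exact ⟨w, by omega, by omega, rfl⟩
      · rintro ⟨k, h, h', h''⟩; omega
    rw [hset, Finset.tsum_subtype' _ (fun cw : ℕ × ℕ =>
      ((TX (sg F false) (cw.2 + cw.1) cw.2 : ℝ) : ℂ) * x ^ (cw.1 + cw.2)), Finset.sum_image]
    · dsimp only
      rw [Complex.ofReal_sum, Finset.sum_mul]
      refine Finset.sum_congr rfl fun w hw => ?_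
      rw [Finset.mem_range] at hw
      rw [show w + (v - w) = v by omega, show v - w + w = v by omega]
      simp [sg]
    · intro a _ a' _ h
      exact (Prod.ext_iff.1 h).2
  have e2' := funext e2
  have hS3 : HasSum (fun v : ℕ => ((∑ w ∈ Finset.range (v + 1), TX (-1 : F) v w : ℝ) : ℂ) * x ^ v)
      (((∏' i : ℕ, (1 + u ^ (i + 1))) *
        ∏' il : ℕ × ℕ, (1 - u ^ (il.1 + 1) * qq ^ (-(2 * il.2 + 1 : ℤ)))⁻¹ : ℝ) : ℂ) := by
    rw [← e2']
    exact hS2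
  have hS4 := hasSum_even_C (fun v : ℕ =>
    ((∑ w ∈ Finset.range (v + 1), TX (-1 : F) v w : ℝ) : ℂ) * x ^ v) _ hS3 (fun k => by
      rw [Finset.sum_eq_zero fun w _ => TX_odd h2 k w]; simp)
  rw [← Complex.hasSum_ofReal]
  refine hasSum_fun_congr (fun n => ?_) hS4
  rw [← NS_eq h2 n, pow_mul, hx]
  push_cast
  ring

end FF

theorem feit_fine_symplectic_nilpotent
    (q : ℕ) (hq : ∃ p m : ℕ, p.Prime ∧ 0 < m ∧ q = p ^ m) (hodd : Odd q)
    (F : Type) [Field F] [Fintype F] (hF : Fintype.card F = q)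
    (u : ℝ) (hu : |u| < 1 / q) :
    Summable (fun n : ℕ => (spNilCommPairs F n : ℝ) * u ^ n / spOrder q n) ∧
    Multipliable (fun i : ℕ => 1 + u ^ (i + 1)) ∧
    Multipliable (fun il : ℕ × ℕ =>
      (1 - u ^ (il.1 + 1) * (q : ℝ) ^ (-(2 * il.2 + 1 : ℤ)))⁻¹) ∧
    ∑' n : ℕ, (spNilCommPairs F n : ℝ) * u ^ n / spOrder q n =
      (∏' i : ℕ, (1 + u ^ (i + 1))) *
        ∏' il : ℕ × ℕ, (1 - u ^ (il.1 + 1) * (q : ℝ) ^ (-(2 * il.2 + 1 : ℤ)))⁻¹ := by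
  subst hF
  have h2 : (2 : F) ≠ 0 := by
    intro h
    obtain ⟨k, hk⟩ := hodd
    have h0 := Nat.cast_card_eq_zero F
    rw [hk] at h0
    push_cast at h0
    rw [h, zero_mul, zero_add] at h0
    exact one_ne_zero h0
  have hu1 : |u| < 1 := by
    refine hu.trans_le ?_
    have := FF.q_ge_three h2
    rw [div_le_one (by linarith)]
    linarith
  obtain ⟨h1, h3⟩ := FF.main h2 u hu1
  exact ⟨h3.summable, h1, FF.mult_pairs h2 u hu1, h3.tsum_eq⟩
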